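/- arXiv:2404.17349 — 3 statements merged into one kernel-verified Lean document; each statement's English description precedes it below -/
import Mathlib

section
/- For every n ≥ 1, the following two subsets of ℝ^n coincide (this common polytope realizes the strong rectangulotope SRP(n)): (i) the convex hull of the points Σ_{1≤i<j≤n} (𝓎^R_{i,j} − 𝓎'^R_{i,j})·(e_i − e_j), taken over all generic rectangulations R of size n, where 𝓎^R_{i,j} = h^T_i · cv^{T,S}_{i,j} · h^S_j · ⟦¬(i‖j)⟧ and 𝓎'^R_{i,j} = v^S_i · ch^{S,T}_{i,j} · v^T_j · ⟦¬(i⦀j)⟧, with S = S(R) and T = T(R) (this point depends only on the strong equivalence class of R, so the points are indexed by strong rectangulations of size n); (ii) the set of x ∈ ℝ^n with Σ_{i∈[n]} x_i = 0 and, for every nonempty proper subset X ⊊ [n], Σ_{i∈X} x_i ≤ #{(I,J) : I ⊄ X and J ⊄ [n]∖X} + #{(I,J) : I ⊄ [n]∖X and J ⊄ X}, where (I,J) ranges over all pairs of nonempty consecutive intervals of [n]. -/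
open Classical Pointwise

noncomputable section

/-- An interval of `[n]`: a nonempty set of consecutive integers. -/
def IsInterval {n : ℕ} (I : Finset (Fin n)) : Prop :=
  I.Nonempty ∧ ∀ a b c : Fin n, a ∈ I → c ∈ I → a ≤ b → b ≤ c → b ∈ I

/-- Two intervals `I`, `J` of `[n]` are consecutive if `max I = min J − 1`. -/
def ConsecIntervals {n : ℕ} (I J : Finset (Fin n)) : Prop :=
  ∃ (hI : IsInterval I) (hJ : IsInterval J),
    (I.max' hI.1 : ℕ) + 1 = (J.min' hJ.1 : ℕ)

/-- The standard basis vector `e i` of `ℝ^n`. -/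
def stdVec (n : ℕ) (i : Fin n) : Fin n → ℝ := fun k => if k = i then 1 else 0

/-- `f_≍(X)`: number of intervals of `[n]` contained neither in `X` nor in its complement. -/
def fWeak (n : ℕ) (X : Finset (Fin n)) : ℕ :=
  {I : Finset (Fin n) | IsInterval I ∧ ¬ I ⊆ X ∧ ¬ I ⊆ Xᶜ}.ncard

/-- `f_⥮(X)`. -/
def fStrong (n : ℕ) (X : Finset (Fin n)) : ℕ :=
  {p : Finset (Fin n) × Finset (Fin n) |
      ConsecIntervals p.1 p.2 ∧ ¬ p.1 ⊆ X ∧ ¬ p.2 ⊆ Xᶜ}.ncard +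
  {p : Finset (Fin n) × Finset (Fin n) |
      ConsecIntervals p.1 p.2 ∧ ¬ p.1 ⊆ Xᶜ ∧ ¬ p.2 ⊆ X}.ncard


/-- A rectangulation of size `n`: a decomposition of the unit square into `n`
axis-parallel rectangles with pairwise disjoint interiors.  Rectangle `i` is
`[xl i, xr i] × [yb i, yt i]`. -/
structure Rectangulation (n : ℕ) where
  xl : Fin n → ℝ
  xr : Fin n → ℝ
  yb : Fin n → ℝ
  yt : Fin n → ℝ
  lt_x : ∀ i, xl i < xr i
  lt_y : ∀ i, yb i < yt i
  xl_nonneg : ∀ i, 0 ≤ xl i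
  xr_le_one : ∀ i, xr i ≤ 1
  yb_nonneg : ∀ i, 0 ≤ yb i
  yt_le_one : ∀ i, yt i ≤ 1
  interiors_disjoint : ∀ i j, i ≠ j →
    ¬ ∃ p : ℝ × ℝ, (xl i < p.1 ∧ p.1 < xr i ∧ yb i < p.2 ∧ p.2 < yt i) ∧
      (xl j < p.1 ∧ p.1 < xr j ∧ yb j < p.2 ∧ p.2 < yt j)
  cover : ∀ p : ℝ × ℝ, 0 ≤ p.1 → p.1 ≤ 1 → 0 ≤ p.2 → p.2 ≤ 1 →
    ∃ i, xl i ≤ p.1 ∧ p.1 ≤ xr i ∧ yb i ≤ p.2 ∧ p.2 ≤ yt i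

namespace Rectangulation

variable {n : ℕ} (R : Rectangulation n)

/-- `p` is a corner (vertex) of rectangle `i`. -/
def IsCorner (i : Fin n) (p : ℝ × ℝ) : Prop :=
  (p.1 = R.xl i ∨ p.1 = R.xr i) ∧ (p.2 = R.yb i ∨ p.2 = R.yt i)

/-- `R` is generic: no four rectangles have a common vertex. -/
def Generic : Prop :=
  ¬ ∃ (p : ℝ × ℝ) (i j k l : Fin n),
    i ≠ j ∧ i ≠ k ∧ i ≠ l ∧ j ≠ k ∧ j ≠ l ∧ k ≠ l ∧
    R.IsCorner i p ∧ R.IsCorner j p ∧ R.IsCorner k p ∧ R.IsCorner l p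

/-- `p` lies on a horizontal edge of some rectangle of `R`. -/
def OnHorizEdge (p : ℝ × ℝ) : Prop :=
  ∃ i, (p.2 = R.yb i ∨ p.2 = R.yt i) ∧ R.xl i ≤ p.1 ∧ p.1 ≤ R.xr i

/-- `p` lies on a vertical edge of some rectangle of `R`. -/
def OnVertEdge (p : ℝ × ℝ) : Prop :=
  ∃ i, (p.1 = R.xl i ∨ p.1 = R.xr i) ∧ R.yb i ≤ p.2 ∧ p.2 ≤ R.yt i

/-- The horizontal edges `[a₁,b₁] × {y}` and `[a₂,b₂] × {y}` lie on the same
(horizontal) segment of `R`: `y` is not on the boundary of the square and every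
point between the two edges lies on a horizontal edge of a rectangle. -/
def SameHSeg (y a₁ b₁ a₂ b₂ : ℝ) : Prop :=
  0 < y ∧ y < 1 ∧ ∀ x : ℝ, min a₁ a₂ ≤ x → x ≤ max b₁ b₂ → R.OnHorizEdge (x, y)

/-- The vertical edges `{x} × [a₁,b₁]` and `{x} × [a₂,b₂]` lie on the same
(vertical) segment of `R`. -/
def SameVSeg (x a₁ b₁ a₂ b₂ : ℝ) : Prop :=
  0 < x ∧ x < 1 ∧ ∀ y : ℝ, min a₁ a₂ ≤ y → y ≤ max b₁ b₂ → R.OnVertEdge (x, y)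

/-- Rectangle `i` is directly above `j`: the bottom edge of `i` lies on the same
segment as the top edge of `j`. -/
def DirAbove (i j : Fin n) : Prop :=
  R.yb i = R.yt j ∧ R.SameHSeg (R.yb i) (R.xl i) (R.xr i) (R.xl j) (R.xr j)

/-- Rectangle `i` is above `j`. -/
def Above : Fin n → Fin n → Prop := Relation.TransGen R.DirAbove

/-- Rectangle `i` is directly on the right of `j`: the left edge of `i` lies on
the same segment as the right edge of `j`. -/
def DirRightOf (i j : Fin n) : Prop :=
  R.xl i = R.xr j ∧ R.SameVSeg (R.xl i) (R.yb i) (R.yt i) (R.yb j) (R.yt j)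

/-- Rectangle `i` is on the right of `j`. -/
def RightOf : Fin n → Fin n → Prop := Relation.TransGen R.DirRightOf

/-- The inorder (NW–SE) order on the rectangles: the transitive closure of the
union of the below and right-of relations. -/
def InorderLT : Fin n → Fin n → Prop :=
  Relation.TransGen (fun i j => R.RightOf j i ∨ R.Above i j)

/-- The rectangles of `R` are labeled `1, …, n` in inorder. -/
def InorderLabeled : Prop := ∀ i j : Fin n, R.InorderLT i j ↔ i < j

/-- `q` is the parent of `r` via a horizontal edge in the source tree `S(R)`:
the bottom-right corner of `q` is the source (bottom-left corner) of `r`. -/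
def SEdgeH (q r : Fin n) : Prop := R.xr q = R.xl r ∧ R.yb q = R.yb r

/-- `q` is the parent of `r` via a vertical edge in the source tree `S(R)`:
the top-left corner of `q` is the source (bottom-left corner) of `r`. -/
def SEdgeV (q r : Fin n) : Prop := R.xl q = R.xl r ∧ R.yt q = R.yb r

/-- `q` is the parent of `r` via a horizontal edge in the target tree `T(R)`:
the top-left corner of `q` is the target (top-right corner) of `r`. -/
def TEdgeH (r q : Fin n) : Prop := R.xl q = R.xr r ∧ R.yt q = R.yt r

/-- `q` is the parent of `r` via a vertical edge in the target tree `T(R)`: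
the bottom-right corner of `q` is the target (top-right corner) of `r`. -/
def TEdgeV (r q : Fin n) : Prop := R.xr q = R.xr r ∧ R.yb q = R.yt r

/-- `a` is a descendant of `q` (or `a = q`) in the source tree. -/
def SReach : Fin n → Fin n → Prop :=
  Relation.ReflTransGen (fun a b => R.SEdgeH a b ∨ R.SEdgeV a b)

/-- `q` is an ancestor of `a` (or `a = q`) in the target tree. -/
def TReach : Fin n → Fin n → Prop :=
  Relation.ReflTransGen (fun a b => R.TEdgeH a b ∨ R.TEdgeV a b)

/-- `a` is a node of the vertical subtree of `i` in the target tree. -/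
def VSubT (i a : Fin n) : Prop := ∃ r, R.TEdgeV r i ∧ R.TReach a r

/-- `a` is a node of the horizontal subtree of `i` in the target tree. -/
def HSubT (i a : Fin n) : Prop := ∃ r, R.TEdgeH r i ∧ R.TReach a r

/-- `a` is a node of the vertical subtree of `i` in the source tree. -/
def VSubS (i a : Fin n) : Prop := ∃ r, R.SEdgeV i r ∧ R.SReach r a

/-- `a` is a node of the horizontal subtree of `i` in the source tree. -/
def HSubS (i a : Fin n) : Prop := ∃ r, R.SEdgeH i r ∧ R.SReach r a

/-- `h^T_i`: the number of leaves of the horizontal subtree of `i` in the target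
tree (a binary tree with `k` nodes has `k + 1` leaves). -/
def hT (i : Fin n) : ℕ := 1 + {a | R.HSubT i a}.ncard

/-- `v^T_i`. -/
def vT (i : Fin n) : ℕ := 1 + {a | R.VSubT i a}.ncard

/-- `h^S_i`. -/
def hS (i : Fin n) : ℕ := 1 + {a | R.HSubS i a}.ncard

/-- `v^S_i`. -/
def vS (i : Fin n) : ℕ := 1 + {a | R.VSubS i a}.ncard

/-- The node `a` of the target tree carries a vertical leaf. -/
def TVLeaf (a : Fin n) : Prop := ¬ ∃ r, R.TEdgeV r a

/-- The node `a` of the target tree carries a horizontal leaf. -/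
def THLeaf (a : Fin n) : Prop := ¬ ∃ r, R.TEdgeH r a

/-- The node `b` of the source tree carries a vertical leaf. -/
def SVLeaf (b : Fin n) : Prop := ¬ ∃ r, R.SEdgeV b r

/-- The node `b` of the source tree carries a horizontal leaf. -/
def SHLeaf (b : Fin n) : Prop := ¬ ∃ r, R.SEdgeH b r

/-- The vertical leaf of `T(R)` at `a` and the vertical leaf of `S(R)` at `b`
are common leaves: the edges to their parents lie on the same (vertical)
segment of `R` (the one supporting the right edge of `a` and the left edge of `b`). -/
def CommonVLeaf (a b : Fin n) : Prop :=
  R.TVLeaf a ∧ R.SVLeaf b ∧ R.xr a = R.xl b ∧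
    R.SameVSeg (R.xr a) (R.yb a) (R.yt a) (R.yb b) (R.yt b)

/-- The horizontal leaf of `T(R)` at `a` and the horizontal leaf of `S(R)` at `b`
are common leaves: the edges to their parents lie on the same (horizontal)
segment of `R` (supporting the top edge of `a` and the bottom edge of `b`). -/
def CommonHLeaf (a b : Fin n) : Prop :=
  R.THLeaf a ∧ R.SHLeaf b ∧ R.yt a = R.yb b ∧
    R.SameHSeg (R.yt a) (R.xl a) (R.xr a) (R.xl b) (R.xr b)

/-- `cv^{T,S}_{i,j}`: the number of common leaves of the vertical subtree of `i`
in `T(R)` and the vertical subtree of `j` in `S(R)`. -/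
def cv (i j : Fin n) : ℕ :=
  {p : Fin n × Fin n |
    (R.CommonVLeaf p.1 p.2 ∧ (R.VSubT i p.1 ∨ p.1 = i) ∧ (R.VSubS j p.2 ∨ p.2 = j)) ∨
    (R.CommonHLeaf p.1 p.2 ∧ R.VSubT i p.1 ∧ R.VSubS j p.2)}.ncard

/-- `ch^{S,T}_{i,j}`: the number of common leaves of the horizontal subtree of `i`
in `S(R)` and the horizontal subtree of `j` in `T(R)`. -/
def ch (i j : Fin n) : ℕ :=
  {p : Fin n × Fin n |
    (R.CommonHLeaf p.2 p.1 ∧ (R.HSubS i p.1 ∨ p.1 = i) ∧ (R.HSubT j p.2 ∨ p.2 = j)) ∨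
    (R.CommonVLeaf p.2 p.1 ∧ R.HSubS i p.1 ∧ R.HSubT j p.2)}.ncard

/-- The weak poset `≺_w^R`: the transitive closure of the union of the partial
orders given by the edges of `S(R)` and of `T(R)`, horizontal edges oriented
left to right and vertical edges bottom to top. -/
def PrecW : Fin n → Fin n → Prop :=
  Relation.TransGen (fun a b => R.SEdgeH a b ∨ R.SEdgeV a b ∨ R.TEdgeH a b ∨ R.TEdgeV a b)

/-- One step of the adjacency relation: `r_i` and `r_j` share part of a segment
of `R`, and `r_i` lies to the left of or below `r_j`. -/
def AdjStep (i j : Fin n) : Prop :=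
  (R.xr i = R.xl j ∧ max (R.yb i) (R.yb j) < min (R.yt i) (R.yt j)) ∨
  (R.yt i = R.yb j ∧ max (R.xl i) (R.xl j) < min (R.xr i) (R.xr j))

/-- The special relation `i ◁◁ j`. -/
def Special (i j : Fin n) : Prop :=
  (R.xr j = R.xl i ∧ R.SameVSeg (R.xl i) (R.yb j) (R.yt j) (R.yb i) (R.yt i) ∧
    R.yt i < R.yb j) ∨
  (R.yt j = R.yb i ∧ R.SameHSeg (R.yb i) (R.xl j) (R.xr j) (R.xl i) (R.xr i) ∧
    R.xr i < R.xl j)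

/-- The strong poset `≺_s^R`: the transitive closure of the union of the
adjacency relation and the special relation. -/
def PrecS : Fin n → Fin n → Prop :=
  Relation.TransGen (fun a b => R.AdjStep a b ∨ R.Special a b)

/-- The vertical pattern `i‖j`: `r_i` and `r_j` share a vertical segment
containing the right edge of `r_i` and the left edge of `r_j`, and the bottom
edge of `r_i` is below the top edge of `r_j`. -/
def VertPattern (i j : Fin n) : Prop :=
  R.xr i = R.xl j ∧ R.SameVSeg (R.xr i) (R.yb i) (R.yt i) (R.yb j) (R.yt j) ∧
    R.yb i < R.yt j

/-- The horizontal pattern `i⦀j`: `r_i` and `r_j` share a horizontal segment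
containing the bottom edge of `r_i` and the top edge of `r_j`, and the right
edge of `r_i` is to the right of the left edge of `r_j`. -/
def HorPattern (i j : Fin n) : Prop :=
  R.yb i = R.yt j ∧ R.SameHSeg (R.yb i) (R.xl i) (R.xr i) (R.xl j) (R.xr j) ∧
    R.xl j < R.xr i

end Rectangulation



section AbstractTree
open Relation

variable {n : ℕ} {L Rr : Fin n → Fin n → Prop}

/-- Abstract binary search tree axioms on `Fin n`. -/
structure TreeAx (L Rr : Fin n → Fin n → Prop) : Prop where
  g1 : ∀ t q, L t q → ∃ u : Fin n, u.val + 1 = q.val ∧ ReflTransGen Rr u t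
  g2 : ∀ t q, Rr t q → ∃ u : Fin n, u.val = q.val + 1 ∧ ReflTransGen L u t
  llt : ∀ t q, L t q → t < q
  rlt : ∀ t q, Rr t q → q < t
  uniq : ∀ a b c, (L a b ∨ Rr a b) → (L a c ∨ Rr a c) → b = c
  gap : ∀ b b' : Fin n, b'.val = b.val + 1 →
    ReflTransGen (fun a b => L a b ∨ Rr a b) b b' ∨ ReflTransGen (fun a b => L a b ∨ Rr a b) b' b
  anti : ∀ a b, ReflTransGen (fun a b => L a b ∨ Rr a b) a b →
    ReflTransGen (fun a b => L a b ∨ Rr a b) b a → a = b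

namespace TreeAx

theorem rchain_le (h : TreeAx L Rr) {a b : Fin n} (hab : ReflTransGen Rr a b) : b ≤ a := by
  induction hab with
  | refl => exact le_rfl
  | tail _ h2 ih => exact (h.rlt _ _ h2).le.trans ih

theorem lchain_le (h : TreeAx L Rr) {a b : Fin n} (hab : ReflTransGen L a b) : a ≤ b := by
  induction hab with
  | refl => exact le_rfl
  | tail _ h2 ih => exact ih.trans (h.llt _ _ h2).le

theorem rchain_reach {a b : Fin n} (hab : ReflTransGen Rr a b) :
    ReflTransGen (fun a b => L a b ∨ Rr a b) a b :=
  ReflTransGen.mono (fun _ _ h => Or.inr h) _ _ hab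

theorem lchain_reach {a b : Fin n} (hab : ReflTransGen L a b) :
    ReflTransGen (fun a b => L a b ∨ Rr a b) a b :=
  ReflTransGen.mono (fun _ _ h => Or.inl h) _ _ hab

theorem between (h : TreeAx L Rr) (d : ℕ) : ∀ t q : Fin n,
    (L t q → q.val - t.val ≤ d → ∀ l, t ≤ l → l < q →
      ReflTransGen (fun a b => L a b ∨ Rr a b) l t) ∧
    (Rr t q → t.val - q.val ≤ d → ∀ l, q < l → l ≤ t →
      ReflTransGen (fun a b => L a b ∨ Rr a b) l t) := by
  induction d with
  | zero =>
    intro t q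
    refine ⟨fun h1 h2 => ?_, fun h1 h2 => ?_⟩
    · have := h.llt _ _ h1; omega
    · have := h.rlt _ _ h1; omega
  | succ d ih =>
    intro t q
    refine ⟨fun h1 h2 l hl1 hl2 => ?_, fun h1 h2 l hl1 hl2 => ?_⟩
    · obtain ⟨u, hu, hc⟩ := h.g1 t q h1
      have key : ∀ x, ReflTransGen Rr x t → x.val < q.val → t ≤ l → l ≤ x →
          ReflTransGen (fun a b => L a b ∨ Rr a b) l t := by
        intro x hx
        induction hx using ReflTransGen.head_induction_on with
        | refl =>
          intro _ a b
          rw [le_antisymm b a]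
        | head hac hct ih2 =>
          rename_i a c
          intro h3 h4 h5
          have := h.rlt _ _ hac
          have h6 := h.rchain_le hct
          by_cases hlc : l ≤ c
          · exact ih2 (by omega) h4 hlc
          · have := (ih a c).2 hac (by omega) l (by omega) h5
            exact this.trans (rchain_reach (ReflTransGen.head hac hct))
      exact key u hc (by omega) hl1 (by omega)
    · obtain ⟨u, hu, hc⟩ := h.g2 t q h1
      have key : ∀ x, ReflTransGen L x t → q.val < x.val → l ≤ t → x ≤ l →
          ReflTransGen (fun a b => L a b ∨ Rr a b) l t := by
        intro x hx
        induction hx using ReflTransGen.head_induction_on with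
        | refl =>
          intro _ a b
          rw [le_antisymm a b]
        | head hac hct ih2 =>
          rename_i a c
          intro h3 h4 h5
          have := h.llt _ _ hac
          have h6 := h.lchain_le hct
          by_cases hlc : c ≤ l
          · exact ih2 (by omega) h4 hlc
          · have := (ih a c).1 hac (by omega) l h5 (by omega)
            exact this.trans (lchain_reach (ReflTransGen.head hac hct))
      exact key u hc (by omega) hl2 (by omega)

theorem hsub_lt (h : TreeAx L Rr) {i r a : Fin n} (hr : L r i)
    (ha : ReflTransGen (fun a b => L a b ∨ Rr a b) a r) : a < i := by
  induction ha using ReflTransGen.head_induction_on with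
  | refl => exact h.llt _ _ hr
  | head hac hct ih =>
    rename_i a c
    rcases hac with hac | hac
    · exact (h.llt _ _ hac).trans ih
    · by_contra hcon
      push Not at hcon
      have h1 := (h.between _ a c).2 hac le_rfl i ih hcon
      have h2 : ReflTransGen (fun a b => L a b ∨ Rr a b) i r :=
        h1.trans (ReflTransGen.head (Or.inr hac) hct)
      have h3 := h.anti _ _ h2 (ReflTransGen.single (Or.inl hr))
      have := h.llt _ _ hr
      omega

theorem vsub_lt (h : TreeAx L Rr) {i r a : Fin n} (hr : Rr r i)
    (ha : ReflTransGen (fun a b => L a b ∨ Rr a b) a r) : i < a := by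
  induction ha using ReflTransGen.head_induction_on with
  | refl => exact h.rlt _ _ hr
  | head hac hct ih =>
    rename_i a c
    rcases hac with hac | hac
    · by_contra hcon
      push Not at hcon
      have h1 := (h.between _ a c).1 hac le_rfl i hcon ih
      have h2 : ReflTransGen (fun a b => L a b ∨ Rr a b) i r :=
        h1.trans (ReflTransGen.head (Or.inl hac) hct)
      have h3 := h.anti _ _ h2 (ReflTransGen.single (Or.inr hr))
      have := h.rlt _ _ hr
      omega
    · exact ih.trans (h.rlt _ _ hac)

theorem sub_cases {i a : Fin n}
    (ha : ReflTransGen (fun a b => L a b ∨ Rr a b) a i) (hne : a ≠ i) :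
    (∃ r, L r i ∧ ReflTransGen (fun a b => L a b ∨ Rr a b) a r) ∨
    (∃ r, Rr r i ∧ ReflTransGen (fun a b => L a b ∨ Rr a b) a r) := by
  rcases ReflTransGen.cases_tail ha with h | ⟨c, h1, h2⟩
  · exact absurd h.symm hne
  · rcases h2 with h2 | h2
    · exact Or.inl ⟨c, h2, h1⟩
    · exact Or.inr ⟨c, h2, h1⟩

theorem hsub_iff (h : TreeAx L Rr) (i a : Fin n) :
    (∃ r, L r i ∧ ReflTransGen (fun a b => L a b ∨ Rr a b) a r) ↔
      a < i ∧ ReflTransGen (fun a b => L a b ∨ Rr a b) a i := by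
  constructor
  · rintro ⟨r, h1, h2⟩
    exact ⟨h.hsub_lt h1 h2, h2.tail (Or.inl h1)⟩
  · rintro ⟨h1, h2⟩
    rcases sub_cases h2 h1.ne with h3 | ⟨r, h3, h4⟩
    · exact h3
    · have := h.vsub_lt h3 h4; omega

theorem vsub_iff (h : TreeAx L Rr) (i a : Fin n) :
    (∃ r, Rr r i ∧ ReflTransGen (fun a b => L a b ∨ Rr a b) a r) ↔
      i < a ∧ ReflTransGen (fun a b => L a b ∨ Rr a b) a i := by
  constructor
  · rintro ⟨r, h1, h2⟩
    exact ⟨h.vsub_lt h1 h2, h2.tail (Or.inr h1)⟩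
  · rintro ⟨h1, h2⟩
    rcases sub_cases h2 h1.ne' with ⟨r, h3, h4⟩ | h3
    · have := h.hsub_lt h3 h4; omega
    · exact h3

theorem exists_max (h : TreeAx L Rr) (a : Fin n) : ∀ (m : ℕ) (b : Fin n), b.val = a.val + m →
    ∃ i, a ≤ i ∧ i ≤ b ∧
    ∀ k, a ≤ k → k ≤ b → ReflTransGen (fun a b => L a b ∨ Rr a b) k i := by
  intro m
  induction m with
  | zero =>
    intro b hb
    refine ⟨a, le_rfl, by omega, fun k h1 h2 => ?_⟩
    have : k = a := by omega
    rw [this]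
  | succ m ih =>
    intro b hb
    obtain ⟨i, h1, h2, h3⟩ := ih ⟨a.val + m, by omega⟩ rfl
    have hle : ∀ k : Fin n, k ≤ b → k ≤ ⟨a.val + m, by omega⟩ ∨ k = b := by
      intro k hk
      rcases lt_or_eq_of_le hk with hk | hk
      · left; rw [Fin.le_def]; simp only; omega
      · exact Or.inr hk
    have h2' : i ≤ b := by rw [Fin.le_def] at h2 ⊢; simp only at h2; omega
    have up : ∀ {x}, ReflTransGen (fun a b => L a b ∨ Rr a b) b x → x = i →
       ∃ i, a ≤ i ∧ i ≤ b ∧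
        ∀ k, a ≤ k → k ≤ b → ReflTransGen (fun a b => L a b ∨ Rr a b) k i := by
      rintro x hx rfl
      refine ⟨x, h1, h2', fun k hk1 hk2 => ?_⟩
      rcases hle k hk2 with hk | hk
      · exact h3 k hk1 hk
      · rw [hk]; exact hx
    have hself := h3 ⟨a.val + m, by omega⟩ (by rw [Fin.le_def]; simp) le_rfl
    rcases h.gap ⟨a.val + m, by omega⟩ b (by simp only; omega) with hg | hg
    · have hru : Relator.RightUnique (fun a b => L a b ∨ Rr a b) :=
        fun a b c h1 h2 => h.uniq a b c h1 h2
      rcases ReflTransGen.total_of_right_unique hru hself hg with h4 | h4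
      · refine ⟨b, by omega, le_rfl, fun k hk1 hk2 => ?_⟩
        rcases hle k hk2 with hk | hk
        · exact (h3 k hk1 hk).trans h4
        · rw [hk]
      · exact up h4 rfl
    · exact up (hg.trans hself) rfl

theorem convex (h : TreeAx L Rr) {a i k : Fin n}
    (ha : ReflTransGen (fun a b => L a b ∨ Rr a b) a i)
    (hk : (a ≤ k ∧ k ≤ i) ∨ (i ≤ k ∧ k ≤ a)) :
    ReflTransGen (fun a b => L a b ∨ Rr a b) k i := by
  rcases hk with ⟨h1, h2⟩ | ⟨h1, h2⟩
  · obtain ⟨m, hm1, hm2, hm3⟩ := h.exists_max a (i.val - a.val) i (by omega)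
    by_cases hmi : m = i
    · rw [← hmi]; exact hm3 k h1 h2
    · exfalso
      have him := hm3 i (by omega) le_rfl
      rcases sub_cases him (Ne.symm hmi) with ⟨r, h3, h4⟩ | ⟨r, h3, h4⟩
      · have := h.hsub_lt h3 h4; omega
      · have := h.vsub_lt h3 (ha.trans h4); omega
  · obtain ⟨m, hm1, hm2, hm3⟩ := h.exists_max i (a.val - i.val) a (by omega)
    by_cases hmi : m = i
    · rw [← hmi]; exact hm3 k h1 h2
    · exfalso
      have him := hm3 i le_rfl (by omega)
      rcases sub_cases him (Ne.symm hmi) with ⟨r, h3, h4⟩ | ⟨r, h3, h4⟩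
      · have := h.hsub_lt h3 (ha.trans h4); omega
      · have := h.vsub_lt h3 h4; omega

end TreeAx
end AbstractTree


theorem rtg_rev {n : ℕ} {r r' : Fin n → Fin n → Prop} (h : ∀ a b, r' a b ↔ r a.rev b.rev)
    (a b : Fin n) : Relation.ReflTransGen r' a b ↔ Relation.ReflTransGen r a.rev b.rev := by
  constructor
  · intro hab
    exact Relation.ReflTransGen.lift Fin.rev (fun a b hh => (h a b).1 hh) _ _ hab
  · intro hab
    have := Relation.ReflTransGen.lift (p := r') Fin.rev
      (fun a b hh => (h _ _).2 (by simpa using hh)) _ _ hab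
    simpa [Function.onFun] using this

theorem rtg_rev_swap {n : ℕ} {r r' : Fin n → Fin n → Prop} (h : ∀ a b, r' a b ↔ r b.rev a.rev)
    (a b : Fin n) : Relation.ReflTransGen r' a b ↔ Relation.ReflTransGen r b.rev a.rev := by
  rw [rtg_rev (r := fun x y => r y x) h]
  exact Relation.reflTransGen_swap (r := r)

namespace Rectangulation

variable {n : ℕ} (R : Rectangulation n)

/-- Reflection across the diagonal, labels reversed. -/
def tr : Rectangulation n where
  xl i := R.yb i.rev
  xr i := R.yt i.rev
  yb i := R.xl i.rev
  yt i := R.xr i.rev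
  lt_x i := R.lt_y _
  lt_y i := R.lt_x _
  xl_nonneg i := R.yb_nonneg _
  xr_le_one i := R.yt_le_one _
  yb_nonneg i := R.xl_nonneg _
  yt_le_one i := R.xr_le_one _
  interiors_disjoint i j hij := by
    rintro ⟨p, ⟨a, b, c, d⟩, e, f, g, h⟩
    exact R.interiors_disjoint i.rev j.rev (fun hh => hij (Fin.rev_injective hh))
      ⟨(p.2, p.1), ⟨c, d, a, b⟩, g, h, e, f⟩
  cover p h1 h2 h3 h4 := by
    obtain ⟨i, a, b, c, d⟩ := R.cover (p.2, p.1) h3 h4 h1 h2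
    exact ⟨i.rev, by simpa using ⟨c, d, a, b⟩⟩

/-- Rotation by a half turn, labels reversed. -/
def rot : Rectangulation n where
  xl i := 1 - R.xr i.rev
  xr i := 1 - R.xl i.rev
  yb i := 1 - R.yt i.rev
  yt i := 1 - R.yb i.rev
  lt_x i := by have := R.lt_x i.rev; linarith
  lt_y i := by have := R.lt_y i.rev; linarith
  xl_nonneg i := by have := R.xr_le_one i.rev; linarith
  xr_le_one i := by have := R.xl_nonneg i.rev; linarith
  yb_nonneg i := by have := R.yt_le_one i.rev; linarith
  yt_le_one i := by have := R.yb_nonneg i.rev; linarith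
  interiors_disjoint i j hij := by
    rintro ⟨p, ⟨a, b, c, d⟩, e, f, g, h⟩
    refine R.interiors_disjoint i.rev j.rev (fun hh => hij (Fin.rev_injective hh))
      ⟨(1 - p.1, 1 - p.2), ⟨?_, ?_, ?_, ?_⟩, ?_, ?_, ?_, ?_⟩ <;> simp only <;> linarith
  cover p h1 h2 h3 h4 := by
    obtain ⟨i, a, b, c, d⟩ := R.cover (1 - p.1, 1 - p.2) (by simp only; linarith)
      (by simp only; linarith) (by simp only; linarith) (by simp only; linarith)
    simp only at a b c d
    refine ⟨i.rev, ?_⟩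
    simp only [Fin.rev_rev]
    refine ⟨?_, ?_, ?_, ?_⟩ <;> linarith

@[simp] theorem tr_xl (i : Fin n) : R.tr.xl i = R.yb i.rev := rfl
@[simp] theorem tr_xr (i : Fin n) : R.tr.xr i = R.yt i.rev := rfl
@[simp] theorem tr_yb (i : Fin n) : R.tr.yb i = R.xl i.rev := rfl
@[simp] theorem tr_yt (i : Fin n) : R.tr.yt i = R.xr i.rev := rfl
@[simp] theorem rot_xl (i : Fin n) : R.rot.xl i = 1 - R.xr i.rev := rfl
@[simp] theorem rot_xr (i : Fin n) : R.rot.xr i = 1 - R.xl i.rev := rfl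
@[simp] theorem rot_yb (i : Fin n) : R.rot.yb i = 1 - R.yt i.rev := rfl
@[simp] theorem rot_yt (i : Fin n) : R.rot.yt i = 1 - R.yb i.rev := rfl

theorem tr_corner (i : Fin n) (p : ℝ × ℝ) : R.tr.IsCorner i p ↔ R.IsCorner i.rev (p.2, p.1) := by
  simp only [IsCorner, tr_xl, tr_xr, tr_yb, tr_yt]; tauto

theorem rot_corner (i : Fin n) (p : ℝ × ℝ) :
    R.rot.IsCorner i p ↔ R.IsCorner i.rev (1 - p.1, 1 - p.2) := by
  simp only [IsCorner, rot_xl, rot_xr, rot_yb, rot_yt]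
  grind

theorem tr_generic (h : R.Generic) : R.tr.Generic := by
  rintro ⟨p, i, j, k, l, h1, h2, h3, h4, h5, h6, a, b, c, d⟩
  rw [tr_corner] at a b c d
  refine h ⟨_, i.rev, j.rev, k.rev, l.rev, ?_, ?_, ?_, ?_, ?_, ?_, a, b, c, d⟩ <;>
    simpa using (by assumption)

theorem rot_generic (h : R.Generic) : R.rot.Generic := by
  rintro ⟨p, i, j, k, l, h1, h2, h3, h4, h5, h6, a, b, c, d⟩
  rw [rot_corner] at a b c d
  refine h ⟨_, i.rev, j.rev, k.rev, l.rev, ?_, ?_, ?_, ?_, ?_, ?_, a, b, c, d⟩ <;>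
    simpa using (by assumption)

theorem tr_onV (p : ℝ × ℝ) : R.tr.OnVertEdge p ↔ R.OnHorizEdge (p.2, p.1) :=
  ⟨fun ⟨i, h⟩ => ⟨i.rev, h⟩, fun ⟨i, h⟩ => ⟨i.rev, by simpa using h⟩⟩

theorem tr_onH (p : ℝ × ℝ) : R.tr.OnHorizEdge p ↔ R.OnVertEdge (p.2, p.1) :=
  ⟨fun ⟨i, h⟩ => ⟨i.rev, h⟩, fun ⟨i, h⟩ => ⟨i.rev, by simpa using h⟩⟩

theorem rot_onV (p : ℝ × ℝ) : R.rot.OnVertEdge p ↔ R.OnVertEdge (1 - p.1, 1 - p.2) := by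
  constructor
  · rintro ⟨i, h1, h2, h3⟩
    refine ⟨i.rev, ?_⟩
    simp only [rot_xl, rot_xr, rot_yb, rot_yt] at *
    grind
  · rintro ⟨i, h1, h2, h3⟩
    refine ⟨i.rev, ?_⟩
    simp only [rot_xl, rot_xr, rot_yb, rot_yt, Fin.rev_rev] at *
    grind

theorem rot_onH (p : ℝ × ℝ) : R.rot.OnHorizEdge p ↔ R.OnHorizEdge (1 - p.1, 1 - p.2) := by
  constructor
  · rintro ⟨i, h1, h2, h3⟩
    refine ⟨i.rev, ?_⟩
    simp only [rot_xl, rot_xr, rot_yb, rot_yt] at *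
    grind
  · rintro ⟨i, h1, h2, h3⟩
    refine ⟨i.rev, ?_⟩
    simp only [rot_xl, rot_xr, rot_yb, rot_yt, Fin.rev_rev] at *
    grind

theorem tr_sameV (x a b c d : ℝ) : R.tr.SameVSeg x a b c d ↔ R.SameHSeg x a b c d := by
  simp only [SameVSeg, SameHSeg, tr_onV]

theorem tr_sameH (x a b c d : ℝ) : R.tr.SameHSeg x a b c d ↔ R.SameVSeg x a b c d := by
  simp only [SameVSeg, SameHSeg, tr_onH]

theorem sameV_swap {x a b c d : ℝ} : R.SameVSeg x a b c d ↔ R.SameVSeg x c d a b := by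
  simp only [SameVSeg, min_comm, max_comm]

theorem sameH_swap {x a b c d : ℝ} : R.SameHSeg x a b c d ↔ R.SameHSeg x c d a b := by
  simp only [SameHSeg, min_comm, max_comm]

theorem rot_sameV (x a b c d : ℝ) : R.rot.SameVSeg (1 - x) (1 - b) (1 - a) (1 - d) (1 - c) ↔
    R.SameVSeg x a b c d := by
  simp only [SameVSeg, rot_onV, min_sub_sub_left, max_sub_sub_left, sub_sub_cancel]
  refine ⟨fun ⟨h1, h2, h3⟩ => ⟨by linarith, by linarith, fun y hy1 hy2 => ?_⟩,
    fun ⟨h1, h2, h3⟩ => ⟨by linarith, by linarith, fun y hy1 hy2 => ?_⟩⟩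
  · have := h3 (1 - y) (by linarith) (by linarith)
    simpa using this
  · exact h3 (1 - y) (by linarith) (by linarith)

theorem rot_sameH (x a b c d : ℝ) : R.rot.SameHSeg (1 - x) (1 - b) (1 - a) (1 - d) (1 - c) ↔
    R.SameHSeg x a b c d := by
  simp only [SameHSeg, rot_onH, min_sub_sub_left, max_sub_sub_left, sub_sub_cancel]
  refine ⟨fun ⟨h1, h2, h3⟩ => ⟨by linarith, by linarith, fun y hy1 hy2 => ?_⟩,
    fun ⟨h1, h2, h3⟩ => ⟨by linarith, by linarith, fun y hy1 hy2 => ?_⟩⟩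
  · have := h3 (1 - y) (by linarith) (by linarith)
    simpa using this
  · exact h3 (1 - y) (by linarith) (by linarith)

theorem tr_dirRight (i j : Fin n) : R.tr.DirRightOf i j ↔ R.DirAbove i.rev j.rev := by
  simp only [DirRightOf, DirAbove, tr_sameV, tr_xl, tr_xr, tr_yb, tr_yt]

theorem tr_dirAbove (i j : Fin n) : R.tr.DirAbove i j ↔ R.DirRightOf i.rev j.rev := by
  simp only [DirRightOf, DirAbove, tr_sameH, tr_xl, tr_xr, tr_yb, tr_yt]

theorem rot_dirRight (i j : Fin n) : R.rot.DirRightOf i j ↔ R.DirRightOf j.rev i.rev := by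
  simp only [DirRightOf, rot_sameV, rot_xl, rot_xr, rot_yb, rot_yt]
  constructor
  · rintro ⟨h1, h2⟩
    have h1 : R.xl j.rev = R.xr i.rev := by linarith
    exact ⟨h1, by rw [h1, sameV_swap]; exact h2⟩
  · rintro ⟨h1, h2⟩
    exact ⟨by rw [h1], by rw [← h1, sameV_swap]; exact h2⟩

theorem rot_dirAbove (i j : Fin n) : R.rot.DirAbove i j ↔ R.DirAbove j.rev i.rev := by
  simp only [DirAbove, rot_sameH, rot_xl, rot_xr, rot_yb, rot_yt]
  constructor
  · rintro ⟨h1, h2⟩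
    have h1 : R.yb j.rev = R.yt i.rev := by linarith
    exact ⟨h1, by rw [h1, sameH_swap]; exact h2⟩
  · rintro ⟨h1, h2⟩
    exact ⟨by rw [h1], by rw [← h1, sameH_swap]; exact h2⟩

theorem tr_TEdgeH (r q : Fin n) : R.tr.TEdgeH r q ↔ R.TEdgeV r.rev q.rev := and_comm
theorem tr_TEdgeV (r q : Fin n) : R.tr.TEdgeV r q ↔ R.TEdgeH r.rev q.rev := and_comm
theorem tr_SEdgeH (r q : Fin n) : R.tr.SEdgeH r q ↔ R.SEdgeV r.rev q.rev := and_comm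
theorem tr_SEdgeV (r q : Fin n) : R.tr.SEdgeV r q ↔ R.SEdgeH r.rev q.rev := and_comm

theorem rot_TEdgeH (r q : Fin n) : R.rot.TEdgeH r q ↔ R.SEdgeH q.rev r.rev := by
  simp only [TEdgeH, SEdgeH, rot_xl, rot_xr, rot_yb, rot_yt, sub_right_inj]
theorem rot_TEdgeV (r q : Fin n) : R.rot.TEdgeV r q ↔ R.SEdgeV q.rev r.rev := by
  simp only [TEdgeV, SEdgeV, rot_xl, rot_xr, rot_yb, rot_yt, sub_right_inj]
theorem rot_SEdgeH (r q : Fin n) : R.rot.SEdgeH r q ↔ R.TEdgeH q.rev r.rev := by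
  simp only [TEdgeH, SEdgeH, rot_xl, rot_xr, rot_yb, rot_yt, sub_right_inj]
theorem rot_SEdgeV (r q : Fin n) : R.rot.SEdgeV r q ↔ R.TEdgeV q.rev r.rev := by
  simp only [TEdgeV, SEdgeV, rot_xl, rot_xr, rot_yb, rot_yt, sub_right_inj]

theorem tr_TReach (r q : Fin n) : R.tr.TReach r q ↔ R.TReach r.rev q.rev :=
  rtg_rev (fun a b => by rw [tr_TEdgeH, tr_TEdgeV, or_comm]) r q
theorem tr_SReach (r q : Fin n) : R.tr.SReach r q ↔ R.SReach r.rev q.rev :=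
  rtg_rev (fun a b => by rw [tr_SEdgeH, tr_SEdgeV, or_comm]) r q
theorem rot_TReach (r q : Fin n) : R.rot.TReach r q ↔ R.SReach q.rev r.rev :=
  rtg_rev_swap (fun a b => by rw [rot_TEdgeH, rot_TEdgeV]) r q

theorem exists_rev {p : Fin n → Prop} : (∃ r, p (Fin.rev r)) ↔ ∃ r, p r :=
  ⟨fun ⟨r, h⟩ => ⟨_, h⟩, fun ⟨r, h⟩ => ⟨r.rev, by simpa using h⟩⟩

theorem tr_HSubT (i a : Fin n) : R.tr.HSubT i a ↔ R.VSubT i.rev a.rev := by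
  simp only [HSubT, VSubT, tr_TEdgeH, tr_TReach]
  exact exists_rev (p := fun r => R.TEdgeV r i.rev ∧ R.TReach a.rev r)
theorem tr_VSubT (i a : Fin n) : R.tr.VSubT i a ↔ R.HSubT i.rev a.rev := by
  simp only [HSubT, VSubT, tr_TEdgeV, tr_TReach]
  exact exists_rev (p := fun r => R.TEdgeH r i.rev ∧ R.TReach a.rev r)
theorem tr_HSubS (i a : Fin n) : R.tr.HSubS i a ↔ R.VSubS i.rev a.rev := by
  simp only [HSubS, VSubS, tr_SEdgeH, tr_SReach]
  exact exists_rev (p := fun r => R.SEdgeV i.rev r ∧ R.SReach r a.rev)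
theorem tr_VSubS (i a : Fin n) : R.tr.VSubS i a ↔ R.HSubS i.rev a.rev := by
  simp only [HSubS, VSubS, tr_SEdgeV, tr_SReach]
  exact exists_rev (p := fun r => R.SEdgeH i.rev r ∧ R.SReach r a.rev)
theorem rot_HSubT (i a : Fin n) : R.rot.HSubT i a ↔ R.HSubS i.rev a.rev := by
  simp only [HSubT, HSubS, rot_TEdgeH, rot_TReach]
  exact exists_rev (p := fun r => R.SEdgeH i.rev r ∧ R.SReach r a.rev)
theorem rot_VSubT (i a : Fin n) : R.rot.VSubT i a ↔ R.VSubS i.rev a.rev := by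
  simp only [VSubT, VSubS, rot_TEdgeV, rot_TReach]
  exact exists_rev (p := fun r => R.SEdgeV i.rev r ∧ R.SReach r a.rev)

theorem tr_TVLeaf (a : Fin n) : R.tr.TVLeaf a ↔ R.THLeaf a.rev := by
  simp only [TVLeaf, THLeaf, tr_TEdgeV]
  exact not_congr (exists_rev (p := fun r => R.TEdgeH r a.rev))
theorem tr_THLeaf (a : Fin n) : R.tr.THLeaf a ↔ R.TVLeaf a.rev := by
  simp only [TVLeaf, THLeaf, tr_TEdgeH]
  exact not_congr (exists_rev (p := fun r => R.TEdgeV r a.rev))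
theorem tr_SVLeaf (a : Fin n) : R.tr.SVLeaf a ↔ R.SHLeaf a.rev := by
  simp only [SVLeaf, SHLeaf, tr_SEdgeV]
  exact not_congr (exists_rev (p := fun r => R.SEdgeH a.rev r))
theorem tr_SHLeaf (a : Fin n) : R.tr.SHLeaf a ↔ R.SVLeaf a.rev := by
  simp only [SVLeaf, SHLeaf, tr_SEdgeH]
  exact not_congr (exists_rev (p := fun r => R.SEdgeV a.rev r))
theorem rot_SVLeaf (a : Fin n) : R.rot.SVLeaf a ↔ R.TVLeaf a.rev := by
  simp only [SVLeaf, TVLeaf, rot_SEdgeV]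
  exact not_congr (exists_rev (p := fun r => R.TEdgeV r a.rev))

theorem tr_CommonV (a b : Fin n) : R.tr.CommonVLeaf a b ↔ R.CommonHLeaf a.rev b.rev := by
  simp only [CommonVLeaf, CommonHLeaf, tr_TVLeaf, tr_SVLeaf, tr_sameV, tr_xl, tr_xr, tr_yb, tr_yt]
theorem tr_CommonH (a b : Fin n) : R.tr.CommonHLeaf a b ↔ R.CommonVLeaf a.rev b.rev := by
  simp only [CommonVLeaf, CommonHLeaf, tr_THLeaf, tr_SHLeaf, tr_sameH, tr_xl, tr_xr, tr_yb, tr_yt]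

theorem tr_VertPattern (i j : Fin n) : R.tr.VertPattern j.rev i.rev ↔ R.HorPattern i j := by
  simp only [VertPattern, HorPattern, tr_sameV, tr_xl, tr_xr, tr_yb, tr_yt, Fin.rev_rev]
  constructor
  · rintro ⟨h1, h2, h3⟩
    exact ⟨h1.symm, by rw [← h1, sameH_swap]; exact h2, h3⟩
  · rintro ⟨h1, h2, h3⟩
    exact ⟨h1.symm, by rw [← h1, sameH_swap]; exact h2, h3⟩

theorem ncard_rev (p : Fin n → Prop) : {a | p (Fin.rev a)}.ncard = {a | p a}.ncard := by
  have : {a | p a} = Fin.rev '' {a | p (Fin.rev a)} := by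
    ext a
    simp only [Set.mem_ofPred_eq, Set.mem_image]
    exact ⟨fun h => ⟨a.rev, by simpa using h, by simp⟩, by rintro ⟨b, h, rfl⟩; exact h⟩
  rw [this, Set.ncard_image_of_injective _ Fin.rev_injective]

theorem tr_hT (j : Fin n) : R.tr.hT j.rev = R.vT j := by
  simp only [hT, vT, tr_HSubT, Fin.rev_rev]
  rw [ncard_rev (fun a => R.VSubT j a)]
theorem tr_hS (j : Fin n) : R.tr.hS j.rev = R.vS j := by
  simp only [hS, vS, tr_HSubS, Fin.rev_rev]
  rw [ncard_rev (fun a => R.VSubS j a)]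

theorem tr_cv (i j : Fin n) : R.tr.cv j.rev i.rev = R.ch i j := by
  simp only [cv, ch, tr_CommonV, tr_CommonH, tr_VSubT, tr_VSubS, Fin.rev_rev]
  apply Set.ncard_congr (fun p _ => (p.2.rev, p.1.rev))
  · rintro ⟨a, b⟩ h
    simp only [Set.mem_ofPred_eq, Fin.rev_eq_iff] at h ⊢
    tauto
  · rintro ⟨a, b⟩ ⟨c, d⟩ _ _ h
    simp only [Prod.mk.injEq, Fin.rev_inj] at h ⊢
    exact ⟨h.2, h.1⟩
  · rintro ⟨a, b⟩ h
    refine ⟨(b.rev, a.rev), ?_, by simp⟩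
    simp only [Set.mem_ofPred_eq, Fin.rev_rev] at h ⊢
    tauto

end Rectangulation


theorem exists_right_near {n : ℕ} (f : Fin n → ℝ) {x B : ℝ} (h : x < B) :
    ∃ x', x < x' ∧ x' < B ∧ ∀ i, f i ≤ x' → f i ≤ x := by
  have h1 : ∀ᶠ x' in nhdsWithin x (Set.Ioi x), ∀ i, f i ≤ x' → f i ≤ x := by
    rw [Filter.eventually_all]
    intro i
    by_cases hi : f i ≤ x
    · exact Filter.Eventually.of_forall (fun _ _ => hi)
    · have : ∀ᶠ x' in nhdsWithin x (Set.Ioi x), x' < f i :=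
        (eventually_lt_nhds (not_le.1 hi)).filter_mono nhdsWithin_le_nhds
      filter_upwards [this] with y hy hy2
      linarith
  have h2 : ∀ᶠ x' in nhdsWithin x (Set.Ioi x), x' < B :=
    (eventually_lt_nhds h).filter_mono nhdsWithin_le_nhds
  have h3 : ∀ᶠ x' in nhdsWithin x (Set.Ioi x), x < x' := self_mem_nhdsWithin
  obtain ⟨y, a, b, c⟩ := (h3.and (h2.and h1)).exists
  exact ⟨y, a, b, c⟩

theorem exists_left_near {n : ℕ} (f : Fin n → ℝ) {x B : ℝ} (h : B < x) :
    ∃ x', x' < x ∧ B < x' ∧ ∀ i, x' ≤ f i → x ≤ f i := by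
  obtain ⟨y, a, b, c⟩ := exists_right_near (fun i => - f i) (neg_lt_neg h)
  refine ⟨-y, by linarith, by linarith, fun i hi => ?_⟩
  have := c i (by linarith)
  linarith

namespace Rectangulation

variable {n : ℕ} (R : Rectangulation n)

theorem sep {i j : Fin n} (hij : i ≠ j) :
    R.xr i ≤ R.xl j ∨ R.xr j ≤ R.xl i ∨ R.yt i ≤ R.yb j ∨ R.yt j ≤ R.yb i := by
  by_contra hh
  push Not at hh
  obtain ⟨h1, h2, h3, h4⟩ := hh
  have a1 := R.lt_x i
  have a2 := R.lt_x j
  have a3 := R.lt_y i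
  have a4 := R.lt_y j
  obtain ⟨x, hx1, hx2⟩ := exists_between (max_lt (lt_min a1 h2) (lt_min h1 a2))
  obtain ⟨y, hy1, hy2⟩ := exists_between (max_lt (lt_min a3 h4) (lt_min h3 a4))
  rw [max_lt_iff] at hx1 hy1
  rw [lt_min_iff] at hx2 hy2
  exact R.interiors_disjoint i j hij
    ⟨(x, y), ⟨hx1.1, hx2.1, hy1.1, hy2.1⟩, hx1.2, hx2.2, hy1.2, hy2.2⟩

theorem eq_of_overlap {i j : Fin n} (h1 : R.xl j < R.xr i) (h2 : R.xl i < R.xr j)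
    (h3 : R.yb j < R.yt i) (h4 : R.yb i < R.yt j) : i = j := by
  by_contra h
  rcases R.sep h with h | h | h | h <;> linarith

theorem coverNE {x y : ℝ} (h1 : 0 ≤ x) (h2 : x < 1) (h3 : 0 ≤ y) (h4 : y < 1) :
    ∃ i, R.xl i ≤ x ∧ x < R.xr i ∧ R.yb i ≤ y ∧ y < R.yt i := by
  obtain ⟨x', a1, a2, a3⟩ := exists_right_near R.xl h2
  obtain ⟨y', b1, b2, b3⟩ := exists_right_near R.yb h4
  obtain ⟨i, c1, c2, c3, c4⟩ := R.cover (x', y') (by simp only; linarith) (by simp only; linarith)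
    (by simp only; linarith) (by simp only; linarith)
  exact ⟨i, a3 i c1, lt_of_lt_of_le a1 c2, b3 i c3, lt_of_lt_of_le b1 c4⟩

theorem coverNW {x y : ℝ} (h1 : 0 < x) (h2 : x ≤ 1) (h3 : 0 ≤ y) (h4 : y < 1) :
    ∃ i, R.xl i < x ∧ x ≤ R.xr i ∧ R.yb i ≤ y ∧ y < R.yt i := by
  obtain ⟨x', a1, a2, a3⟩ := exists_left_near R.xr h1
  obtain ⟨y', b1, b2, b3⟩ := exists_right_near R.yb h4
  obtain ⟨i, c1, c2, c3, c4⟩ := R.cover (x', y') (by simp only; linarith) (by simp only; linarith)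
    (by simp only; linarith) (by simp only; linarith)
  exact ⟨i, lt_of_le_of_lt c1 a1, a3 i c2, b3 i c3, lt_of_lt_of_le b1 c4⟩

theorem coverSW {x y : ℝ} (h1 : 0 < x) (h2 : x ≤ 1) (h3 : 0 < y) (h4 : y ≤ 1) :
    ∃ i, R.xl i < x ∧ x ≤ R.xr i ∧ R.yb i < y ∧ y ≤ R.yt i := by
  obtain ⟨x', a1, a2, a3⟩ := exists_left_near R.xr h1
  obtain ⟨y', b1, b2, b3⟩ := exists_left_near R.yt h3
  obtain ⟨i, c1, c2, c3, c4⟩ := R.cover (x', y') (by simp only; linarith) (by simp only; linarith)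
    (by simp only; linarith) (by simp only; linarith)
  exact ⟨i, lt_of_le_of_lt c1 a1, a3 i c2, lt_of_le_of_lt c3 b1, b3 i c4⟩

theorem noCross {x y : ℝ} (h : R.OnVertEdge (x, y)) {i : Fin n} (h1 : R.xl i < x)
    (h2 : x < R.xr i) (h3 : R.yb i < y) (h4 : y < R.yt i) : False := by
  obtain ⟨k, hk, k1, k2⟩ := h
  simp only at hk k1 k2
  have a1 := R.lt_x k
  have a2 := R.lt_y k
  have : i = k := by
    apply R.eq_of_overlap <;> rcases hk with hk | hk <;> linarith
  subst this
  rcases hk with hk | hk <;> linarith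

theorem onV_right {a : Fin n} {y : ℝ} (h1 : R.yb a ≤ y) (h2 : y ≤ R.yt a) :
    R.OnVertEdge (R.xr a, y) := ⟨a, Or.inr rfl, h1, h2⟩
theorem onV_left {a : Fin n} {y : ℝ} (h1 : R.yb a ≤ y) (h2 : y ≤ R.yt a) :
    R.OnVertEdge (R.xl a, y) := ⟨a, Or.inl rfl, h1, h2⟩
theorem onH_top {a : Fin n} {x : ℝ} (h1 : R.xl a ≤ x) (h2 : x ≤ R.xr a) :
    R.OnHorizEdge (x, R.yt a) := ⟨a, Or.inr rfl, h1, h2⟩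
theorem onH_bot {a : Fin n} {x : ℝ} (h1 : R.xl a ≤ x) (h2 : x ≤ R.xr a) :
    R.OnHorizEdge (x, R.yb a) := ⟨a, Or.inl rfl, h1, h2⟩

theorem onV_le_one {x y : ℝ} (h : R.OnVertEdge (x, y)) : y ≤ 1 := by
  obtain ⟨k, _, _, k2⟩ := h
  exact k2.trans (R.yt_le_one k)

theorem exists_TEdgeV {a : Fin n} {h : ℝ} (hh : R.yt a < h)
    (hc : ∀ y, R.yt a ≤ y → y ≤ h → R.OnVertEdge (R.xr a, y)) : ∃ a', R.TEdgeV a a' := by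
  have h1 := R.onV_le_one (hc h hh.le le_rfl)
  have b1 := R.lt_x a
  have b2 := R.lt_y a
  have b3 := R.xl_nonneg a
  have b4 := R.yb_nonneg a
  obtain ⟨a', c1, c2, c3, c4⟩ := R.coverNW (x := R.xr a) (y := R.yt a) (by linarith)
    (R.xr_le_one a) (by linarith) (by linarith)
  obtain ⟨y, hy1, hy2⟩ := exists_between (lt_min hh c4)
  rw [lt_min_iff] at hy2
  have e1 : R.xr a' = R.xr a := by
    by_contra hne
    exact R.noCross (hc y hy1.le hy2.1.le) c1 (lt_of_le_of_ne c2 (Ne.symm hne)) (by linarith) hy2.2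
  refine ⟨a', e1, ?_⟩
  by_contra hne
  have : R.yb a' < R.yt a := lt_of_le_of_ne c3 hne
  have : a = a' := by
    apply R.eq_of_overlap <;> linarith
  subst this
  linarith

theorem exists_SEdgeV {a : Fin n} {h : ℝ} (hh : R.yt a < h)
    (hc : ∀ y, R.yt a ≤ y → y ≤ h → R.OnVertEdge (R.xl a, y)) : ∃ a', R.SEdgeV a a' := by
  have h1 := R.onV_le_one (hc h hh.le le_rfl)
  have b1 := R.lt_x a
  have b2 := R.lt_y a
  have b3 := R.xl_nonneg a
  have b4 := R.yb_nonneg a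
  have b5 := R.xr_le_one a
  obtain ⟨a', c1, c2, c3, c4⟩ := R.coverNE (x := R.xl a) (y := R.yt a) (by linarith)
    (by linarith) (by linarith) (by linarith)
  obtain ⟨y, hy1, hy2⟩ := exists_between (lt_min hh c4)
  rw [lt_min_iff] at hy2
  have e1 : R.xl a = R.xl a' := by
    by_contra hne
    exact R.noCross (hc y hy1.le hy2.1.le) (lt_of_le_of_ne c1 (Ne.symm hne)) c2 (by linarith) hy2.2
  refine ⟨a', e1, ?_⟩
  by_contra hne
  have : R.yb a' < R.yt a := lt_of_le_of_ne c3 (Ne.symm hne)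
  have : a = a' := by
    apply R.eq_of_overlap <;> linarith
  subst this
  linarith

theorem TEdge_excl (hg : R.Generic) {r q q' : Fin n} (h1 : R.TEdgeH r q) (h2 : R.TEdgeV r q') :
    False := by
  obtain ⟨a1, a2⟩ := h1
  obtain ⟨c1, c2⟩ := h2
  have l1 := R.lt_x r
  have l2 := R.lt_x q
  have l3 := R.lt_x q'
  have m1 := R.lt_y r
  have m2 := R.lt_y q
  have m3 := R.lt_y q'
  have o1 := R.xr_le_one q
  have o2 := R.yt_le_one q'
  have o3 := R.xl_nonneg r
  have o4 := R.yb_nonneg r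
  obtain ⟨k, d1, d2, d3, d4⟩ := R.coverNE (x := R.xr r) (y := R.yt r) (by linarith)
    (by linarith) (by linarith) (by linarith)
  have e1 : R.xr r = R.xl k := by
    by_contra hne
    have : R.xl k < R.xr r := lt_of_le_of_ne d1 (Ne.symm hne)
    have : q' = k := by apply R.eq_of_overlap <;> linarith
    subst this
    linarith
  have e2 : R.yt r = R.yb k := by
    by_contra hne
    have : R.yb k < R.yt r := lt_of_le_of_ne d3 (Ne.symm hne)
    have : q = k := by apply R.eq_of_overlap <;> linarith
    subst this
    linarith
  refine hg ⟨(R.xr r, R.yt r), r, q, q', k, ?_, ?_, ?_, ?_, ?_, ?_,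
    ⟨Or.inr rfl, Or.inr rfl⟩, ⟨Or.inl a1.symm, Or.inr a2.symm⟩, ⟨Or.inr c1.symm, Or.inl c2.symm⟩,
    ⟨Or.inl e1, Or.inl e2⟩⟩ <;> rintro rfl <;> linarith

theorem TEdgeH_uniq {r q q' : Fin n} (h1 : R.TEdgeH r q) (h2 : R.TEdgeH r q') : q = q' := by
  obtain ⟨a1, a2⟩ := h1
  obtain ⟨c1, c2⟩ := h2
  have l2 := R.lt_x q
  have l3 := R.lt_x q'
  have m2 := R.lt_y q
  have m3 := R.lt_y q'
  apply R.eq_of_overlap <;> linarith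

theorem TEdgeV_uniq {r q q' : Fin n} (h1 : R.TEdgeV r q) (h2 : R.TEdgeV r q') : q = q' := by
  obtain ⟨a1, a2⟩ := h1
  obtain ⟨c1, c2⟩ := h2
  have l2 := R.lt_x q
  have l3 := R.lt_x q'
  have m2 := R.lt_y q
  have m3 := R.lt_y q'
  apply R.eq_of_overlap <;> linarith

theorem TReach_le {a b : Fin n} (h : R.TReach a b) : a = b ∨ R.xr a + R.yt a < R.xr b + R.yt b := by
  induction h with
  | refl => exact Or.inl rfl
  | @tail c d _ h2 ih =>
    right
    have l1 := R.lt_x d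
    have l2 := R.lt_y d
    have : R.xr c + R.yt c < R.xr d + R.yt d := by
      rcases h2 with ⟨h1, h2⟩ | ⟨h1, h2⟩ <;> linarith
    rcases ih with rfl | ih <;> linarith

theorem corner {u : Fin n} (h1 : R.xr u < 1) (h2 : 0 < R.yb u) (h3 : R.TVLeaf u) :
    ∃ A, R.SEdgeH u A := by
  have l1 := R.lt_x u
  have l2 := R.lt_y u
  have l3 := R.xl_nonneg u
  have l4 := R.yt_le_one u
  obtain ⟨B, b1, b2, b3, b4⟩ := R.coverSW (x := R.xr u) (y := R.yb u) (by linarith)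
    (by linarith) (by linarith) (by linarith)
  obtain ⟨A, a1, a2, a3, a4⟩ := R.coverNE (x := R.xr u) (y := R.yb u) (by linarith)
    (by linarith) (by linarith) (by linarith)
  have e1 : R.xr u = R.xl A := by
    by_contra hne
    have : R.xl A < R.xr u := lt_of_le_of_ne a1 (Ne.symm hne)
    have : u = A := by apply R.eq_of_overlap <;> linarith
    subst this
    linarith
  refine ⟨A, e1, ?_⟩
  by_contra hne
  have a5 : R.yb A < R.yb u := lt_of_le_of_ne a3 (Ne.symm hne)
  apply h3
  refine ⟨B, ?_, ?_⟩
  · by_contra hne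
    have : R.xr u < R.xr B := lt_of_le_of_ne b2 hne
    have : A = B := by apply R.eq_of_overlap <;> linarith
    subst this
    linarith
  · by_contra hne
    have : R.yb u < R.yt B := lt_of_le_of_ne b4 hne
    have : u = B := by apply R.eq_of_overlap <;> linarith
    subst this
    linarith

/-- A generic rectangulation labeled in inorder, in local form. -/
structure Good : Prop where
  gen : R.Generic
  o1 : ∀ i j, R.DirRightOf j i → i < j
  o2 : ∀ i j, R.DirAbove i j → i < j
  o3 : ∀ b b' : Fin n, b'.val = b.val + 1 → R.DirRightOf b' b ∨ R.DirAbove b b'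

theorem good_of_inorder (hg : R.Generic) (h : R.InorderLabeled) : R.Good := by
  have o1 : ∀ i j, R.DirRightOf j i → i < j := fun i j hij =>
    (h i j).1 (.single (Or.inl (.single hij)))
  have o2 : ∀ i j, R.DirAbove i j → i < j := fun i j hij =>
    (h i j).1 (.single (Or.inr (.single hij)))
  refine ⟨hg, o1, o2, fun b b' hb => ?_⟩
  have hlt : ∀ i j : Fin n, (R.RightOf j i ∨ R.Above i j) → i < j := fun i j hij =>
    (h i j).1 (.single hij)
  have h1 : R.InorderLT b b' := (h b b').2 (by rw [Fin.lt_def]; omega)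
  have h2 : R.RightOf b' b ∨ R.Above b b' := by
    rcases (Relation.TransGen.tail'_iff).1 h1 with ⟨c, hc1, hc2⟩
    have h3 := hlt _ _ hc2
    rcases (Relation.reflTransGen_iff_eq_or_transGen).1 hc1 with rfl | h4
    · exact hc2
    · have h4 := (h b c).1 h4
      rw [Fin.lt_def] at *
      omega
  rcases h2 with h2 | h2
  · left
    rcases (Relation.TransGen.tail'_iff).1 h2 with ⟨c, hc1, hc2⟩
    rcases (Relation.reflTransGen_iff_eq_or_transGen).1 hc1 with rfl | h4
    · exact hc2
    · have h4 := hlt c b' (Or.inl h4)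
      have h3 := o1 _ _ hc2
      rw [Fin.lt_def] at *
      omega
  · right
    rcases (Relation.TransGen.tail'_iff).1 h2 with ⟨c, hc1, hc2⟩
    rcases (Relation.reflTransGen_iff_eq_or_transGen).1 hc1 with rfl | h4
    · exact hc2
    · have h4 := hlt b c (Or.inr h4)
      have h3 := o2 _ _ hc2
      rw [Fin.lt_def] at *
      omega

variable {R}

theorem Good.tr (h : R.Good) : R.tr.Good where
  gen := R.tr_generic h.gen
  o1 i j hij := by
    rw [tr_dirRight] at hij
    exact Fin.rev_lt_rev.1 (h.o2 _ _ hij)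
  o2 i j hij := by
    rw [tr_dirAbove] at hij
    exact Fin.rev_lt_rev.1 (h.o1 _ _ hij)
  o3 b b' hb := by
    rw [tr_dirRight, tr_dirAbove]
    have := h.o3 b'.rev b.rev (by simp only [Fin.val_rev]; omega)
    exact this.symm

theorem Good.rot (h : R.Good) : R.rot.Good where
  gen := R.rot_generic h.gen
  o1 i j hij := by
    rw [rot_dirRight] at hij
    exact Fin.rev_lt_rev.1 (h.o1 _ _ hij)
  o2 i j hij := by
    rw [rot_dirAbove] at hij
    exact Fin.rev_lt_rev.1 (h.o2 _ _ hij)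
  o3 b b' hb := by
    rw [rot_dirRight, rot_dirAbove]
    exact h.o3 b'.rev b.rev (by simp only [Fin.val_rev]; omega)

end Rectangulation

namespace Rectangulation

variable {n : ℕ} {R : Rectangulation n}

theorem dirAbove_of_TEdgeV {r q : Fin n} (h : R.TEdgeV r q) : R.DirAbove q r := by
  obtain ⟨h1, h2⟩ := h
  have m1 := R.lt_y r
  have m2 := R.lt_y q
  have m3 := R.yb_nonneg r
  have m4 := R.yt_le_one q
  refine ⟨h2, by linarith, by linarith, fun x hx1 hx2 => ?_⟩
  rw [h1, max_self] at hx2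
  rcases min_le_iff.1 hx1 with hx | hx
  · exact R.onH_bot hx (by linarith)
  · rw [h2]; exact R.onH_top hx hx2

theorem dirAbove_of_SEdgeV {r q : Fin n} (h : R.SEdgeV q r) : R.DirAbove r q := by
  obtain ⟨h1, h2⟩ := h
  have m1 := R.lt_y r
  have m2 := R.lt_y q
  have m3 := R.yb_nonneg q
  have m4 := R.yt_le_one r
  refine ⟨h2.symm, by linarith, by linarith, fun x hx1 hx2 => ?_⟩
  rw [h1, min_self] at hx1
  rcases le_max_iff.1 hx2 with hx | hx
  · exact R.onH_bot hx1 hx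
  · rw [← h2]; exact R.onH_top (by linarith) hx

theorem dirRight_of_SEdgeH {u A : Fin n} (h : R.SEdgeH u A) : R.DirRightOf A u := by
  obtain ⟨h1, h2⟩ := h
  have m1 := R.lt_x u
  have m2 := R.lt_x A
  have m3 := R.xl_nonneg u
  have m4 := R.xr_le_one A
  refine ⟨h1.symm, by linarith, by linarith, fun x hx1 hx2 => ?_⟩
  rw [h2, min_self] at hx1
  rcases le_max_iff.1 hx2 with hx | hx
  · exact R.onV_left hx1 hx
  · rw [← h1]; exact R.onV_right (by linarith) hx

/-- vertical chains in the target tree -/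
abbrev VS (R : Rectangulation n) : Fin n → Fin n → Prop := Relation.ReflTransGen R.TEdgeV

theorem VS_facts {a c : Fin n} (h : R.VS a c) : R.xr c = R.xr a ∧ R.yb a ≤ R.yb c ∧
    R.yt a ≤ R.yt c ∧ ∀ y, R.yb a ≤ y → y ≤ R.yt c → R.OnVertEdge (R.xr a, y) := by
  induction h with
  | refl => exact ⟨rfl, le_rfl, le_rfl, fun y h1 h2 => R.onV_right h1 h2⟩
  | @tail b d _ h2 ih =>
    obtain ⟨i1, i2, i3, i4⟩ := ih
    obtain ⟨j1, j2⟩ := h2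
    have m1 := R.lt_y b
    have m2 := R.lt_y d
    refine ⟨by linarith, by linarith, by linarith, fun y h1 h2 => ?_⟩
    by_cases hy : y ≤ R.yt b
    · exact i4 y h1 hy
    · rw [← i1, ← j1]
      exact R.onV_right (by linarith) h2

theorem VS_TReach {a c : Fin n} (h : R.VS a c) : R.TReach a c :=
  Relation.ReflTransGen.mono (fun _ _ h => Or.inr h) _ _ h

theorem Good.VS_le (hR : R.Good) {a c : Fin n} (h : R.VS a c) : c ≤ a := by
  induction h with
  | refl => exact le_rfl
  | tail _ h2 ih => exact (hR.o2 _ _ (dirAbove_of_TEdgeV h2)).le.trans ih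

theorem Good.chain (hR : R.Good) (H : ℝ) (a : Fin n) : R.yb a < H →
    (∀ y, R.yb a ≤ y → y ≤ H → R.OnVertEdge (R.xr a, y)) →
    ∃ c, R.VS a c ∧ R.yb c < H ∧ H ≤ R.yt c := by
  induction a using WellFoundedLT.induction with
  | ind a ih =>
    intro h1 h2
    have m1 := R.lt_y a
    by_cases h3 : H ≤ R.yt a
    · exact ⟨a, .refl, h1, h3⟩
    · obtain ⟨a', ha'⟩ := R.exists_TEdgeV (not_le.1 h3) (fun y hy1 hy2 => h2 y (by linarith) hy2)
      obtain ⟨e1, e2⟩ := id ha'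
      obtain ⟨c, hc1, hc2⟩ := ih a' (hR.o2 _ _ (dirAbove_of_TEdgeV ha')) (by linarith)
        (fun y hy1 hy2 => by rw [e1]; exact h2 y (by linarith) hy2)
      exact ⟨c, .head ha' hc1, hc2⟩

theorem Good.bottom (hR : R.Good) (t : Fin n) : ∃ u, R.VS u t ∧ R.TVLeaf u := by
  induction t using WellFoundedGT.induction with
  | ind t ih =>
    by_cases h : R.TVLeaf t
    · exact ⟨t, .refl, h⟩
    · simp only [TVLeaf, not_not] at h
      obtain ⟨r, hr⟩ := h
      obtain ⟨u, hu1, hu2⟩ := ih r (hR.o2 _ _ (dirAbove_of_TEdgeV hr))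
      exact ⟨u, hu1.tail hr, hu2⟩

theorem Good.gap_SVLeaf (hR : R.Good) {b b' : Fin n} (hb : b'.val = b.val + 1)
    (h : R.DirRightOf b' b) : R.SVLeaf b' := by
  rintro ⟨r, hr⟩
  have h1 := hR.o2 _ _ (dirAbove_of_SEdgeV hr)
  obtain ⟨e1, e2⟩ := hr
  obtain ⟨g1, g2, g3, g4⟩ := h
  have m1 := R.lt_y b'
  have m2 := R.lt_y r
  have h2 := hR.o1 b r ⟨by linarith, by linarith, by linarith, fun y hy1 hy2 => by
    rw [← e1]
    by_cases hy : R.yb r ≤ y ∧ y ≤ R.yt r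
    · rw [e1]; exact R.onV_left hy.1 hy.2
    · apply g4
      · rcases min_le_iff.1 hy1 with hy | hy
        · exact min_le_iff.2 (Or.inl (by linarith))
        · exact min_le_iff.2 (Or.inr hy)
      · rw [not_and_or] at hy
        push Not at hy
        rcases hy with hy | hy
        · exact le_max_iff.2 (Or.inl (by linarith))
        · rcases le_max_iff.1 hy2 with hy | hy
          · linarith
          · exact le_max_iff.2 (Or.inr hy)⟩
  rw [Fin.lt_def] at *
  omega

theorem Good.gap_TVLeaf (hR : R.Good) {b b' : Fin n} (hb : b'.val = b.val + 1)
    (h : R.DirRightOf b' b) : R.TVLeaf b := by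
  have := hR.rot.gap_SVLeaf (b := b'.rev) (b' := b.rev) (by simp only [Fin.val_rev]; omega)
    (by rw [rot_dirRight]; simpa using h)
  rw [rot_SVLeaf] at this
  simpa using this

theorem Good.gap_below (hR : R.Good) {b b' : Fin n} (hb : b'.val = b.val + 1)
    (h : R.DirRightOf b' b) : R.yb b < R.yt b' := by
  by_contra hlt
  push Not at hlt
  obtain ⟨g1, g2, g3, g4⟩ := id h
  have m1 := R.lt_y b'
  have m2 := R.lt_y b
  exact hR.gap_SVLeaf hb h (R.exists_SEdgeV (h := R.yt b) (by linarith) (fun y h1 h2 =>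
    g4 y (min_le_iff.2 (Or.inl (by linarith))) (le_max_iff.2 (Or.inr h2))))

theorem Good.gap_chain (hR : R.Good) {b b' : Fin n} (hb : b'.val = b.val + 1)
    (h : R.DirRightOf b' b) : ∃ c, R.VS b c ∧ R.TEdgeH c b' := by
  have h0 := hR.gap_below hb h
  obtain ⟨g1, g2, g3, g4⟩ := id h
  have m1 := R.lt_y b'
  have m2 := R.lt_y b
  obtain ⟨c, c1, c2, c3⟩ := hR.chain (R.yt b') b h0 (fun y hy1 hy2 => by
    rw [← g1]
    exact g4 y (min_le_iff.2 (Or.inr hy1)) (le_max_iff.2 (Or.inl hy2)))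
  obtain ⟨e1, e2, e3, e4⟩ := VS_facts c1
  refine ⟨c, c1, by linarith, ?_⟩
  by_contra hne
  exact hR.gap_SVLeaf hb h (R.exists_SEdgeV (h := R.yt c) (lt_of_le_of_ne c3 hne) (fun y h1 h2 => by
    rw [g1]; exact e4 y (by linarith) h2))

theorem Good.next_right (hR : R.Good) {u v : Fin n} (hx : R.xr u < 1) (hul : R.TVLeaf u)
    (hv : v.val = u.val + 1) : R.DirRightOf v u := by
  rcases hR.o3 u v hv with h3 | h3
  · exact h3
  · exfalso
    obtain ⟨k1, k2, k3, k4⟩ := h3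
    obtain ⟨A, hA⟩ := R.corner hx k2 hul
    have hA1 := hR.o1 _ _ (dirRight_of_SEdgeH hA)
    obtain ⟨a1, a2⟩ := hA
    have m5 := R.lt_x A
    have m6 := R.lt_x u
    have hA2 := hR.o2 A v ⟨by linarith, by linarith, by linarith, fun x hx1 hx2 => by
      rw [← a2]
      by_cases hx : R.xl A ≤ x ∧ x ≤ R.xr A
      · rw [a2]; exact R.onH_bot hx.1 hx.2
      · apply k4
        · rcases min_le_iff.1 hx1 with hx | hx
          · exact min_le_iff.2 (Or.inl (by linarith))
          · exact min_le_iff.2 (Or.inr hx)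
        · rw [not_and_or] at hx
          push Not at hx
          rcases hx with hx | hx
          · exact le_max_iff.2 (Or.inl (by linarith))
          · rcases le_max_iff.1 hx2 with hx | hx
            · linarith
            · exact le_max_iff.2 (Or.inr hx)⟩
    rw [Fin.lt_def] at *
    omega

theorem Good.g1 (hR : R.Good) {t q : Fin n} (h : R.TEdgeH t q) :
    t < q ∧ ∃ u : Fin n, u.val + 1 = q.val ∧ R.VS u t := by
  obtain ⟨e1, e2⟩ := id h
  have m1 := R.lt_x t
  have m2 := R.lt_x q
  have m3 := R.xl_nonneg t
  have m4 := R.xr_le_one q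
  have key : ∀ u, R.VS u t → R.DirRightOf q u := by
    intro u hu
    obtain ⟨f1, f2, f3, f4⟩ := VS_facts hu
    refine ⟨by linarith, by linarith, by linarith, fun y hy1 hy2 => ?_⟩
    have hy3 : y ≤ R.yt q := by
      rcases le_max_iff.1 hy2 with hy | hy <;> linarith
    rcases min_le_iff.1 hy1 with hy | hy
    · exact R.onV_left hy hy3
    · rw [e1, f1]; exact f4 y hy (by linarith)
  refine ⟨hR.o1 _ _ (key t .refl), ?_⟩
  obtain ⟨u, hu, hul⟩ := hR.bottom t
  have huq := hR.o1 _ _ (key u hu)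
  obtain ⟨f1, f2, f3, f4⟩ := VS_facts hu
  let v : Fin n := ⟨u.val + 1, by have := q.2; rw [Fin.lt_def] at huq; omega⟩
  have h3 := hR.next_right (v := v) (by linarith) hul rfl
  obtain ⟨c, c1, c2⟩ := hR.gap_chain rfl h3
  have htc : t = c := by
    rcases Relation.ReflTransGen.total_of_right_unique
      (show Relator.RightUnique R.TEdgeV from fun a b c h1 h2 => R.TEdgeV_uniq h1 h2) hu c1 with h4 | h4
    · rcases Relation.ReflTransGen.cases_head h4 with h5 | ⟨s, h5, _⟩
      · exact h5
      · exact (R.TEdge_excl hR.gen h h5).elim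
    · rcases Relation.ReflTransGen.cases_head h4 with h5 | ⟨s, h5, _⟩
      · exact h5.symm
      · exact (R.TEdge_excl hR.gen c2 h5).elim
  subst htc
  have := R.TEdgeH_uniq h c2
  exact ⟨u, by rw [this], hu⟩

theorem Good.g2 (hR : R.Good) {t q : Fin n} (h : R.TEdgeV t q) :
    q < t ∧ ∃ u : Fin n, u.val = q.val + 1 ∧ Relation.ReflTransGen R.TEdgeH u t := by
  have h' : R.tr.TEdgeH t.rev q.rev := by rw [tr_TEdgeH]; simpa using h
  obtain ⟨h1, u, h2, h3⟩ := hR.tr.g1 h'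
  refine ⟨Fin.rev_lt_rev.1 h1, u.rev, ?_, ?_⟩
  · simp only [Fin.val_rev] at *
    have := u.2
    have := q.2
    omega
  · have := (rtg_rev (fun a b => R.tr_TEdgeV a b) u t.rev).1 h3
    simpa using this

theorem Good.TReach_V (hR : R.Good) {b b' : Fin n} (hb : b'.val = b.val + 1)
    (h : R.DirRightOf b' b) : R.TReach b b' := by
  obtain ⟨c, c1, c2⟩ := hR.gap_chain hb h
  exact (VS_TReach c1).tail (Or.inl c2)

theorem Good.TReach_H (hR : R.Good) {b b' : Fin n} (hb : b'.val = b.val + 1)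
    (h : R.DirAbove b b') : R.TReach b' b := by
  have := hR.tr.TReach_V (b := b'.rev) (b' := b.rev) (by simp only [Fin.val_rev]; omega)
    (by rw [tr_dirRight]; simpa using h)
  rw [tr_TReach] at this
  simpa using this

theorem Good.SReach_V (hR : R.Good) {b b' : Fin n} (hb : b'.val = b.val + 1)
    (h : R.DirRightOf b' b) : R.SReach b b' := by
  have := hR.rot.TReach_V (b := b'.rev) (b' := b.rev) (by simp only [Fin.val_rev]; omega)
    (by rw [rot_dirRight]; simpa using h)
  rw [rot_TReach] at this
  simpa using this

theorem Good.SReach_H (hR : R.Good) {b b' : Fin n} (hb : b'.val = b.val + 1)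
    (h : R.DirAbove b b') : R.SReach b' b := by
  have := hR.rot.TReach_H (b := b'.rev) (b' := b.rev) (by simp only [Fin.val_rev]; omega)
    (by rw [rot_dirAbove]; simpa using h)
  rw [rot_TReach] at this
  simpa using this

theorem TReach_anti {a b : Fin n} (h1 : R.TReach a b) (h2 : R.TReach b a) : a = b := by
  rcases R.TReach_le h1 with h | h
  · exact h
  · rcases R.TReach_le h2 with h' | h'
    · exact h'.symm
    · linarith

theorem SReach_anti {a b : Fin n} (h1 : R.SReach a b) (h2 : R.SReach b a) : a = b := by
  have := TReach_anti (R := R.rot) (a := a.rev) (b := b.rev) (by rw [rot_TReach]; simpa using h2)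
    (by rw [rot_TReach]; simpa using h1)
  exact Fin.rev_injective this

theorem Good.treeAx (hR : R.Good) : TreeAx R.TEdgeH R.TEdgeV where
  g1 t q h := (hR.g1 h).2
  g2 t q h := (hR.g2 h).2
  llt t q h := (hR.g1 h).1
  rlt t q h := (hR.g2 h).1
  uniq a b c h1 h2 := by
    rcases h1 with h1 | h1 <;> rcases h2 with h2 | h2
    · exact R.TEdgeH_uniq h1 h2
    · exact (R.TEdge_excl hR.gen h1 h2).elim
    · exact (R.TEdge_excl hR.gen h2 h1).elim
    · exact R.TEdgeV_uniq h1 h2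
  gap b b' hb := by
    rcases hR.o3 b b' hb with h | h
    · exact Or.inl (hR.TReach_V hb h)
    · exact Or.inr (hR.TReach_H hb h)
  anti a b h1 h2 := TReach_anti h1 h2

theorem Good.not_both (hR : R.Good) {b b' : Fin n} (hb : b'.val = b.val + 1)
    (h : R.DirRightOf b' b) (h' : R.DirAbove b b') : False := by
  have := TReach_anti (hR.TReach_V hb h) (hR.TReach_H hb h')
  subst this
  omega

end Rectangulation

namespace Rectangulation

variable {n : ℕ} {R : Rectangulation n}

theorem Good.commonV_succ (hR : R.Good) {a b : Fin n} (h : R.CommonVLeaf a b) :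
    b.val = a.val + 1 ∧ R.DirRightOf b a := by
  obtain ⟨h1, h2, h3, h4⟩ := h
  have hd : R.DirRightOf b a := ⟨h3.symm, by rw [← h3, sameV_swap]; exact h4⟩
  refine ⟨?_, hd⟩
  have hab := hR.o1 _ _ hd
  let v : Fin n := ⟨a.val + 1, by have := b.2; rw [Fin.lt_def] at hab; omega⟩
  have hv : R.DirRightOf v a := hR.next_right h4.2.1 h1 rfl
  have hvs := hR.gap_SVLeaf rfl hv
  have hbl := hR.gap_below rfl hv
  obtain ⟨p1, p2, p3, p4⟩ := hv
  obtain ⟨q1, q2, q3⟩ := h4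
  have m1 := R.lt_y a
  have m2 := R.lt_y b
  have m3 := R.lt_y v
  have l1 := R.lt_x b
  have l2 := R.lt_x v
  have e : R.yt b = R.yt v := by
    rcases lt_trichotomy (R.yt b) (R.yt v) with hlt | heq | hlt
    · exfalso
      by_cases hc : R.yt b < R.yb a
      · apply h2
        apply R.exists_SEdgeV (h := R.yt a) (by linarith)
        intro y hy1 hy2
        rw [← h3]
        exact q3 y (min_le_iff.2 (Or.inr (by linarith))) (le_max_iff.2 (Or.inl hy2))
      · apply h2
        apply R.exists_SEdgeV hlt
        intro y hy1 hy2
        rw [← h3, ← p1]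
        exact p4 y (min_le_iff.2 (Or.inr (by linarith))) (le_max_iff.2 (Or.inl hy2))
    · exact heq
    · exfalso
      apply hvs
      apply R.exists_SEdgeV hlt
      intro y hy1 hy2
      rw [p1]
      exact q3 y (min_le_iff.2 (Or.inl (by linarith))) (le_max_iff.2 (Or.inr hy2))
  have : b = v := by apply R.eq_of_overlap <;> linarith
  rw [this]

theorem Good.commonV_iff (hR : R.Good) {a b : Fin n} :
    R.CommonVLeaf a b ↔ b.val = a.val + 1 ∧ R.DirRightOf b a := by
  refine ⟨hR.commonV_succ, fun ⟨h1, h2⟩ => ⟨hR.gap_TVLeaf h1 h2, hR.gap_SVLeaf h1 h2, h2.1.symm, ?_⟩⟩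
  rw [← h2.1, sameV_swap]
  exact h2.2

theorem Good.commonH_iff (hR : R.Good) {a b : Fin n} :
    R.CommonHLeaf a b ↔ a.val = b.val + 1 ∧ R.DirAbove b a := by
  have := hR.tr.commonV_iff (a := a.rev) (b := b.rev)
  rw [tr_CommonV, tr_dirRight] at this
  simp only [Fin.rev_rev, Fin.val_rev] at this
  rw [this]
  have := a.2
  have := b.2
  constructor <;> rintro ⟨h1, h2⟩ <;> exact ⟨by omega, h2⟩

theorem Good.HSubT_iff (hR : R.Good) (i a : Fin n) : R.HSubT i a ↔ a < i ∧ R.TReach a i :=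
  hR.treeAx.hsub_iff i a
theorem Good.VSubT_iff (hR : R.Good) (i a : Fin n) : R.VSubT i a ↔ i < a ∧ R.TReach a i :=
  hR.treeAx.vsub_iff i a
theorem Good.VSubS_iff (hR : R.Good) (j a : Fin n) : R.VSubS j a ↔ a < j ∧ R.SReach j a := by
  have := hR.rot.VSubT_iff j.rev a.rev
  rw [rot_VSubT, rot_TReach, Fin.rev_lt_rev] at this
  simpa using this
theorem Good.HSubS_iff (hR : R.Good) (j a : Fin n) : R.HSubS j a ↔ j < a ∧ R.SReach j a := by
  have := hR.rot.HSubT_iff j.rev a.rev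
  rw [rot_HSubT, rot_TReach, Fin.rev_lt_rev] at this
  simpa using this

theorem Good.T_convex (hR : R.Good) {a i k : Fin n} (ha : R.TReach a i)
    (hk : (a ≤ k ∧ k ≤ i) ∨ (i ≤ k ∧ k ≤ a)) : R.TReach k i := hR.treeAx.convex ha hk

theorem Good.S_convex (hR : R.Good) {a i k : Fin n} (ha : R.SReach i a)
    (hk : (a ≤ k ∧ k ≤ i) ∨ (i ≤ k ∧ k ≤ a)) : R.SReach i k := by
  have := hR.rot.T_convex (a := a.rev) (i := i.rev) (k := k.rev)
    (by rw [rot_TReach]; simpa using ha) (by simp only [Fin.rev_le_rev]; tauto)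
  rw [rot_TReach] at this
  simpa using this

theorem Good.T_max (hR : R.Good) {a b : Fin n} (hab : a ≤ b) :
    ∃ i, a ≤ i ∧ i ≤ b ∧ ∀ k, a ≤ k → k ≤ b → R.TReach k i :=
  hR.treeAx.exists_max a (b.val - a.val) b (by rw [Fin.le_def] at hab; omega)

theorem Good.S_min (hR : R.Good) {a b : Fin n} (hab : a ≤ b) :
    ∃ i, a ≤ i ∧ i ≤ b ∧ ∀ k, a ≤ k → k ≤ b → R.SReach i k := by
  obtain ⟨i, h1, h2, h3⟩ := hR.rot.T_max (Fin.rev_le_rev.2 hab)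
  refine ⟨i.rev, Fin.le_rev_iff.1 h2, Fin.rev_le_iff.1 h1, fun k hk1 hk2 => ?_⟩
  have := h3 k.rev (Fin.rev_le_rev.2 hk2) (Fin.rev_le_rev.2 hk1)
  rw [rot_TReach] at this
  simpa using this

/-- the gap condition counted by `cv` -/
def GapIn (R : Rectangulation n) (i j b : Fin n) : Prop :=
  ∃ b' : Fin n, b'.val = b.val + 1 ∧ i ≤ b ∧ b' ≤ j ∧ R.TReach b i ∧ R.SReach j b'

theorem Good.cv_eq (hR : R.Good) (i j : Fin n) : R.cv i j = {b | R.GapIn i j b}.ncard := by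
  simp only [cv, hR.commonV_iff, hR.commonH_iff, hR.VSubT_iff, hR.VSubS_iff]
  apply Set.ncard_congr (fun p _ => min p.1 p.2)
  · rintro ⟨a, b⟩ h
    simp only [Set.mem_ofPred_eq] at h ⊢
    rcases h with ⟨⟨h1, h2⟩, h3, h4⟩ | ⟨⟨h1, h2⟩, h3, h4⟩
    · rw [min_eq_left (by rw [Fin.le_def]; omega)]
      refine ⟨b, h1, ?_, ?_, ?_, ?_⟩
      · rcases h3 with h3 | h3
        · exact h3.1.le
        · exact h3.ge
      · rcases h4 with h4 | h4
        · exact h4.1.le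
        · exact h4.le
      · rcases h3 with h3 | h3
        · exact h3.2
        · rw [h3]; exact .refl
      · rcases h4 with h4 | h4
        · exact h4.2
        · rw [h4]; exact .refl
    · rw [min_eq_right (by rw [Fin.le_def]; omega)]
      have e1 : i ≤ b := by have := h3.1; rw [Fin.lt_def] at this; rw [Fin.le_def]; omega
      have e2 : a ≤ j := by have := h4.1; rw [Fin.lt_def] at this; rw [Fin.le_def]; omega
      have e3 : b ≤ a := by rw [Fin.le_def]; omega
      exact ⟨a, h1, e1, e2, hR.T_convex h3.2 (Or.inr ⟨e1, e3⟩), hR.S_convex h4.2 (Or.inl ⟨e3, e2⟩)⟩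
  · rintro ⟨a, b⟩ ⟨c, d⟩ h1 h2 h
    simp only [Set.mem_ofPred_eq] at h1 h2
    dsimp only at h
    rcases h1 with ⟨⟨h1, h1'⟩, _, _⟩ | ⟨⟨h1, h1'⟩, _, _⟩ <;>
    rcases h2 with ⟨⟨h2, h2'⟩, _, _⟩ | ⟨⟨h2, h2'⟩, _, _⟩
    · rw [min_eq_left (by rw [Fin.le_def]; omega), min_eq_left (by rw [Fin.le_def]; omega)] at h
      subst h
      rw [Prod.mk.injEq]
      exact ⟨rfl, Fin.ext (by omega)⟩
    · rw [min_eq_left (by rw [Fin.le_def]; omega), min_eq_right (by rw [Fin.le_def]; omega)] at h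
      subst h
      have : b = c := Fin.ext (by omega)
      subst this
      exact (hR.not_both h1 h1' h2').elim
    · rw [min_eq_right (by rw [Fin.le_def]; omega), min_eq_left (by rw [Fin.le_def]; omega)] at h
      subst h
      have : a = d := Fin.ext (by omega)
      subst this
      exact (hR.not_both h2 h2' h1').elim
    · rw [min_eq_right (by rw [Fin.le_def]; omega), min_eq_right (by rw [Fin.le_def]; omega)] at h
      subst h
      rw [Prod.mk.injEq]
      exact ⟨Fin.ext (by omega), rfl⟩
  · rintro b ⟨b', h1, h2, h3, h4, h5⟩
    rcases hR.o3 b b' h1 with h | h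
    · refine ⟨(b, b'), Or.inl ⟨⟨h1, h⟩, ?_, ?_⟩, min_eq_left (by rw [Fin.le_def]; dsimp only; omega)⟩
      · rcases eq_or_lt_of_le h2 with h2 | h2
        · exact Or.inr h2.symm
        · exact Or.inl ⟨h2, h4⟩
      · rcases eq_or_lt_of_le h3 with h3 | h3
        · exact Or.inr h3
        · exact Or.inl ⟨h3, h5⟩
    · refine ⟨(b', b), Or.inr ⟨⟨h1, h⟩, ⟨?_, ?_⟩, ⟨?_, ?_⟩⟩, min_eq_right (by rw [Fin.le_def]; dsimp only; omega)⟩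
      · rw [Fin.le_def] at h2; rw [Fin.lt_def]; dsimp only; omega
      · exact (hR.TReach_H h1 h).trans h4
      · rw [Fin.le_def] at h3; rw [Fin.lt_def]; dsimp only; omega
      · exact h5.trans (hR.SReach_H h1 h)

theorem Good.hT_eq (hR : R.Good) (i : Fin n) : R.hT i = {a | a ≤ i ∧ R.TReach a i}.ncard := by
  simp only [hT, hR.HSubT_iff]
  have : {a | a ≤ i ∧ R.TReach a i} = insert i {a | a < i ∧ R.TReach a i} := by
    ext a
    simp only [Set.mem_ofPred_eq, Set.mem_insert_iff]
    constructor
    · rintro ⟨h1, h2⟩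
      rcases eq_or_lt_of_le h1 with h1 | h1
      · exact Or.inl h1
      · exact Or.inr ⟨h1, h2⟩
    · rintro (rfl | h)
      · exact ⟨le_rfl, .refl⟩
      · exact ⟨h.1.le, h.2⟩
  rw [this, Set.ncard_insert_of_notMem (by simp), add_comm]

theorem Good.hS_eq (hR : R.Good) (i : Fin n) : R.hS i = {a | i ≤ a ∧ R.SReach i a}.ncard := by
  simp only [hS, hR.HSubS_iff]
  have : {a | i ≤ a ∧ R.SReach i a} = insert i {a | i < a ∧ R.SReach i a} := by
    ext a
    simp only [Set.mem_ofPred_eq, Set.mem_insert_iff]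
    constructor
    · rintro ⟨h1, h2⟩
      rcases eq_or_lt_of_le h1 with h1 | h1
      · exact Or.inl h1.symm
      · exact Or.inr ⟨h1, h2⟩
    · rintro (rfl | h)
      · exact ⟨le_rfl, .refl⟩
      · exact ⟨h.1.le, h.2⟩
  rw [this, Set.ncard_insert_of_notMem (by simp), add_comm]

/-- triples counted by `h^T_i cv_{ij} h^S_j` -/
def Tp (R : Rectangulation n) (i j : Fin n) (t : Fin n × Fin n × Fin n) : Prop :=
  (t.1 ≤ i ∧ R.TReach t.1 i) ∧ R.GapIn i j t.2.1 ∧ (j ≤ t.2.2 ∧ R.SReach j t.2.2)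

theorem Good.prod_eq (hR : R.Good) (i j : Fin n) :
    R.hT i * R.cv i j * R.hS j = (Finset.univ.filter (R.Tp i j)).card := by
  rw [hR.hT_eq, hR.cv_eq, hR.hS_eq, mul_assoc, ← Set.ncard_prod, ← Set.ncard_prod,
    ← Set.ncard_coe_finset]
  congr 1
  ext ⟨a, b, c⟩
  simp [Tp]

theorem Good.Tp_unique (hR : R.Good) {i j i' j' : Fin n} {t : Fin n × Fin n × Fin n}
    (h : R.Tp i j t) (h' : R.Tp i' j' t) : i = i' ∧ j = j' := by
  obtain ⟨⟨a1, a2⟩, ⟨b', b1, b2, b3, b4, b5⟩, c1, c2⟩ := h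
  obtain ⟨⟨p1, p2⟩, ⟨q', q1, q2, q3, q4, q5⟩, r1, r2⟩ := h'
  have : b' = q' := Fin.ext (by omega)
  subst this
  constructor
  · apply TReach_anti (R := R)
    · rcases le_total i i' with h | h
      · exact hR.T_convex p2 (Or.inl ⟨a1, h⟩)
      · exact hR.T_convex q4 (Or.inr ⟨h, b2⟩)
    · rcases le_total i i' with h | h
      · exact hR.T_convex b4 (Or.inr ⟨h, q2⟩)
      · exact hR.T_convex a2 (Or.inl ⟨p1, h⟩)
  · apply SReach_anti (R := R)
    · rcases le_total j j' with h | h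
      · exact hR.S_convex c2 (Or.inr ⟨h, r1⟩)
      · exact hR.S_convex b5 (Or.inl ⟨q3, h⟩)
    · rcases le_total j j' with h | h
      · exact hR.S_convex q5 (Or.inl ⟨b3, h⟩)
      · exact hR.S_convex r2 (Or.inr ⟨h, c1⟩)

theorem Tp_order {i j : Fin n} {t : Fin n × Fin n × Fin n}
    (h : R.Tp i j t) : t.1 ≤ t.2.1 ∧ t.2.1 < t.2.2 ∧ i < j := by
  obtain ⟨⟨a1, a2⟩, ⟨b', b1, b2, b3, b4, b5⟩, c1, c2⟩ := h
  simp only [Fin.le_def, Fin.lt_def] at *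
  omega

theorem Good.Tp_exists (hR : R.Good) {t : Fin n × Fin n × Fin n} (h1 : t.1 ≤ t.2.1)
    (h2 : t.2.1 < t.2.2) : ∃ i j, R.Tp i j t := by
  let b' : Fin n := ⟨t.2.1.val + 1, by have := t.2.2.2; rw [Fin.lt_def] at h2; omega⟩
  have hb' : b' ≤ t.2.2 := by rw [Fin.le_def]; rw [Fin.lt_def] at h2; simp only [b']; omega
  obtain ⟨i, i1, i2, i3⟩ := hR.T_max h1
  obtain ⟨j, j1, j2, j3⟩ := hR.S_min hb'
  exact ⟨i, j, ⟨i1, i3 _ le_rfl h1⟩, ⟨b', rfl, i2, j1, i3 _ h1 le_rfl, j3 _ le_rfl hb'⟩, j2,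
    j3 _ hb' le_rfl⟩

theorem Good.Tp_T (hR : R.Good) {i j k : Fin n} {t : Fin n × Fin n × Fin n}
    (h : R.Tp i j t) (h1 : t.1 ≤ k) (h2 : k ≤ t.2.1) : R.TReach k i := by
  obtain ⟨⟨a1, a2⟩, ⟨b', b1, b2, b3, b4, b5⟩, c1, c2⟩ := h
  rcases le_total k i with h | h
  · exact hR.T_convex a2 (Or.inl ⟨h1, h⟩)
  · exact hR.T_convex b4 (Or.inr ⟨h, h2⟩)

theorem Good.Tp_S (hR : R.Good) {i j k : Fin n} {t : Fin n × Fin n × Fin n}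
    (h : R.Tp i j t) (h1 : t.2.1 < k) (h2 : k ≤ t.2.2) : R.SReach j k := by
  obtain ⟨⟨a1, a2⟩, ⟨b', b1, b2, b3, b4, b5⟩, c1, c2⟩ := h
  have : b' ≤ k := by rw [Fin.le_def]; rw [Fin.lt_def] at h1; omega
  rcases le_total k j with h | h
  · exact hR.S_convex b5 (Or.inl ⟨this, h⟩)
  · exact hR.S_convex c2 (Or.inr ⟨h, h2⟩)

theorem Good.path_split (hR : R.Good) {b c b' i : Fin n} (h1 : R.VS b c) (h2 : R.TEdgeH c b')
    (h3 : R.TReach b i) : (R.VS b i ∧ R.VS i c) ∨ R.TReach b' i := by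
  induction h1 using Relation.ReflTransGen.head_induction_on with
  | refl =>
    rcases Relation.ReflTransGen.cases_head h3 with rfl | ⟨d, hd, hd'⟩
    · exact Or.inl ⟨.refl, .refl⟩
    · have := hR.treeAx.uniq _ _ _ hd (Or.inl h2)
      subst this
      exact Or.inr hd'
  | head hab hbc ih =>
    rcases Relation.ReflTransGen.cases_head h3 with rfl | ⟨d, hd, hd'⟩
    · exact Or.inl ⟨.refl, .head hab hbc⟩
    · have := hR.treeAx.uniq _ _ _ hd (Or.inr hab)
      subst this
      rcases ih hd' with h | h
      · exact Or.inl ⟨.head hab h.1, h.2⟩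
      · exact Or.inr h

theorem Good.pos_T (hR : R.Good) {b b' i : Fin n} (hb : b'.val = b.val + 1)
    (h : R.DirRightOf b' b) (hi : R.TReach b i) :
    R.TReach b' i ∨ (R.xr i = R.xr b ∧ R.yb b ≤ R.yb i ∧ R.yt i ≤ R.yt b') := by
  obtain ⟨c, c1, c2⟩ := hR.gap_chain hb h
  rcases hR.path_split c1 c2 hi with ⟨h1, h2⟩ | h1
  · right
    have f1 := VS_facts h1
    have f2 := VS_facts h2
    exact ⟨f1.1, f1.2.1, by have := c2.2; linarith [f2.2.2.1]⟩
  · exact Or.inl h1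

theorem Good.pos_S (hR : R.Good) {b b' j : Fin n} (hb : b'.val = b.val + 1)
    (h : R.DirRightOf b' b) (hj : R.SReach j b') :
    R.SReach j b ∨ (R.xl j = R.xl b' ∧ R.yt j ≤ R.yt b' ∧ R.yb b ≤ R.yb j) := by
  have := hR.rot.pos_T (b := b'.rev) (b' := b.rev) (i := j.rev)
    (by simp only [Fin.val_rev]; omega)
    (by rw [rot_dirRight]; simpa using h) (by rw [rot_TReach]; simpa using hj)
  rw [rot_TReach] at this
  simp only [Fin.rev_rev, rot_xr, rot_yb, rot_yt, sub_right_inj, sub_le_sub_iff_left] at this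
  exact this

/-- `w` is compatible with `R`. -/
structure Compat (R : Rectangulation n) (w : Fin n → ℝ) : Prop where
  cT : ∀ a b, R.TReach a b → w a ≤ w b
  cS : ∀ a b, R.SReach a b → w a ≤ w b
  cV : ∀ i j, R.xr i = R.xl j → (w i < w j ↔ R.yb i < R.yt j)

theorem Good.vert_of_lt (hR : R.Good) {w : Fin n → ℝ} (hw : R.Compat w) {i j : Fin n}
    {t : Fin n × Fin n × Fin n} (h : R.Tp i j t) (hij : w i < w j) : R.VertPattern i j := by
  obtain ⟨_, ⟨b', b1, b2, b3, b4, b5⟩, _⟩ := h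
  have w1 := hw.cT _ _ b4
  have w2 := hw.cS _ _ b5
  rcases hR.o3 _ b' b1 with h | h
  · rcases hR.pos_T b1 h b4 with h1 | ⟨p1, p2, p3⟩
    · have := hw.cT _ _ h1
      linarith
    · rcases hR.pos_S b1 h b5 with h1 | ⟨q1, q2, q3⟩
      · have := hw.cS _ _ h1
        linarith
      · obtain ⟨g1, g2, g3, g4⟩ := h
        have e : R.xr i = R.xl j := by linarith
        refine ⟨e, ⟨by linarith, by linarith, fun y hy1 hy2 => ?_⟩, (hw.cV _ _ e).1 hij⟩
        rw [e, q1]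
        apply g4
        · apply min_le_iff.2 (Or.inr _)
          rcases min_le_iff.1 hy1 with hy | hy <;> linarith
        · apply le_max_iff.2 (Or.inl _)
          rcases le_max_iff.1 hy2 with hy | hy <;> linarith
  · have := hw.cT _ _ (hR.TReach_H b1 h)
    linarith

theorem Compat.not_vert {w : Fin n → ℝ} (hw : R.Compat w) {i j : Fin n} (hij : w j < w i) :
    ¬ R.VertPattern i j := by
  rintro ⟨h1, _, h3⟩
  have := (hw.cV _ _ h1).2 h3
  linarith

end Rectangulation


/-- triples `a ≤ b < c` -/
def triples (n : ℕ) : Finset (Fin n × Fin n × Fin n) :=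
  Finset.univ.filter (fun t => t.1 ≤ t.2.1 ∧ t.2.1 < t.2.2)

/-- triples whose left interval meets `P` and right interval meets `Q` -/
def tripG {n : ℕ} (P Q : Fin n → Prop) : Finset (Fin n × Fin n × Fin n) :=
  (triples n).filter (fun t =>
    (∃ k, t.1 ≤ k ∧ k ≤ t.2.1 ∧ P k) ∧ (∃ k, t.2.1 < k ∧ k ≤ t.2.2 ∧ Q k))

theorem mem_triples {n : ℕ} {t : Fin n × Fin n × Fin n} :
    t ∈ triples n ↔ t.1 ≤ t.2.1 ∧ t.2.1 < t.2.2 := by simp [triples]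

theorem tripG_rev_le {n : ℕ} (P Q : Fin n → Prop) :
    (tripG P Q).card ≤ (tripG (fun k => Q k.rev) (fun k => P k.rev)).card := by
  apply Finset.card_le_card_of_injOn
    (fun t => (t.2.2.rev, ⟨n - 1 - (t.2.1.val + 1), by have := t.1.2; omega⟩, t.1.rev))
  · rintro ⟨a, b, c⟩ h
    simp only [tripG, Finset.coe_filter, mem_triples, Set.mem_ofPred_eq] at h ⊢
    obtain ⟨⟨h1, h2⟩, ⟨k, k1, k2, k3⟩, ⟨l, l1, l2, l3⟩⟩ := h
    have := c.2
    simp only [Fin.le_def, Fin.lt_def, Fin.val_rev] at *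
    refine ⟨⟨by omega, by omega⟩, ⟨l.rev, ?_, ?_, by simpa using l3⟩,
      ⟨k.rev, ?_, ?_, by simpa using k3⟩⟩ <;> simp only [Fin.val_rev] <;> omega
  · rintro ⟨a, b, c⟩ h ⟨a', b', c'⟩ h' e
    simp only [tripG, Finset.coe_filter, mem_triples, Set.mem_ofPred_eq] at h h'
    simp only [Prod.mk.injEq, Fin.rev_inj, Fin.mk.injEq] at e ⊢
    obtain ⟨e1, e2, e3⟩ := e
    have h2 := h.1.2
    have h2' := h'.1.2
    have := c.2
    have := c'.2
    simp only [Fin.lt_def] at h2 h2'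
    exact ⟨e3, Fin.ext (by omega), e1⟩

theorem tripG_rev {n : ℕ} (P Q : Fin n → Prop) :
    (tripG P Q).card = (tripG (fun k => Q k.rev) (fun k => P k.rev)).card := by
  apply le_antisymm (tripG_rev_le P Q)
  have := tripG_rev_le (fun k => Q k.rev) (fun k : Fin n => P k.rev)
  simpa using this

theorem consec_ncard {n : ℕ} (P Q : Fin n → Prop) :
    {p : Finset (Fin n) × Finset (Fin n) | ConsecIntervals p.1 p.2 ∧ (∃ k ∈ p.1, P k) ∧
      (∃ k ∈ p.2, Q k)}.ncard = (tripG P Q).card := by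
  rw [← Set.ncard_coe_finset]
  symm
  apply Set.ncard_congr (fun t _ => (Finset.Icc t.1 t.2.1, Finset.Ioc t.2.1 t.2.2))
  · rintro ⟨a, b, c⟩ h
    simp only [tripG, Finset.coe_filter, mem_triples, Set.mem_ofPred_eq] at h ⊢
    obtain ⟨⟨h1, h2⟩, ⟨k, k1, k2, k3⟩, ⟨l, l1, l2, l3⟩⟩ := h
    refine ⟨⟨⟨⟨k, Finset.mem_Icc.2 ⟨k1, k2⟩⟩, ?_⟩, ⟨⟨l, Finset.mem_Ioc.2 ⟨l1, l2⟩⟩, ?_⟩, ?_⟩,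
      ⟨k, Finset.mem_Icc.2 ⟨k1, k2⟩, k3⟩, ⟨l, Finset.mem_Ioc.2 ⟨l1, l2⟩, l3⟩⟩
    · intro x y z hx hz hxy hyz
      rw [Finset.mem_Icc] at *
      exact ⟨hx.1.trans hxy, hyz.trans hz.2⟩
    · intro x y z hx hz hxy hyz
      rw [Finset.mem_Ioc] at *
      exact ⟨hx.1.trans_le hxy, hyz.trans hz.2⟩
    · have e1 : (Finset.Icc a b).max' ⟨k, Finset.mem_Icc.2 ⟨k1, k2⟩⟩ = b := by
        apply le_antisymm
        · apply Finset.max'_le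
          intro y hy
          exact (Finset.mem_Icc.1 hy).2
        · exact Finset.le_max' _ _ (Finset.mem_Icc.2 ⟨h1, le_rfl⟩)
      let b' : Fin n := ⟨b.val + 1, by have := c.2; rw [Fin.lt_def] at h2; omega⟩
      have e2 : (Finset.Ioc b c).min' ⟨l, Finset.mem_Ioc.2 ⟨l1, l2⟩⟩ = b' := by
        apply le_antisymm
        · apply Finset.min'_le
          rw [Finset.mem_Ioc, Fin.lt_def, Fin.le_def]
          rw [Fin.lt_def] at h2
          simp only [b']
          omega
        · apply Finset.le_min'
          intro y hy
          have := (Finset.mem_Ioc.1 hy).1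
          rw [Fin.lt_def] at this
          rw [Fin.le_def]
          simp only [b']
          omega
      rw [e1, e2]
  · rintro ⟨a, b, c⟩ ⟨a', b', c'⟩ h h' e
    simp only [tripG, Finset.coe_filter, mem_triples, Set.mem_ofPred_eq] at h h'
    simp only [Prod.mk.injEq] at e ⊢
    obtain ⟨e1, e2⟩ := e
    have f1 : ∀ k, (a ≤ k ∧ k ≤ b) ↔ (a' ≤ k ∧ k ≤ b') := fun k => by
      rw [← Finset.mem_Icc, ← Finset.mem_Icc, e1]
    have f2 : ∀ k, (b < k ∧ k ≤ c) ↔ (b' < k ∧ k ≤ c') := fun k => by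
      rw [← Finset.mem_Ioc, ← Finset.mem_Ioc, e2]
    have g1 := (f1 a).1 ⟨le_rfl, h.1.1⟩
    have g2 := (f1 b).1 ⟨h.1.1, le_rfl⟩
    have g3 := (f1 a').2 ⟨le_rfl, h'.1.1⟩
    have g4 := (f1 b').2 ⟨h'.1.1, le_rfl⟩
    have g5 := (f2 c).1 ⟨h.1.2, le_rfl⟩
    have g6 := (f2 c').2 ⟨h'.1.2, le_rfl⟩
    exact ⟨le_antisymm g3.1 g1.1, le_antisymm g2.2 g4.2, le_antisymm g5.2 g6.2⟩
  · rintro ⟨I, J⟩ ⟨⟨hI, hJ, h⟩, ⟨k, k1, k2⟩, ⟨l, l1, l2⟩⟩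
    have h : (I.max' hI.1 : ℕ) + 1 = (J.min' hJ.1 : ℕ) := h
    simp only at k1 l1
    have eI : Finset.Icc (I.min' hI.1) (I.max' hI.1) = I := by
      ext x
      rw [Finset.mem_Icc]
      exact ⟨fun hx => hI.2 _ x _ (Finset.min'_mem _ hI.1) (Finset.max'_mem _ hI.1) hx.1 hx.2,
        fun hx => ⟨Finset.min'_le _ _ hx, Finset.le_max' _ _ hx⟩⟩
    have eJ : Finset.Ioc (I.max' hI.1) (J.max' hJ.1) = J := by
      ext x
      rw [Finset.mem_Ioc]
      constructor
      · intro hx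
        refine hJ.2 _ x _ (Finset.min'_mem _ hJ.1) (Finset.max'_mem _ hJ.1) ?_ hx.2
        have := hx.1
        change J.min' hJ.1 ≤ x
        rw [Fin.lt_def] at this
        rw [Fin.le_def]
        omega
      · intro hx
        refine ⟨?_, Finset.le_max' _ _ hx⟩
        have := Finset.min'_le _ _ hx
        rw [Fin.le_def] at this
        rw [Fin.lt_def]
        omega
    refine ⟨(I.min' hI.1, I.max' hI.1, J.max' hJ.1), ?_, by simp only [eI, eJ]⟩
    simp only [tripG, Finset.coe_filter, mem_triples, Set.mem_ofPred_eq]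
    have hk : k ∈ Finset.Icc (I.min' hI.1) (I.max' hI.1) := by rw [eI]; exact k1
    have hl : l ∈ Finset.Ioc (I.max' hI.1) (J.max' hJ.1) := by rw [eJ]; exact l1
    rw [Finset.mem_Icc] at hk
    rw [Finset.mem_Ioc] at hl
    exact ⟨⟨hk.1.trans hk.2, hl.1.trans_le hl.2⟩, ⟨k, hk.1, hk.2, k2⟩, ⟨l, hl.1, hl.2, l2⟩⟩

theorem fStrong_eq {n : ℕ} (X : Finset (Fin n)) :
    fStrong n X = (tripG (fun k => k.rev ∈ X) (fun k => k.rev ∉ X)).card +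
      (tripG (fun k => k ∈ X) (fun k => k ∉ X)).card := by
  rw [fStrong]
  congr 1
  · rw [← tripG_rev (fun k => k ∉ X) (fun k => k ∈ X), ← consec_ncard]
    congr 1
    ext p
    simp only [Set.mem_ofPred_eq, Finset.not_subset, Finset.mem_compl, not_not]
  · rw [← consec_ncard]
    congr 1
    ext p
    simp only [Set.mem_ofPred_eq, Finset.not_subset, Finset.mem_compl, not_not]

namespace Rectangulation
variable {n : ℕ} {R : Rectangulation n}

/-- value of one term -/
def pval (R : Rectangulation n) (X : Fin n → Prop) (p : Fin n × Fin n) : ℝ :=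
  (if R.VertPattern p.1 p.2 then 0 else 1) * ((if X p.1 then 1 else 0) - (if X p.2 then 1 else 0))

/-- sum over `X` of the vertical part -/
def pv (R : Rectangulation n) (X : Fin n → Prop) : ℝ :=
  ∑ p ∈ Finset.univ.filter (fun p : Fin n × Fin n => p.1 < p.2),
    ((R.hT p.1 * R.cv p.1 p.2 * R.hS p.2 : ℕ) : ℝ) * R.pval X p

theorem Good.pv_eq (hR : R.Good) (X : Fin n → Prop) :
    ∃ F : Fin n × Fin n × Fin n → ℝ, R.pv X = ∑ t ∈ triples n, F t ∧
      ∀ t ∈ triples n, ∃ i j, R.Tp i j t ∧ F t = R.pval X (i, j) := by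
  refine ⟨fun t => ∑ p ∈ Finset.univ.filter (fun p : Fin n × Fin n => p.1 < p.2),
    if R.Tp p.1 p.2 t then R.pval X p else 0, ?_, ?_⟩
  · rw [Finset.sum_comm, pv]
    apply Finset.sum_congr rfl
    intro p _
    rw [hR.prod_eq, ← Finset.sum_filter, Finset.sum_const, nsmul_eq_mul]
    congr 2
    congr 1
    ext t
    simp only [Finset.mem_filter, Finset.mem_univ, true_and, mem_triples]
    exact ⟨fun h => ⟨⟨(Tp_order h).1, (Tp_order h).2.1⟩, h⟩, fun h => h.2⟩
  · intro t ht
    rw [mem_triples] at ht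
    obtain ⟨i, j, hij⟩ := hR.Tp_exists ht.1 ht.2
    refine ⟨i, j, hij, ?_⟩
    dsimp only
    rw [Finset.sum_eq_single (i, j)]
    · simp [hij]
    · rintro ⟨i', j'⟩ _ hne
      rw [if_neg]
      intro h
      obtain ⟨rfl, rfl⟩ := hR.Tp_unique hij h
      exact hne rfl
    · intro h
      simp only [Finset.mem_filter, Finset.mem_univ, true_and] at h
      exact (h (Tp_order hij).2.2).elim

theorem Good.pv_le (hR : R.Good) (X : Fin n → Prop) :
    R.pv X ≤ (tripG X (fun k => ¬ X k)).card := by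
  obtain ⟨F, h1, h2⟩ := hR.pv_eq X
  rw [h1, tripG, Finset.card_filter, Nat.cast_sum]
  apply Finset.sum_le_sum
  intro t ht
  obtain ⟨i, j, hij, hF⟩ := h2 t ht
  obtain ⟨⟨a1, a2⟩, ⟨b', b1, b2, b3, b4, b5⟩, c1, c2⟩ := hij
  have hbj : t.2.1 < j := by rw [Fin.lt_def]; rw [Fin.le_def] at b3; omega
  rw [hF, pval]
  by_cases hc : X i ∧ ¬ X j
  · have hcond : (∃ k, t.1 ≤ k ∧ k ≤ t.2.1 ∧ X k) ∧ (∃ k, t.2.1 < k ∧ k ≤ t.2.2 ∧ ¬ X k) :=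
      ⟨⟨i, a1, b2, hc.1⟩, ⟨j, hbj, c1, hc.2⟩⟩
    simp only [hc.1, hc.2, hcond, and_self, if_true, if_false]
    split_ifs <;> norm_num
  · refine le_trans ?_ (Nat.cast_nonneg _)
    by_cases hi : X i <;> by_cases hj : X j <;> simp_all
    split_ifs <;> norm_num

theorem Good.pv_ge (hR : R.Good) {w : Fin n → ℝ} (hw : R.Compat w) (X : Fin n → Prop)
    (hX : ∀ i j, X i → w i ≤ w j → X j) :
    (tripG X (fun k => ¬ X k)).card ≤ R.pv X := by
  obtain ⟨F, h1, h2⟩ := hR.pv_eq X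
  rw [h1, tripG, Finset.card_filter, Nat.cast_sum]
  apply Finset.sum_le_sum
  intro t ht
  obtain ⟨i, j, hij, hF⟩ := h2 t ht
  have hup : X i → ¬ X j → w j < w i := fun hi hj => by
    by_contra h
    exact hj (hX _ _ hi (not_lt.1 h))
  have hup' : ¬ X i → X j → w i < w j := fun hi hj => by
    by_contra h
    exact hi (hX _ _ hj (not_lt.1 h))
  rw [hF, pval]
  split_ifs with hc hv hi hj hj hi hj hj hv hi hj hj hi hj hj
  all_goals first
    | (exfalso
       obtain ⟨⟨k, k1, k2, k3⟩, ⟨l, l1, l2, l3⟩⟩ := hc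
       have Xi : X i := hX _ _ k3 (hw.cT _ _ (hR.Tp_T hij k1 k2))
       have Xj : ¬ X j := fun h => l3 (hX _ _ h (hw.cS _ _ (hR.Tp_S hij l1 l2)))
       first
         | exact (by assumption : ¬ X i) Xi
         | exact Xj (by assumption)
         | exact hw.not_vert (hup Xi Xj) hv)
    | (norm_num; done)
    | exact (hv (hR.vert_of_lt hw hij (hup' hi hj))).elim

end Rectangulation


namespace Rectangulation
variable {n : ℕ} {R : Rectangulation n}

/-- the point of `R` -/
def pt (R : Rectangulation n) : Fin n → ℝ :=
  ∑ p ∈ Finset.univ.filter (fun p : Fin n × Fin n => p.1 < p.2),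
            ((((R.hT p.1 * R.cv p.1 p.2 * R.hS p.2 : ℕ) : ℝ) *
                (if R.VertPattern p.1 p.2 then 0 else 1) -
              ((R.vS p.1 * R.ch p.1 p.2 * R.vT p.2 : ℕ) : ℝ) *
                (if R.HorPattern p.1 p.2 then 0 else 1)) •
              (stdVec n p.1 - stdVec n p.2))

theorem sum_stdVec (X : Finset (Fin n)) (i : Fin n) :
    ∑ k ∈ X, stdVec n i k = if i ∈ X then 1 else 0 := by
  simp [stdVec]

theorem pv_tr (R : Rectangulation n) (X : Finset (Fin n)) : R.tr.pv (fun k => k.rev ∈ X) =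
    ∑ p ∈ Finset.univ.filter (fun p : Fin n × Fin n => p.1 < p.2),
      ((R.vS p.1 * R.ch p.1 p.2 * R.vT p.2 : ℕ) : ℝ) *
                (if R.HorPattern p.1 p.2 then 0 else 1) *
        ((if p.2 ∈ X then 1 else 0) - (if p.1 ∈ X then 1 else 0)) := by
  rw [pv]
  symm
  apply Finset.sum_bij (fun p _ => (p.2.rev, p.1.rev))
  · rintro ⟨i, j⟩ h
    simpa using h
  · rintro ⟨i, j⟩ _ ⟨i', j'⟩ _ h
    simp only [Prod.mk.injEq, Fin.rev_inj] at h ⊢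
    exact ⟨h.2, h.1⟩
  · rintro ⟨i, j⟩ h
    refine ⟨(j.rev, i.rev), by simpa using h, by simp⟩
  · rintro ⟨i, j⟩ h
    simp only [pval, tr_hT, tr_hS, tr_cv, tr_VertPattern, Fin.rev_rev]
    push_cast
    ring

theorem sum_pt (R : Rectangulation n) (X : Finset (Fin n)) :
    ∑ k ∈ X, R.pt k = R.pv (fun k => k ∈ X) + R.tr.pv (fun k => k.rev ∈ X) := by
  rw [pv_tr, pv, ← Finset.sum_add_distrib]
  simp only [pt, Finset.sum_apply]
  rw [Finset.sum_comm]
  apply Finset.sum_congr rfl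
  intro p _
  simp only [Pi.smul_apply, Pi.sub_apply, smul_eq_mul]
  rw [← Finset.mul_sum, Finset.sum_sub_distrib, sum_stdVec, sum_stdVec, pval]
  ring

theorem sum_pt_univ (R : Rectangulation n) : ∑ k, R.pt k = 0 := by
  rw [sum_pt]
  simp [pv, pval]

theorem Good.sum_pt_le (hR : R.Good) (X : Finset (Fin n)) :
    ∑ k ∈ X, R.pt k ≤ fStrong n X := by
  rw [sum_pt, fStrong_eq, add_comm]
  push_cast
  exact add_le_add (hR.tr.pv_le _) (hR.pv_le _)

theorem Good.sum_pt_ge (hR : R.Good) {w : Fin n → ℝ} (hw : R.Compat w)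
    (hw' : R.tr.Compat (fun k => w k.rev)) (X : Finset (Fin n))
    (hX : ∀ i j, i ∈ X → w i ≤ w j → j ∈ X) :
    (fStrong n X : ℝ) ≤ ∑ k ∈ X, R.pt k := by
  rw [sum_pt, fStrong_eq, add_comm]
  push_cast
  exact add_le_add (hR.pv_ge hw _ hX) (hR.tr.pv_ge hw' _ (fun i j => hX i.rev j.rev))

end Rectangulation

theorem abel_nonneg : ∀ (n : ℕ) (e d : Fin n → ℝ), Monotone e → (∀ k, 0 ≤ e k) →
    (∀ k, 0 ≤ ∑ m ∈ Finset.univ.filter (fun m => k ≤ m), d m) → 0 ≤ ∑ m, e m * d m := by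
  intro n
  induction n with
  | zero => intro e d _ _ _; simp
  | succ n ih =>
    intro e d he h0 hd
    have h1 := ih (fun m => e m.succ - e 0) (fun m => d m.succ)
      (fun a b hab => by
        have := he (Fin.succ_le_succ_iff.2 hab)
        simp only
        linarith)
      (fun k => by
        have := he (Fin.zero_le k.succ)
        linarith)
      (fun k => by
        have := hd k.succ
        rw [Finset.sum_filter, Fin.sum_univ_succ, if_neg (by simp)] at this
        simpa [Finset.sum_filter] using this)
    have h2 := hd 0
    simp only [Fin.zero_le, Finset.filter_true] at h2
    have h3 : ∑ m, e m * d m = e 0 * (∑ m, d m) + ∑ m : Fin n, (e m.succ - e 0) * d m.succ := by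
      rw [Fin.sum_univ_succ, Fin.sum_univ_succ, mul_add, Finset.mul_sum, add_assoc,
        ← Finset.sum_add_distrib]
      congr 1
      apply Finset.sum_congr rfl
      intro m _
      ring
    rw [h3]
    have := mul_nonneg (h0 0) h2
    linarith

theorem abel_total (n : ℕ) (e d : Fin n → ℝ) (he : Monotone e) (h0 : ∑ m, d m = 0)
    (hd : ∀ k : Fin n, k.val ≠ 0 → 0 ≤ ∑ m ∈ Finset.univ.filter (fun m => k ≤ m), d m) :
    0 ≤ ∑ m, e m * d m := by
  rcases Nat.eq_zero_or_pos n with rfl | hn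
  · simp
  let z : Fin n := ⟨0, hn⟩
  have hz : ∀ k, z ≤ k := fun k => Fin.le_def.2 (Nat.zero_le _)
  have := abel_nonneg n (fun k => e k - e z) d (fun a b hab => by
      have := he hab
      simp only
      linarith) (fun k => by have := he (hz k); linarith) (fun k => by
      by_cases hk : k.val = 0
      · have hk : k = z := Fin.ext hk
        subst hk
        rw [Finset.filter_true_of_mem (fun m _ => hz m), h0]
      · exact hd k hk)
  simp only [sub_mul, Finset.sum_sub_distrib, ← Finset.mul_sum, h0, mul_zero, sub_zero] at this
  exact this

theorem main_of_construction (n : ℕ)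
    (hE : ∀ w : Fin n → ℝ, Function.Injective w → ∃ R : Rectangulation n, R.Generic ∧
      R.InorderLabeled ∧ R.Compat w ∧ R.tr.Compat (fun k => w k.rev)) :
    convexHull ℝ {x : Fin n → ℝ |
        ∃ R : Rectangulation n, R.Generic ∧ R.InorderLabeled ∧ x = R.pt} =
      {x : Fin n → ℝ | (∑ i, x i) = 0 ∧
        ∀ X : Finset (Fin n), X.Nonempty → X ≠ Finset.univ →
          (∑ i ∈ X, x i) ≤ (fStrong n X : ℝ)} := by
  apply Set.Subset.antisymm
  · apply convexHull_min
    · rintro x ⟨R, h1, h2, rfl⟩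
      exact ⟨R.sum_pt_univ, fun X _ _ => (R.good_of_inorder h1 h2).sum_pt_le X⟩
    · intro x hx y hy a b ha hb hab
      simp only [Set.mem_ofPred_eq] at hx hy ⊢
      simp only [Pi.add_apply, Pi.smul_apply, smul_eq_mul, Finset.sum_add_distrib,
        ← Finset.mul_sum]
      refine ⟨by rw [hx.1, hy.1]; simp, fun X h1 h2 => ?_⟩
      have e1 := mul_le_mul_of_nonneg_left (hx.2 X h1 h2) ha
      have e2 := mul_le_mul_of_nonneg_left (hy.2 X h1 h2) hb
      have e3 : a * (fStrong n X : ℝ) + b * (fStrong n X : ℝ) = fStrong n X := by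
        rw [← add_mul, hab, one_mul]
      linarith
  · rintro x ⟨hx0, hx⟩
    have hinj : ∀ σ : Equiv.Perm (Fin n), Function.Injective (fun i => ((σ i : ℕ) : ℝ)) := by
      intro σ i j hij
      exact σ.injective (Fin.ext (Nat.cast_injective hij))
    choose Rf r1 r2 r3 r4 using fun σ : Equiv.Perm (Fin n) => hE _ (hinj σ)
    let S' : Set (Fin n → ℝ) := Set.range (fun σ => (Rf σ).pt)
    have hS' : S' ⊆ {x : Fin n → ℝ |
        ∃ R : Rectangulation n, R.Generic ∧ R.InorderLabeled ∧ x = R.pt} := by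
      rintro _ ⟨σ, rfl⟩
      exact ⟨Rf σ, r1 σ, r2 σ, rfl⟩
    apply convexHull_mono hS'
    by_contra hxn
    have hfin : S'.Finite := Set.finite_range _
    obtain ⟨f, u, hf1, hf2⟩ := geometric_hahn_banach_closed_point (convex_convexHull ℝ S')
      (hfin.isClosed_convexHull (𝕜 := ℝ)) hxn
    let c : Fin n → ℝ := fun i => f (Pi.single i 1)
    have hfc : ∀ y : Fin n → ℝ, f y = ∑ i, c i * y i := by
      intro y
      conv_lhs => rw [pi_eq_sum_univ' y]
      rw [map_sum]
      apply Finset.sum_congr rfl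
      intro i _
      rw [map_smul, smul_eq_mul, mul_comm]
    let τ := Tuple.sort c
    have hmono : Monotone (c ∘ τ) := Tuple.monotone_sort c
    let σ : Equiv.Perm (Fin n) := τ.symm
    have hgood := (Rf σ).good_of_inorder (r1 σ) (r2 σ)
    have key : 0 ≤ ∑ m, (c ∘ τ) m * ((Rf σ).pt (τ m) - x (τ m)) := by
      apply abel_total n _ _ hmono
      · rw [Equiv.sum_comp τ (fun i => (Rf σ).pt i - x i), Finset.sum_sub_distrib, hx0,
          (Rf σ).sum_pt_univ, sub_zero]
      · intro k hk
        let X : Finset (Fin n) := (Finset.univ.filter (fun m => k ≤ m)).map τ.toEmbedding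
        have hXm : ∀ i, i ∈ X ↔ k ≤ σ i := by
          intro i
          simp only [X, Finset.mem_map, Finset.mem_filter, Finset.mem_univ, true_and,
            Equiv.coe_toEmbedding]
          constructor
          · rintro ⟨m, hm, rfl⟩
            simpa [σ] using hm
          · intro h
            exact ⟨σ i, h, by simp [σ]⟩
        have hs : ∑ m ∈ Finset.univ.filter (fun m => k ≤ m), ((Rf σ).pt (τ m) - x (τ m)) =
            ∑ i ∈ X, (Rf σ).pt i - ∑ i ∈ X, x i := by
          rw [← Finset.sum_sub_distrib]
          simp only [X, Finset.sum_map, Equiv.coe_toEmbedding]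
        rw [hs]
        have e1 := hx X ⟨τ k, (hXm _).2 (by simp [σ])⟩ (by
          intro h
          have : τ ⟨0, by have := k.2; omega⟩ ∈ X := by rw [h]; exact Finset.mem_univ _
          rw [hXm] at this
          simp only [σ, Equiv.symm_apply_apply, Fin.le_def] at this
          omega)
        have e2 := hgood.sum_pt_ge (r3 σ) (r4 σ) X (by
          intro i j hi hij
          rw [hXm] at hi ⊢
          refine hi.trans ?_
          rw [Fin.le_def]
          exact_mod_cast hij)
        linarith
    have h1 := hf1 (Rf σ).pt (subset_convexHull ℝ _ ⟨σ, rfl⟩)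
    have h2 : ∑ m, (c ∘ τ) m * ((Rf σ).pt (τ m) - x (τ m)) = f (Rf σ).pt - f x := by
      rw [hfc, hfc, ← Finset.sum_sub_distrib]
      rw [← Equiv.sum_comp τ (fun i => c i * (Rf σ).pt i - c i * x i)]
      apply Finset.sum_congr rfl
      intro m _
      simp only [Function.comp]
      ring
    linarith



theorem exists_between_avoid (lo hi F : Finset ℝ) (h : ∀ x ∈ lo, ∀ y ∈ hi, x < y) :
    ∃ m, m ∉ F ∧ (∀ x ∈ lo, x < m) ∧ ∀ y ∈ hi, m < y := by
  obtain ⟨m1, a1, b1⟩ := Order.exists_between_finsets lo hi h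
  obtain ⟨m2, a2, b2⟩ := Order.exists_between_finsets (insert m1 lo) hi (by
    intro x hx y hy
    rcases Finset.mem_insert.1 hx with rfl | hx
    · exact b1 y hy
    · exact h x hx y hy)
  have hm : m1 < m2 := a2 m1 (Finset.mem_insert_self _ _)
  obtain ⟨m, hm1, hm2⟩ := (Set.Ioo_infinite hm).exists_notMem_finset F
  exact ⟨m, hm2, fun x hx => (a1 x hx).trans hm1.1, fun y hy => hm1.2.trans (b2 y hy)⟩

/-- linking condition between two gaps -/
def Linked (u : ℕ → ℝ) (c d : ℕ) : Prop :=
  ∃ b, c < b ∧ b < d ∧ (∀ k, c < k → k ≤ b → u k < u c) ∧ ∀ k, b < k → k ≤ d → u (d + 1) < u k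

theorem Y_exists (u : ℕ → ℝ) (hu : Function.Injective u) (D : Finset ℕ) :
    (∀ d ∈ D, u (d + 1) < u d) →
    ∃ Y : ℕ → ℝ, (∀ c ∈ D, ∀ d ∈ D, Y c = Y d → c = d) ∧ ∀ c ∈ D, ∀ d ∈ D, c < d →
      (u (d + 1) < u c → Y d < Y c) ∧ (u c < u (d + 1) → Linked u c d → Y c < Y d) := by
  induction D using Finset.induction_on_max_value (fun d => u (d + 1)) with
  | empty => intro _; exact ⟨fun _ => 0, by simp, by simp⟩
  | insert d D hdD hmax ih =>
    intro hD
    have hdd := hD d (Finset.mem_insert_self _ _)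
    obtain ⟨Y, hY1, hY2⟩ := ih (fun c hc => hD c (Finset.mem_insert_of_mem hc))
    have hlt : ∀ c ∈ D, u (c + 1) < u (d + 1) := by
      intro c hc
      refine lt_of_le_of_ne (hmax c hc) ?_
      intro h
      have := hu h
      have : c = d := by omega
      subst this
      exact hdD hc
    let lo := (D.filter (fun c => d < c ∨ (c < d ∧ u c < u (d + 1) ∧ Linked u c d))).image Y
    let hi := (D.filter (fun c => c < d ∧ u (d + 1) < u c)).image Y
    obtain ⟨m, hm1, hm2, hm3⟩ := exists_between_avoid lo hi (D.image Y) (by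
      intro x hx y hy
      simp only [lo, hi, Finset.mem_image, Finset.mem_filter] at hx hy
      obtain ⟨e, ⟨heD, he⟩, rfl⟩ := hx
      obtain ⟨c, ⟨hcD, hc1, hc2⟩, rfl⟩ := hy
      rcases he with he | ⟨he1, he2, b, b1, b2, b3, b4⟩
      · exact (hY2 c hcD e heD (by omega)).1 ((hlt e heD).trans hc2)
      · have hee := hD e (Finset.mem_insert_of_mem heD)
        have : c < e := by
          by_contra hce
          push Not at hce
          rcases eq_or_lt_of_le hce with rfl | hce
          · linarith
          · by_cases hcb : c ≤ b
            · have := b3 c hce hcb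
              linarith
            · have := b4 (c + 1) (by omega) (by omega)
              have := hlt c hcD
              linarith
        exact (hY2 c hcD e heD this).1 (by linarith))
    have hne : ∀ c ∈ D, c ≠ d := fun c hc h => hdD (h ▸ hc)
    refine ⟨Function.update Y d m, ?_, ?_⟩
    · intro c hc0 e he0
      rcases Finset.mem_insert.1 hc0 with rfl | hc <;> rcases Finset.mem_insert.1 he0 with rfl | he
      · intro _; rfl
      · rw [Function.update_self, Function.update_of_ne (hne e he)]
        intro h
        exact (hm1 (h ▸ Finset.mem_image_of_mem _ he)).elim
      · rw [Function.update_self, Function.update_of_ne (hne c hc)]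
        intro h
        exact (hm1 (h ▸ Finset.mem_image_of_mem _ hc)).elim
      · rw [Function.update_of_ne (hne c hc), Function.update_of_ne (hne e he)]
        exact hY1 c hc e he
    · intro c hc0 e he0 hce
      rcases Finset.mem_insert.1 hc0 with rfl | hc <;> rcases Finset.mem_insert.1 he0 with rfl | he
      · omega
      · rw [Function.update_self, Function.update_of_ne (hne e he)]
        refine ⟨fun _ => hm2 _ (Finset.mem_image_of_mem _ (Finset.mem_filter.2 ⟨he, Or.inl hce⟩)),
          fun h => ?_⟩
        have := hlt e he
        linarith
      · rw [Function.update_self, Function.update_of_ne (hne c hc)]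
        exact ⟨fun h => hm3 _ (Finset.mem_image_of_mem _ (Finset.mem_filter.2 ⟨hc, hce, h⟩)),
          fun h h' => hm2 _ (Finset.mem_image_of_mem _
            (Finset.mem_filter.2 ⟨hc, Or.inr ⟨hce, h, h'⟩⟩))⟩
      · rw [Function.update_of_ne (hne c hc), Function.update_of_ne (hne e he)]
        exact hY2 c hc e he hce

/-- first drop after `i` occurs at gap `d` -/
def Dn (u : ℕ → ℝ) (i d : ℕ) : Prop :=
  i ≤ d ∧ (∀ k, i < k → k ≤ d → u i < u k) ∧ u (d + 1) < u i
/-- last larger value before `i` is at `c` -/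
def Up (u : ℕ → ℝ) (i c : ℕ) : Prop :=
  c < i ∧ u i < u c ∧ ∀ k, c < k → k < i → u k < u i

theorem Dn_exists (u : ℕ → ℝ) (hu : Function.Injective u) {i N : ℕ} (h : i < N) (hN : u N < u i) :
    ∃ d, Dn u i d ∧ d < N := by
  have hex : ∃ m, i < m ∧ u m < u i := ⟨N, h, hN⟩
  have h1 := Nat.find_spec hex
  have h2 := Nat.find_min' hex ⟨h, hN⟩
  refine ⟨Nat.find hex - 1, ⟨by omega, fun k hk1 hk2 => ?_, ?_⟩, by omega⟩
  · have := Nat.find_min hex (m := k) (by omega)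
    simp only [not_and, not_lt] at this
    exact lt_of_le_of_ne (this hk1) (fun h => by have := hu h; omega)
  · have : Nat.find hex - 1 + 1 = Nat.find hex := by omega
    rw [this]
    exact h1.2

theorem Up_exists (u : ℕ → ℝ) (hu : Function.Injective u) {i : ℕ} (h : 0 < i) (hN : u i < u 0) :
    ∃ c, Up u i c := by
  let P : ℕ → Prop := fun m => m < i ∧ u i < u m
  have h1 : P (Nat.findGreatest P i) := Nat.findGreatest_spec (P := P) (m := 0) (by omega) ⟨h, hN⟩
  refine ⟨Nat.findGreatest P i, h1.1, h1.2, fun k hk1 hk2 => ?_⟩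
  have : ¬ P k := Nat.findGreatest_is_greatest hk1 hk2.le
  simp only [P, not_and, not_lt] at this
  exact lt_of_le_of_ne (this hk2) (fun h => by have := hu h; omega)

theorem Dn_gap {u : ℕ → ℝ} {i d : ℕ} (h : Dn u i d) : u (d + 1) < u d := by
  obtain ⟨h1, h2, h3⟩ := h
  rcases eq_or_lt_of_le h1 with rfl | h1
  · exact h3
  · have := h2 d h1 le_rfl
    linarith

theorem Up_le {u : ℕ → ℝ} {i c : ℕ} (h : Up u i c) : u (c + 1) ≤ u i := by
  obtain ⟨h1, h2, h3⟩ := h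
  rcases Nat.lt_or_ge (c + 1) i with h | h
  · exact (h3 _ (by omega) h).le
  · have : c + 1 = i := by omega
    rw [this]

theorem Dn_ge {u : ℕ → ℝ} {i d : ℕ} (h : Dn u i d) : u i ≤ u d := by
  obtain ⟨h1, h2, h3⟩ := h
  rcases eq_or_lt_of_le h1 with rfl | h1
  · exact le_rfl
  · exact (h2 d h1 le_rfl).le

theorem half_nat (u : ℕ → ℝ) (hu : Function.Injective u) (n : ℕ) (hn : 1 ≤ n)
    (h0 : ∀ i, 0 < i → u i < u 0) (hN : ∀ i, i ≤ n → u (n + 1) < u i) :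
    ∃ yb yt : ℕ → ℝ,
      (∀ i, 1 ≤ i → i ≤ n → 0 ≤ yb i ∧ yb i < yt i ∧ yt i ≤ 1) ∧
      (∀ i k, 1 ≤ k → i ≤ n → k < i → u i < u k → yt i ≤ yb k) ∧
      (∀ i j g, 1 ≤ i → j ≤ n → u i < u j → i ≤ g → g < j → (∀ k, i < k → k ≤ g → u k < u i) →
        (∀ k, g < k → k < j → u j < u k) → u i < u (g + 1) → u g < u j → yb i < yt j) ∧
      (∀ i, 1 ≤ i → i ≤ n → (∀ k, 1 ≤ k → k < i → u k < u i) → yt i = 1) ∧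
      (∀ i, 1 ≤ i → i ≤ n → (∀ k, i < k → k ≤ n → u i < u k) → yb i = 0) ∧
      (∀ i j, 1 ≤ i → i ≤ n → 1 ≤ j → j ≤ n → (yb i = yt j ↔ ∃ g, Dn u i g ∧ Up u j g)) ∧
      (∀ l i, 1 ≤ l → i ≤ n → l < i → u l < u i →
        (∀ k, 1 ≤ k → k < l → u l < u k → u k < u i → ∃ m, k < m ∧ m < l ∧ u i < u m) →
        yt i ≤ yt l) := by
  let D := (Finset.range (n + 1)).filter (fun d => u (d + 1) < u d)
  obtain ⟨Y0, hY0, hY1⟩ := Y_exists u hu D (fun d hd => (Finset.mem_filter.1 hd).2)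
  have D0 : 0 ∈ D := by
    simp only [D, Finset.mem_filter, Finset.mem_range]
    exact ⟨by omega, h0 _ (by omega)⟩
  have Dn' : n ∈ D := by
    simp only [D, Finset.mem_filter, Finset.mem_range]
    exact ⟨by omega, hN _ (by omega)⟩
  have hpos : 0 < Y0 0 - Y0 n := by
    have := (hY1 0 D0 n Dn' (by omega)).1 (h0 _ (by omega))
    linarith
  obtain ⟨Y, hYi, hYm, hYl, hYz, hYn⟩ : ∃ Y : ℕ → ℝ, (∀ c ∈ D, ∀ d ∈ D, Y c = Y d → c = d) ∧
      (∀ c ∈ D, ∀ d ∈ D, c < d → u (d + 1) < u c → Y d < Y c) ∧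
      (∀ c ∈ D, ∀ d ∈ D, c < d → u c < u (d + 1) → Linked u c d → Y c < Y d) ∧
      Y 0 = 1 ∧ Y n = 0 := by
    refine ⟨fun k => (Y0 k - Y0 n) / (Y0 0 - Y0 n), ?_, ?_, ?_, ?_, ?_⟩
    · intro c hc d hd h
      apply hY0 c hc d hd
      simp only at h
      rw [div_left_inj' hpos.ne'] at h
      linarith
    · intro c hc d hd hcd h
      simp only
      rw [div_lt_div_iff_of_pos_right hpos]
      have := (hY1 c hc d hd hcd).1 h
      linarith
    · intro c hc d hd hcd h h'
      simp only
      rw [div_lt_div_iff_of_pos_right hpos]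
      have := (hY1 c hc d hd hcd).2 h h'
      linarith
    · exact div_self hpos.ne'
    · simp
  have hle1 : ∀ c ∈ D, Y c ≤ 1 := by
    intro c hc
    rcases Nat.eq_zero_or_pos c with rfl | h
    · rw [hYz]
    · rw [← hYz]; exact (hYm 0 D0 c hc h (h0 _ (by omega))).le
  have hge0 : ∀ c ∈ D, 0 ≤ Y c := by
    intro c hc
    have : c ≤ n := by
      simp only [D, Finset.mem_filter, Finset.mem_range] at hc
      omega
    rcases eq_or_lt_of_le this with rfl | h
    · rw [hYn]
    · rw [← hYn]; exact (hYm c hc n Dn' h (hN _ (by omega))).le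
  have hd : ∀ i, ∃ d, 1 ≤ i → i ≤ n → Dn u i d ∧ d ∈ D := by
    intro i
    by_cases h : 1 ≤ i ∧ i ≤ n
    · obtain ⟨d, d1, d2⟩ := Dn_exists u hu (i := i) (N := n + 1) (by omega) (hN i h.2)
      refine ⟨d, fun _ _ => ⟨d1, ?_⟩⟩
      simp only [D, Finset.mem_filter, Finset.mem_range]
      exact ⟨d2, Dn_gap d1⟩
    · exact ⟨0, fun h1 h2 => (h ⟨h1, h2⟩).elim⟩
  have hc : ∀ i, ∃ c, 1 ≤ i → i ≤ n → Up u i c ∧ c ∈ D := by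
    intro i
    by_cases h : 1 ≤ i ∧ i ≤ n
    · obtain ⟨c, c1⟩ := Up_exists u hu (i := i) (by omega) (h0 i (by omega))
      refine ⟨c, fun _ _ => ⟨c1, ?_⟩⟩
      simp only [D, Finset.mem_filter, Finset.mem_range]
      have := c1.1
      exact ⟨by omega, lt_of_le_of_lt (Up_le c1) c1.2.1⟩
    · exact ⟨0, fun h1 h2 => (h ⟨h1, h2⟩).elim⟩
  choose d hd using hd
  choose c hc using hc
  refine ⟨fun i => Y (d i), fun i => Y (c i), ?_, ?_, ?_, ?_, ?_, ?_, ?_⟩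
  · intro i h1 h2
    obtain ⟨d1, d2⟩ := hd i h1 h2
    obtain ⟨c1, c2⟩ := hc i h1 h2
    exact ⟨hge0 _ d2, hYm _ c2 _ d2 (lt_of_lt_of_le c1.1 d1.1) (d1.2.2.trans c1.2.1), hle1 _ c2⟩
  · intro i k h1 h2 h3 h4
    obtain ⟨d1, d2⟩ := hd k h1 (by omega)
    obtain ⟨c1, c2⟩ := hc i (by omega) h2
    simp only
    have hd1 : d k < i := by
      by_contra h
      have := d1.2.1 i h3 (by omega)
      linarith
    have := Dn_ge d1
    rcases lt_trichotomy (c i) (d k) with h | h | h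
    · have := c1.2.2 (d k) h hd1
      linarith
    · rw [h]
    · refine (hYm _ d2 _ c2 h ?_).le
      have := Up_le c1
      linarith
  · intro i j g h1 h2 h3 h4 h5 h6 h7 h8 h9
    obtain ⟨d1, d2⟩ := hd i h1 (by omega)
    obtain ⟨c1, c2⟩ := hc j (by omega) h2
    simp only
    by_cases hcd : c j < d i
    · apply hYm _ c2 _ d2 hcd
      have := d1.2.2
      have := c1.2.1
      linarith
    · have hgi : i < g := by
        rcases eq_or_lt_of_le h4 with rfl | h
        · exfalso
          have e1 : j ≤ d i := by
            by_contra hlt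
            have e2 := d1.2.2
            rcases Nat.lt_or_ge (d i + 1) j with h | h
            · have := h7 (d i + 1) (by have := d1.1; omega) h
              linarith
            · have : d i + 1 = j := by omega
              rw [this] at e2
              linarith
          have := c1.1
          omega
        · exact h
      have hdi : d i = i := by
        by_contra hne
        have := d1.2.1 (i + 1) (by omega) (by have := d1.1; omega)
        have := h6 (i + 1) (by omega) (by omega)
        linarith
      have hgj : g + 1 < j := by
        by_contra hge
        have e1 : g + 1 = j := by omega
        have c3 := c1.1
        have c4 := c1.2.1
        rcases eq_or_lt_of_le (show i ≤ c j by omega) with h | h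
        · rw [← h] at c4; linarith
        · have := h6 (c j) h (by omega)
          linarith
      have hcj : c j + 1 = j := by
        by_contra hne
        have := c1.1
        have := c1.2.2 (j - 1) (by omega) (by omega)
        have := h7 (j - 1) (by omega) (by omega)
        linarith
      apply hYl _ d2 _ c2 (by omega)
      · rw [hdi, hcj]; exact h3
      · refine ⟨g, by omega, by omega, ?_, ?_⟩
        · rw [hdi]; exact h6
        · rw [hcj]; intro k hk1 hk2; exact h7 k hk1 (by omega)
  · intro i h1 h2 h3
    obtain ⟨c1, c2⟩ := hc i h1 h2
    have : c i = 0 := by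
      by_contra hne
      have := h3 (c i) (by omega) c1.1
      linarith [c1.2.1]
    simp only [this, hYz]
  · intro i h1 h2 h3
    obtain ⟨d1, d2⟩ := hd i h1 h2
    have : d i = n := by
      by_contra hne
      have : d i < n + 1 := by
        simp only [D, Finset.mem_filter, Finset.mem_range] at d2
        exact d2.1
      have := h3 (d i + 1) (by have := d1.1; omega) (by omega)
      linarith [d1.2.2]
    simp only [this, hYn]
  · intro i j h1 h2 h3 h4
    obtain ⟨d1, d2⟩ := hd i h1 h2
    obtain ⟨c1, c2⟩ := hc j h3 h4
    constructor
    · intro h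
      have := hYi _ d2 _ c2 h
      exact ⟨d i, d1, this ▸ c1⟩
    · rintro ⟨g, g1, g2⟩
      have e1 : d i = g := by
        rcases lt_trichotomy (d i) g with h | h | h
        · have := g1.2.1 (d i + 1) (by have := d1.1; omega) (by omega)
          linarith [d1.2.2]
        · exact h
        · have := d1.2.1 (g + 1) (by have := g1.1; omega) (by omega)
          linarith [g1.2.2]
      have e2 : c j = g := by
        rcases lt_trichotomy (c j) g with h | h | h
        · have := c1.2.2 g h g2.1
          linarith [g2.2.1]
        · exact h
        · have := g2.2.2 (c j) h c1.1
          linarith [c1.2.1]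
      simp only [e1, e2]
  · intro l i h1 h2 h3 h4 h5
    obtain ⟨c1, c2⟩ := hc i (by omega) h2
    obtain ⟨l1, l2⟩ := hc l h1 (by omega)
    have hul : u i < u (c l) := by
      rcases Nat.eq_zero_or_pos (c l) with h | h
      · rw [h]; exact h0 _ (by omega)
      · rcases lt_trichotomy (u i) (u (c l)) with h' | h' | h'
        · exact h'
        · have := hu h'
          have := l1.1
          omega
        · obtain ⟨m, m1, m2, m3⟩ := h5 (c l) h l1.1 l1.2.1 h'
          have := l1.2.2 m m1 m2
          linarith
    simp only
    have e1 : c l ≤ c i := by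
      by_contra h
      have := c1.2.2 (c l) (by omega) (by have := l1.1; omega)
      linarith
    rcases eq_or_lt_of_le e1 with h | h
    · rw [h]
    · exact (hYm _ l2 _ c2 h (by have := Up_le c1; linarith)).le



/-- one coordinate of the rectangulation built from a generic weight -/
structure Half {n : ℕ} (w yb yt : Fin n → ℝ) : Prop where
  p0 : ∀ i, 0 ≤ yb i ∧ yb i < yt i ∧ yt i ≤ 1
  p1 : ∀ i k, k < i → w i < w k → yt i ≤ yb k
  p2 : ∀ i j b b' : Fin n, b'.val = b.val + 1 → w i < w j → i ≤ b → b' ≤ j →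
    (∀ k, i < k → k ≤ b → w k < w i) → (∀ k, b' ≤ k → k < j → w j < w k) →
    w i < w b' → w b < w j → yb i < yt j
  p5 : ∀ i, (∀ k, k < i → w k < w i) → yt i = 1
  p5' : ∀ i, (∀ k, i < k → w i < w k) → yb i = 0
  p8 : ∀ i j, yb i = yt j ↔ ∃ b b' : Fin n, b'.val = b.val + 1 ∧ i ≤ b ∧ b' ≤ j ∧
    (∀ k, i < k → k ≤ b → w i < w k) ∧ w b' < w i ∧ w j < w b ∧
    (∀ k, b' ≤ k → k < j → w k < w j)
  p7 : ∀ l i, l < i → w l < w i →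
    (∀ k, k < l → w l < w k → w k < w i → ∃ m, k < m ∧ m < l ∧ w i < w m) → yt i ≤ yt l

theorem half_exists {n : ℕ} (hn : 1 ≤ n) (w : Fin n → ℝ) (hw : Function.Injective w) :
    ∃ yb yt, Half w yb yt := by
  obtain ⟨M, hM⟩ : ∃ M : ℝ, ∀ i, |w i| < M := by
    refine ⟨1 + ∑ i, |w i|, fun i => ?_⟩
    have := Finset.single_le_sum (f := fun i => |w i|) (fun i _ => abs_nonneg _) (Finset.mem_univ i)
    linarith
  have hM0 : 0 < M := lt_of_le_of_lt (abs_nonneg _) (hM ⟨0, hn⟩)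
  have hlo : ∀ i, -M < w i := fun i => (abs_lt.1 (hM i)).1
  have hhi : ∀ i, w i < M := fun i => (abs_lt.1 (hM i)).2
  let u : ℕ → ℝ := fun k => if k = 0 then M else if h : k - 1 < n then w ⟨k - 1, h⟩ else -M - k
  have u0 : u 0 = M := by simp [u]
  have u1 : ∀ i : Fin n, u (i.val + 1) = w i := by intro i; simp [u]
  have u2 : ∀ k, n < k → u k = -M - k := by
    intro k hk
    simp only [u]
    rw [if_neg (by omega), dif_neg (by omega)]
  have cas : ∀ k, k = 0 ∨ (∃ i : Fin n, k = i.val + 1) ∨ n < k := by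
    intro k
    rcases Nat.eq_zero_or_pos k with h | h
    · exact Or.inl h
    · by_cases h' : k ≤ n
      · exact Or.inr (Or.inl ⟨⟨k - 1, by omega⟩, by simp only; omega⟩)
      · exact Or.inr (Or.inr (by omega))
  have hu : Function.Injective u := by
    intro a b hab
    rcases cas a with rfl | ⟨i, rfl⟩ | ha <;> rcases cas b with rfl | ⟨j, rfl⟩ | hb
    · rfl
    · rw [u0, u1] at hab; have := hhi j; linarith
    · rw [u0, u2 _ hb] at hab; have : (0:ℝ) ≤ b := by positivity
      linarith
    · rw [u0, u1] at hab; have := hhi i; linarith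
    · rw [u1, u1] at hab; rw [hw hab]
    · rw [u1, u2 _ hb] at hab; have : (0:ℝ) ≤ b := by positivity
      have := hlo i
      linarith
    · rw [u0, u2 _ ha] at hab; have : (0:ℝ) ≤ a := by positivity
      linarith
    · rw [u1, u2 _ ha] at hab; have : (0:ℝ) ≤ a := by positivity
      have := hlo j
      linarith
    · rw [u2 _ ha, u2 _ hb] at hab
      have : (a:ℝ) = b := by linarith
      exact_mod_cast this
  have hh0 : ∀ i, 0 < i → u i < u 0 := by
    intro i hi
    rcases cas i with rfl | ⟨i, rfl⟩ | ha
    · omega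
    · rw [u0, u1]; exact hhi i
    · rw [u0, u2 _ ha]; have : (0:ℝ) ≤ i := by positivity
      linarith
  have hhN : ∀ i, i ≤ n → u (n + 1) < u i := by
    intro i hi
    have : (0:ℝ) ≤ ((n + 1 : ℕ) : ℝ) := by positivity
    rcases cas i with rfl | ⟨i, rfl⟩ | ha
    · rw [u0, u2 _ (by omega)]; linarith
    · rw [u1, u2 _ (by omega)]; have := hlo i; linarith
    · omega
  obtain ⟨yb, yt, q0, q1, q2, q5, q5', q8, q7⟩ := half_nat u hu n hn hh0 hhN
  have fin : ∀ k, 1 ≤ k → k ≤ n → ∃ i : Fin n, k = i.val + 1 := by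
    intro k h1 h2
    exact ⟨⟨k - 1, by omega⟩, by simp only; omega⟩
  refine ⟨fun i => yb (i.val + 1), fun i => yt (i.val + 1), ?_, ?_, ?_, ?_, ?_, ?_, ?_⟩
  · intro i
    exact q0 _ (by omega) (by omega)
  · intro i k h1 h2
    exact q1 _ _ (by omega) (by omega) (by omega) (by rw [u1, u1]; exact h2)
  · intro i j b b' hb h1 h2 h3 h4 h5 h6 h7
    have hb' : b.val + 1 + 1 = b'.val + 1 := by omega
    rw [Fin.le_def] at h2 h3
    refine q2 _ _ (b.val + 1) (by omega) (by omega) (by rw [u1, u1]; exact h1) (by omega) (by omega)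
      ?_ ?_ (by rw [hb', u1, u1]; exact h6) (by rw [u1, u1]; exact h7)
    · intro k hk1 hk2
      obtain ⟨k, rfl⟩ := fin k (by omega) (by omega)
      rw [u1, u1]
      exact h4 k (by rw [Fin.lt_def]; omega) (by rw [Fin.le_def]; omega)
    · intro k hk1 hk2
      obtain ⟨k, rfl⟩ := fin k (by omega) (by omega)
      rw [u1, u1]
      exact h5 k (by rw [Fin.le_def]; omega) (by rw [Fin.lt_def]; omega)
  · intro i h
    refine q5 _ (by omega) (by omega) ?_
    intro k hk1 hk2
    obtain ⟨k, rfl⟩ := fin k (by omega) (by omega)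
    rw [u1, u1]
    exact h k (by rw [Fin.lt_def]; omega)
  · intro i h
    refine q5' _ (by omega) (by omega) ?_
    intro k hk1 hk2
    obtain ⟨k, rfl⟩ := fin k (by omega) (by omega)
    rw [u1, u1]
    exact h k (by rw [Fin.lt_def]; omega)
  · intro i j
    rw [q8 _ _ (by omega) (by omega) (by omega) (by omega)]
    constructor
    · rintro ⟨g, ⟨g1, g2, g3⟩, g4, g5, g6⟩
      obtain ⟨b, rfl⟩ := fin g (by omega) (by omega)
      have hb' : b.val + 1 + 1 = (⟨b.val + 1, by omega⟩ : Fin n).val + 1 := rfl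
      rw [hb', u1, u1] at g3
      rw [u1, u1] at g5
      refine ⟨b, ⟨b.val + 1, by omega⟩, rfl, by rw [Fin.le_def]; omega,
        by rw [Fin.le_def]; simp only; omega, ?_, g3, g5, ?_⟩
      · intro k h1 h2
        have := g2 (k.val + 1) (by rw [Fin.lt_def] at h1; omega) (by rw [Fin.le_def] at h2; omega)
        rwa [u1, u1] at this
      · intro k h1 h2
        have := g6 (k.val + 1) (by rw [Fin.le_def] at h1; simp only at h1; omega)
          (by rw [Fin.lt_def] at h2; omega)
        rwa [u1, u1] at this
    · rintro ⟨b, b', hb, h1, h2, h3, h4, h5, h6⟩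
      have hb' : b.val + 1 + 1 = b'.val + 1 := by omega
      rw [Fin.le_def] at h1 h2
      refine ⟨b.val + 1, ⟨by omega, ?_, by rw [hb', u1, u1]; exact h4⟩, by omega,
        by rw [u1, u1]; exact h5, ?_⟩
      · intro k hk1 hk2
        obtain ⟨k, rfl⟩ := fin k (by omega) (by omega)
        rw [u1, u1]
        exact h3 k (by rw [Fin.lt_def]; omega) (by rw [Fin.le_def]; omega)
      · intro k hk1 hk2
        obtain ⟨k, rfl⟩ := fin k (by omega) (by omega)
        rw [u1, u1]
        exact h6 k (by rw [Fin.le_def]; omega) (by rw [Fin.lt_def]; omega)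
  · intro l i h1 h2 h3
    refine q7 _ _ (by omega) (by omega) (by omega) (by rw [u1, u1]; exact h2) ?_
    intro k k1 k2 k3 k4
    obtain ⟨k, rfl⟩ := fin k (by omega) (by omega)
    rw [u1, u1] at k3 k4
    obtain ⟨m, m1, m2, m3⟩ := h3 k (by rw [Fin.lt_def]; omega) k3 k4
    exact ⟨m.val + 1, by rw [Fin.lt_def] at m1; omega, by rw [Fin.lt_def] at m2; omega,
      by rw [u1, u1]; exact m3⟩

theorem side_cases {a b c d : Prop} (h1 : a ∨ b) (h2 : c ∨ d) (h3 : a ↔ c) :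
    (a ∧ c) ∨ (b ∧ d) := by
  tauto

/-- both coordinates of the construction -/
structure WtCon {n : ℕ} (w xl xr yb yt : Fin n → ℝ) : Prop where
  inj : Function.Injective w
  hx : Half (fun k => w k.rev) (fun k => xl k.rev) (fun k => xr k.rev)
  hy : Half w yb yt

namespace WtCon
variable {n : ℕ} {w xl xr yb yt : Fin n → ℝ}

theorem swap (h : WtCon w xl xr yb yt) : WtCon (fun k => w k.rev) (fun k => yb k.rev)
    (fun k => yt k.rev) (fun k => xl k.rev) (fun k => xr k.rev) where
  inj := h.inj.comp Fin.rev_injective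
  hx := by simpa only [Fin.rev_rev] using h.hy
  hy := h.hx

theorem x0 (h : WtCon w xl xr yb yt) (i : Fin n) : 0 ≤ xl i ∧ xl i < xr i ∧ xr i ≤ 1 := by
  simpa using h.hx.p0 i.rev

theorem x1 (h : WtCon w xl xr yb yt) (i k : Fin n) (hik : i < k) (hw : w i < w k) :
    xr i ≤ xl k := by
  have := h.hx.p1 i.rev k.rev (by simpa using hik) (by simpa using hw)
  simpa using this

theorem F (h : WtCon w xl xr yb yt) (i k : Fin n) (hw : w i < w k) :
    xr i ≤ xl k ∨ yt i ≤ yb k := by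
  rcases lt_trichotomy i k with h1 | h1 | h1
  · exact Or.inl (h.x1 i k h1 hw)
  · subst h1; exact (lt_irrefl _ hw).elim
  · exact Or.inr (h.hy.p1 i k h1 hw)

theorem x8 (h : WtCon w xl xr yb yt) (i j : Fin n) : xl j = xr i ↔ ∃ b b' : Fin n,
    b'.val = b.val + 1 ∧ i ≤ b ∧ b' ≤ j ∧ (∀ k, b' ≤ k → k < j → w j < w k) ∧ w b < w j ∧
    w i < w b' ∧ (∀ k, i < k → k ≤ b → w k < w i) := by
  have h8 := h.hx.p8 j.rev i.rev
  simp only [Fin.rev_rev] at h8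
  rw [h8]
  constructor
  · rintro ⟨b, b', hb, h1, h2, h3, h4, h5, h6⟩
    refine ⟨b'.rev, b.rev, by simp only [Fin.val_rev]; omega, Fin.le_rev_iff.2 h2,
      Fin.rev_le_iff.2 h1, ?_, h4, h5, ?_⟩
    · intro k h7 h8
      have := h3 k.rev (by simpa using h8) (Fin.rev_le_iff.1 h7 |> fun _ => by
        rw [Fin.rev_le_iff]; exact h7)
      simpa using this
    · intro k h7 h8
      have := h6 k.rev (by rw [Fin.le_rev_iff]; exact h8) (by simpa using h7)
      simpa using this
  · rintro ⟨b, b', hb, h1, h2, h3, h4, h5, h6⟩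
    refine ⟨b'.rev, b.rev, by simp only [Fin.val_rev]; omega, by simpa using h2,
      by simpa using h1, ?_, by simpa using h4, by simpa using h5, ?_⟩
    · intro k h7 h8
      exact h3 k.rev (by rw [Fin.le_rev_iff]; exact h8) (by rw [Fin.rev_lt_iff]; exact h7)
    · intro k h7 h8
      exact h6 k.rev (by rw [Fin.lt_rev_iff]; exact h8) (by rw [Fin.rev_le_iff]; exact h7)

theorem xlt (h : WtCon w xl xr yb yt) {i j : Fin n} (hij : xl j = xr i) : i < j := by
  obtain ⟨b, b', hb, h1, h2, _⟩ := (h.x8 i j).1 hij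
  rw [Fin.le_def] at h1 h2
  rw [Fin.lt_def]; omega

theorem ylt (h : WtCon w xl xr yb yt) {i j : Fin n} (hij : yb i = yt j) : i < j := by
  obtain ⟨b, b', hb, h1, h2, _⟩ := (h.hy.p8 i j).1 hij
  rw [Fin.le_def] at h1 h2
  rw [Fin.lt_def]; omega

theorem step (h : WtCon w xl xr yb yt) (i : Fin n) (hi : 0 < xl i) :
    ∃ l, w l < w i ∧ xr l = xl i ∧ yt i ≤ yt l := by
  have h1 : ∃ k, k < i ∧ w k < w i := by
    by_contra hcon
    push Not at hcon
    have := h.hx.p5' i.rev (by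
      intro k hk
      simp only [Fin.rev_rev]
      have hk' : k.rev < i := by rw [Fin.rev_lt_iff]; exact hk
      exact lt_of_le_of_ne (hcon _ hk') (fun e => by
        have := h.inj e
        rw [this] at hk'
        exact lt_irrefl _ hk'))
    simp only [Fin.rev_rev] at this
    linarith
  obtain ⟨b, hb, hbm⟩ := Finset.exists_max_image
    (Finset.univ.filter (fun k => k < i ∧ w k < w i)) id (by
      obtain ⟨k, hk⟩ := h1
      exact ⟨k, by simpa using hk⟩)
  simp only [Finset.mem_filter, Finset.mem_univ, true_and, id] at hb hbm
  obtain ⟨hbi, hbw⟩ := hb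
  have hgt : ∀ k, b < k → k < i → w i < w k := by
    intro k k1 k2
    by_contra hcon
    push Not at hcon
    have := hbm k ⟨k2, lt_of_le_of_ne hcon (fun e => k2.ne (h.inj e))⟩
    exact absurd this (not_le.2 k1)
  obtain ⟨l, hl, hlm⟩ := Finset.exists_max_image
    (Finset.univ.filter (fun k => k ≤ b ∧ ∀ m, k ≤ m → m ≤ b → w m < w i)) w (by
      refine ⟨b, ?_⟩
      simp only [Finset.mem_filter, Finset.mem_univ, true_and]
      refine ⟨le_rfl, fun m m1 m2 => ?_⟩
      rw [le_antisymm m2 m1]; exact hbw)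
  simp only [Finset.mem_filter, Finset.mem_univ, true_and] at hl hlm
  obtain ⟨hlb, hl2⟩ := hl
  have hli : w l < w i := hl2 l le_rfl hlb
  have hb' : b.val + 1 < n := by have := i.2; rw [Fin.lt_def] at hbi; omega
  refine ⟨l, hli, ?_, ?_⟩
  · symm
    rw [h.x8]
    refine ⟨b, ⟨b.val + 1, hb'⟩, rfl, hlb, by rw [Fin.lt_def] at hbi; rw [Fin.le_def]; exact hbi,
      ?_, hbw, ?_, ?_⟩
    · intro k k1 k2
      exact hgt k (by rw [Fin.le_def] at k1; rw [Fin.lt_def]; simp only at k1; omega) k2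
    · rcases eq_or_lt_of_le (show (⟨b.val + 1, hb'⟩ : Fin n) ≤ i by
        rw [Fin.lt_def] at hbi; rw [Fin.le_def]; exact hbi) with e | e
      · rw [e]; exact hli
      · exact hli.trans (hgt _ (by rw [Fin.lt_def]; simp only; omega) e)
    · intro k k1 k2
      exact lt_of_le_of_ne (hlm k ⟨k2, fun m m1 m2 => hl2 m (k1.le.trans m1) m2⟩)
        (fun e => k1.ne' (h.inj e))
  · apply h.hy.p7 l i (lt_of_le_of_lt hlb hbi) hli
    intro k k1 k2 k3
    have : ¬ (∀ m, k ≤ m → m ≤ b → w m < w i) := by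
      intro hall
      exact absurd (hlm k ⟨k1.le.trans hlb, hall⟩) (not_le.2 k2)
    push Not at this
    obtain ⟨m, m1, m2, m3⟩ := this
    refine ⟨m, lt_of_le_of_ne m1 ?_, ?_, lt_of_le_of_ne m3 ?_⟩
    · rintro rfl; linarith
    · by_contra hcon
      push Not at hcon
      have := hl2 m hcon m2
      linarith
    · intro e
      have := h.inj e
      rw [this] at hbi
      exact absurd m2 (not_le.2 hbi)

theorem stepy (h : WtCon w xl xr yb yt) (i : Fin n) (hi : 0 < yb i) :
    ∃ l, w l < w i ∧ yt l = yb i ∧ xr i ≤ xr l := by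
  obtain ⟨l, l1, l2, l3⟩ := h.swap.step i.rev (by simpa using hi)
  exact ⟨l.rev, by simpa using l1, by simpa using l2, by simpa using l3⟩

/-- the rectangulation of a weight -/
def rect (hn : 1 ≤ n) (h : WtCon w xl xr yb yt) : Rectangulation n where
  xl := xl
  xr := xr
  yb := yb
  yt := yt
  lt_x i := (h.x0 i).2.1
  lt_y i := (h.hy.p0 i).2.1
  xl_nonneg i := (h.x0 i).1
  xr_le_one i := (h.x0 i).2.2
  yb_nonneg i := (h.hy.p0 i).1
  yt_le_one i := (h.hy.p0 i).2.2
  interiors_disjoint i j hij := by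
    rintro ⟨p, ⟨a, b, c, d⟩, a', b', c', d'⟩
    rcases lt_or_gt_of_ne (fun e => hij (h.inj e) : w i ≠ w j) with hw | hw
    · rcases h.F i j hw with e | e <;> linarith
    · rcases h.F j i hw with e | e <;> linarith
  cover p h1 h2 h3 h4 := by
    obtain ⟨t, _, ht⟩ := Finset.exists_max_image Finset.univ w ⟨(⟨0, hn⟩ : Fin n), Finset.mem_univ _⟩
    have ht' : ∀ k, k ≠ t → w k < w t := fun k hk =>
      lt_of_le_of_ne (ht k (Finset.mem_univ _)) (fun e => hk (h.inj e))
    have t1 : yt t = 1 := h.hy.p5 t (fun k hk => ht' k hk.ne)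
    have t2 : xr t = 1 := by
      have := h.hx.p5 t.rev (fun k hk => by
        simp only [Fin.rev_rev]
        refine ht' _ ?_
        rintro rfl
        simp at hk)
      simpa using this
    obtain ⟨i, hi, him⟩ := Finset.exists_min_image
      (Finset.univ.filter (fun i => p.1 ≤ xr i ∧ p.2 ≤ yt i)) w
      ⟨t, by simp only [Finset.mem_filter, Finset.mem_univ, true_and, t1, t2]; exact ⟨h2, h4⟩⟩
    simp only [Finset.mem_filter, Finset.mem_univ, true_and] at hi him
    refine ⟨i, ?_, hi.1, ?_, hi.2⟩
    · by_contra hcon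
      push Not at hcon
      obtain ⟨l, l1, l2, l3⟩ := h.step i (by linarith)
      have := him l ⟨by linarith, by linarith [hi.2]⟩
      linarith
    · by_contra hcon
      push Not at hcon
      obtain ⟨l, l1, l2, l3⟩ := h.stepy i (by linarith)
      have := him l ⟨by linarith [hi.1], by linarith⟩
      linarith

theorem swap_rect (hn : 1 ≤ n) (h : WtCon w xl xr yb yt) : h.swap.rect hn = (h.rect hn).tr := rfl

theorem compat (hn : 1 ≤ n) (h : WtCon w xl xr yb yt) : (h.rect hn).Compat w where
  cT a b hab := by
    induction hab with
    | refl => exact le_rfl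
    | @tail r q _ hrq ih =>
      refine ih.trans ?_
      by_contra hcon
      push Not at hcon
      have a1 := h.x0 r
      have a2 := h.x0 q
      have a3 := h.hy.p0 r
      have a4 := h.hy.p0 q
      rcases hrq with ⟨e1, e2⟩ | ⟨e1, e2⟩ <;> simp only [rect] at e1 e2 <;>
        rcases h.F q r hcon with e | e <;> linarith
  cS a b hab := by
    induction hab with
    | refl => exact le_rfl
    | @tail r q _ hrq ih =>
      refine ih.trans ?_
      by_contra hcon
      push Not at hcon
      have a1 := h.x0 r
      have a2 := h.x0 q
      have a3 := h.hy.p0 r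
      have a4 := h.hy.p0 q
      rcases hrq with ⟨e1, e2⟩ | ⟨e1, e2⟩ <;> simp only [rect] at e1 e2 <;>
        rcases h.F q r hcon with e | e <;> linarith
  cV i j hij := by
    simp only [rect] at hij ⊢
    have hlt := h.xlt hij.symm
    constructor
    · intro hw
      obtain ⟨b, b', hb, h1, h2, h3, h4, h5, h6⟩ := (h.x8 i j).1 hij.symm
      exact h.hy.p2 i j b b' hb hw h1 h2 h6 h3 h5 h4
    · intro hy
      by_contra hcon
      push Not at hcon
      have := h.hy.p1 j i hlt (lt_of_le_of_ne hcon (fun e => hlt.ne' (h.inj e)))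
      linarith

theorem o3a (hn : 1 ≤ n) (h : WtCon w xl xr yb yt) (b b' : Fin n) (hb : b'.val = b.val + 1)
    (hw : w b < w b') : (h.rect hn).DirRightOf b' b := by
  have hX : xl b' = xr b := by
    rw [h.x8]
    refine ⟨b, b', hb, le_rfl, le_rfl, fun k k1 k2 => absurd k1 (not_le.2 k2), hw, hw,
      fun k k1 k2 => absurd k1 (not_lt.2 k2)⟩
  have a1 := h.x0 b
  have a2 := h.x0 b'
  have a3 := h.hy.p0 b
  have a4 := h.hy.p0 b'
  refine ⟨hX, ?_, ?_, ?_⟩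
  · change 0 < xl b'
    linarith
  · change xl b' < 1
    linarith
  · intro y y1 y2
    change min (yb b') (yb b) ≤ y at y1
    change y ≤ max (yt b') (yt b) at y2
    change (h.rect hn).OnVertEdge (xl b', y)
    by_contra hno
    have key : ∀ i, (xl b' = xl i ∨ xl b' = xr i) → yb i ≤ y → y ≤ yt i → False :=
      fun i e1 e2 e3 => hno ⟨i, e1, e2, e3⟩
    have y0 : 0 ≤ y := le_trans (le_min a4.1 a3.1) y1
    have y3 : y ≤ 1 := le_trans y2 (max_le a4.2.2 a3.2.2)
    obtain ⟨i, i1, i2, i3, i4⟩ := (h.rect hn).cover (xl b', y) a2.1 (by simp only; linarith) y0 y3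
    simp only [rect] at i1 i2 i3 i4
    have j1 : xl i < xl b' := lt_of_le_of_ne i1 (fun e => key i (Or.inl e.symm) i3 i4)
    have j2 : xl b' < xr i := lt_of_le_of_ne i2 (fun e => key i (Or.inr e) i3 i4)
    have n1 : i ≠ b := by rintro rfl; linarith
    have n2 : i ≠ b' := by rintro rfl; linarith
    rcases lt_or_gt_of_ne n1 with l1 | l1
    · have l2 : i < b' := by rw [Fin.lt_def] at l1 ⊢; omega
      have e1 : w b < w i := by
        by_contra hcon
        push Not at hcon
        have := h.x1 i b l1 (lt_of_le_of_ne hcon (fun e => n1 (h.inj e)))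
        linarith
      have e2 : w b' < w i := by
        by_contra hcon
        push Not at hcon
        have := h.x1 i b' l2 (lt_of_le_of_ne hcon (fun e => n2 (h.inj e)))
        linarith
      have f1 := h.hy.p1 b i l1 e1
      have f2 := h.hy.p1 b' i l2 e2
      rcases le_max_iff.1 y2 with g | g
      · exact key b' (Or.inl rfl) (by linarith) g
      · exact key b (Or.inr hX) (by linarith) g
    · have l2 : b' < i := lt_of_le_of_ne (by rw [Fin.lt_def] at l1; rw [Fin.le_def]; omega) n2.symm
      have e1 : w i < w b := by
        by_contra hcon
        push Not at hcon
        have := h.x1 b i l1 (lt_of_le_of_ne hcon (fun e => n1 (h.inj e).symm))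
        linarith
      have e2 : w i < w b' := by
        by_contra hcon
        push Not at hcon
        have := h.x1 b' i l2 (lt_of_le_of_ne hcon (fun e => n2 (h.inj e).symm))
        linarith
      have f1 := h.hy.p1 i b l1 e1
      have f2 := h.hy.p1 i b' l2 e2
      rcases min_le_iff.1 y1 with g | g
      · exact key b' (Or.inl rfl) g (by linarith)
      · exact key b (Or.inr hX) g (by linarith)

theorem generic (hn : 1 ≤ n) (h : WtCon w xl xr yb yt) : (h.rect hn).Generic := by
  rintro ⟨p, i, j, k, l, h1, h2, h3, h4, h5, h6, a, b, c, d⟩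
  let f : Fin n → Bool × Bool := fun i => (decide (p.1 = xl i), decide (p.2 = yb i))
  have hf : ∀ i j, i ≠ j → (h.rect hn).IsCorner i p → (h.rect hn).IsCorner j p → f i ≠ f j := by
    intro i j hij hi hj hfe
    have a1 := h.x0 i
    have a2 := h.x0 j
    have a3 := h.hy.p0 i
    have a4 := h.hy.p0 j
    simp only [f, Prod.mk.injEq, decide_eq_decide] at hfe
    obtain ⟨e1, e2⟩ := hfe
    obtain ⟨p1, p2⟩ := hi
    obtain ⟨q1, q2⟩ := hj
    simp only [rect] at p1 p2 q1 q2
    have ex : (p.1 = xl i ∧ p.1 = xl j) ∨ (p.1 = xr i ∧ p.1 = xr j) :=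
      side_cases p1 q1 e1
    have ey : (p.2 = yb i ∧ p.2 = yb j) ∨ (p.2 = yt i ∧ p.2 = yt j) :=
      side_cases p2 q2 e2
    rcases lt_or_gt_of_ne (fun e => hij (h.inj e) : w i ≠ w j) with hw | hw
    · rcases h.F i j hw with e | e
      · rcases ex with ex | ex <;> linarith
      · rcases ey with ex | ex <;> linarith
    · rcases h.F j i hw with e | e
      · rcases ex with ex | ex <;> linarith
      · rcases ey with ex | ex <;> linarith
  let v : Fin 4 → Fin n := ![i, j, k, l]
  have hv : ∀ m, (h.rect hn).IsCorner (v m) p := by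
    intro m; fin_cases m
    · exact a
    · exact b
    · exact c
    · exact d
  have hvi : Function.Injective v := by
    intro m m' hm
    clear hv hf a b c d
    fin_cases m <;> fin_cases m' <;> simp [v] at hm ⊢ <;> simp_all
  have hbij : Function.Bijective (fun m => f (v m)) := by
    rw [Fintype.bijective_iff_injective_and_card]
    refine ⟨fun m m' hm => ?_, by simp⟩
    by_contra hne
    exact hf _ _ (fun e => hne (hvi e)) (hv m) (hv m') hm
  obtain ⟨m, hm⟩ := hbij.2 (true, true)
  obtain ⟨m', hm'⟩ := hbij.2 (false, false)
  simp only [f, Prod.mk.injEq, decide_eq_true_eq, decide_eq_false_iff_not] at hm hm'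
  obtain ⟨q1, q2⟩ := hv m'
  simp only [rect] at q1 q2
  have r1 := q1.resolve_left hm'.1
  have r2 := q2.resolve_left hm'.2
  have s1 : v m' < v m := h.xlt (hm.1.symm.trans r1)
  have s2 : v m < v m' := h.ylt (hm.2.symm.trans r2)
  exact absurd s1 (not_lt.2 s2.le)

theorem inorder (hn : 1 ≤ n) (h : WtCon w xl xr yb yt) : (h.rect hn).InorderLabeled := by
  intro i j
  constructor
  · intro hij
    have g1 : ∀ a b, (h.rect hn).RightOf a b → b < a := by
      intro a b hab
      induction hab with
      | single e => exact h.xlt e.1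
      | tail _ e ih => exact (h.xlt e.1).trans ih
    have g2 : ∀ a b, (h.rect hn).Above a b → a < b := by
      intro a b hab
      induction hab with
      | single e => exact h.ylt e.1
      | tail _ e ih => exact ih.trans (h.ylt e.1)
    have g3 : ∀ a b, ((h.rect hn).RightOf b a ∨ (h.rect hn).Above a b) → a < b := by
      rintro a b (e | e)
      · exact g1 _ _ e
      · exact g2 _ _ e
    induction hij with
    | single e => exact g3 _ _ e
    | tail _ e ih => exact ih.trans (g3 _ _ e)
  · have o3 : ∀ b b' : Fin n, b'.val = b.val + 1 →
        ((h.rect hn).RightOf b' b ∨ (h.rect hn).Above b b') := by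
      intro b b' hb
      rcases lt_or_gt_of_ne (show w b ≠ w b' from fun e => by
        have := h.inj e; rw [this] at hb; omega) with hw | hw
      · exact Or.inl (.single (h.o3a hn b b' hb hw))
      · refine Or.inr (.single ?_)
        have := h.swap.o3a hn b'.rev b.rev (by simp only [Fin.val_rev]; omega) (by simpa using hw)
        rw [swap_rect, Rectangulation.tr_dirRight] at this
        simpa using this
    intro hij
    obtain ⟨d, hd⟩ : ∃ d, j.val = i.val + d + 1 := ⟨j.val - i.val - 1, by
      rw [Fin.lt_def] at hij; omega⟩
    clear hij
    induction d generalizing j with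
    | zero => exact .single (o3 i j hd)
    | succ d ih =>
      exact .tail (ih ⟨i.val + d + 1, by omega⟩ rfl) (o3 _ j hd)

end WtCon

theorem construction {n : ℕ} (hn : 1 ≤ n) (w : Fin n → ℝ) (hw : Function.Injective w) :
    ∃ R : Rectangulation n, R.Generic ∧ R.InorderLabeled ∧ R.Compat w ∧
      R.tr.Compat (fun k => w k.rev) := by
  obtain ⟨yb, yt, hy⟩ := half_exists hn w hw
  obtain ⟨xb, xt, hx⟩ := half_exists hn (fun k => w k.rev) (hw.comp Fin.rev_injective)
  have h : WtCon w (fun k => xb k.rev) (fun k => xt k.rev) yb yt :=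
    ⟨hw, by simpa only [Fin.rev_rev] using hx, hy⟩
  exact ⟨h.rect hn, h.generic hn, h.inorder hn, h.compat hn, h.swap.compat hn⟩


/-- Theorem: realization of the strong rectangulotope `SRP(n)`.
The convex hull of the points
`Σ_{i<j} (𝓎_{i,j} − 𝓎'_{i,j})·(e_i − e_j)` with
`𝓎_{i,j} = h^T_i · cv^{T,S}_{i,j} · h^S_j · ⟦¬ i‖j⟧` and
`𝓎'_{i,j} = v^S_i · ch^{S,T}_{i,j} · v^T_j · ⟦¬ i⦀j⟧`,
over all generic (inorder-labeled) rectangulations `R` of size `n`, coincides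
with the set of `x ∈ ℝ^n` with `Σ_i x_i = 0` and `Σ_{i ∈ X} x_i ≤ f_⥮(X)` for
every nonempty proper subset `X ⊊ [n]`. -/
theorem strong_rectangulotope_realization (n : ℕ) (hn : 1 ≤ n) :
    convexHull ℝ {x : Fin n → ℝ |
        ∃ R : Rectangulation n, R.Generic ∧ R.InorderLabeled ∧
          x = ∑ p ∈ Finset.univ.filter (fun p : Fin n × Fin n => p.1 < p.2),
            ((((R.hT p.1 * R.cv p.1 p.2 * R.hS p.2 : ℕ) : ℝ) *
                (if R.VertPattern p.1 p.2 then 0 else 1) -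
              ((R.vS p.1 * R.ch p.1 p.2 * R.vT p.2 : ℕ) : ℝ) *
                (if R.HorPattern p.1 p.2 then 0 else 1)) •
              (stdVec n p.1 - stdVec n p.2))} =
      {x : Fin n → ℝ | (∑ i, x i) = 0 ∧
        ∀ X : Finset (Fin n), X.Nonempty → X ≠ Finset.univ →
          (∑ i ∈ X, x i) ≤ (fStrong n X : ℝ)} := by
  exact main_of_construction n (fun w hw => construction hn w hw)

end
end

section
/- For every n ≥ 1, the Minkowski sum, over all intervals I of [n] with |I| ≥ 2, of the simplices conv{e_i : i ∈ I} and conv{−e_i : i ∈ I} (which are translates of the shard polytopes SP(↑I) and SP(↓I) of the up and down arcs), equals the set of x ∈ ℝ^n with Σ_{i∈[n]} x_i = 0 and, for every nonempty proper subset X ⊊ [n], Σ_{i∈X} x_i ≤ #{I interval of [n] : I ⊄ X and I ⊄ [n]∖X}. This polytope realizes the weak rectangulotope WRP(n). -/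
open Classical Pointwise

noncomputable section

theorem abel_aux {n : ℕ} (y : Fin n → ℝ) (hy : ∑ i, y i = 0) (S : Finset ℝ) :
    ∀ c : Fin n → ℝ, (∀ i, c i ∈ S) →
      (∀ t : ℝ, 0 ≤ ∑ i ∈ Finset.univ.filter (fun i => t ≤ c i), y i) →
      0 ≤ ∑ i, c i * y i := by
  induction S using Finset.induction_on_max with
  | empty =>
    intro c hc _
    refine Finset.sum_nonneg fun i _ => ?_
    exact absurd (hc i) (by simp)
  | insert m S' hm ih =>
    intro c hc ht
    rcases S'.eq_empty_or_nonempty with rfl | hne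
    · have : ∀ i, c i = m := fun i => by simpa using hc i
      simp [this, ← Finset.mul_sum, hy]
    · set m' := S'.max' hne with hm'
      have hm'S : m' ∈ S' := S'.max'_mem hne
      have hlt : m' < m := hm _ hm'S
      have h1 : 0 ≤ ∑ i, min (c i) m' * y i := by
        apply ih
        · intro i
          rcases Finset.mem_insert.1 (hc i) with h | h
          · rw [h, min_eq_right hlt.le]; exact hm'S
          · rw [min_eq_left (S'.le_max' _ h)]; exact h
        · intro t
          by_cases h : t ≤ m'
          · simpa [h] using ht t
          · simp [h]
      have h2 : ∑ i, c i * y i = ∑ i, min (c i) m' * y i +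
          (m - m') * ∑ i ∈ Finset.univ.filter (fun i => m ≤ c i), y i := by
        rw [Finset.sum_filter, Finset.mul_sum, ← Finset.sum_add_distrib]
        refine Finset.sum_congr rfl fun i _ => ?_
        rcases Finset.mem_insert.1 (hc i) with h | h
        · rw [h, min_eq_right hlt.le]; simp; ring
        · rw [min_eq_left (S'.le_max' _ h), if_neg (not_le.2 (hm _ h))]; simp
      rw [h2]
      have := mul_nonneg (sub_nonneg.2 hlt.le) (ht m)
      linarith

theorem fWeak_eq (n : ℕ) (X : Finset (Fin n)) :
    (fWeak n X : ℝ) =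
      ∑ I ∈ Finset.univ.filter (fun I : Finset (Fin n) => IsInterval I ∧ 2 ≤ I.card),
        (if ¬ I ⊆ X ∧ ¬ I ⊆ Xᶜ then (1 : ℝ) else 0) := by
  rw [Finset.sum_boole, fWeak, ← Set.ncard_coe_finset]
  congr 2
  ext I
  simp only [Set.mem_ofPred_eq, Finset.coe_filter, Finset.mem_filter, Finset.mem_univ, true_and]
  constructor
  · rintro ⟨h1, h2, h3⟩
    refine ⟨⟨h1, ?_⟩, h2, h3⟩
    obtain ⟨a, ha, ha'⟩ := Finset.not_subset.1 h2
    obtain ⟨b, hb, hb'⟩ := Finset.not_subset.1 h3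
    have : 1 < I.card := Finset.one_lt_card.2 ⟨a, ha, b, hb, by rintro rfl; simp_all⟩
    omega
  · rintro ⟨⟨h1, _⟩, h2, h3⟩
    exact ⟨h1, h2, h3⟩

theorem sum_stdVec {n : ℕ} (X : Finset (Fin n)) (p : Fin n) :
    ∑ i ∈ X, stdVec n p i = if p ∈ X then 1 else 0 := by
  simp [stdVec]

/-- the Minkowski sum, over all intervals `I` of `[n]` with
`|I| ≥ 2`, of the simplices `conv{e_i : i ∈ I}` and `conv{−e_i : i ∈ I}`
(translates of the shard polytopes of the up and down arcs) equals the
H-description of the weak rectangulotope `WRP(n)`. -/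
theorem weak_rectangulotope_minkowski (n : ℕ) (hn : 1 ≤ n) :
    (∑ I ∈ Finset.univ.filter (fun I : Finset (Fin n) => IsInterval I ∧ 2 ≤ I.card),
        (convexHull ℝ {x : Fin n → ℝ | ∃ i ∈ I, x = stdVec n i} +
          convexHull ℝ {x : Fin n → ℝ | ∃ i ∈ I, x = - stdVec n i})) =
      {x : Fin n → ℝ | (∑ i, x i) = 0 ∧
        ∀ X : Finset (Fin n), X.Nonempty → X ≠ Finset.univ →
          (∑ i ∈ X, x i) ≤ (fWeak n X : ℝ)} := by
  have hvs : ∀ (T : Finset (Finset (Fin n))) (p q : Finset (Fin n) → Fin n)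
      (X : Finset (Fin n)),
      ∑ i ∈ X, (∑ I ∈ T, (stdVec n (p I) + -stdVec n (q I))) i =
        ∑ I ∈ T, ((if p I ∈ X then (1 : ℝ) else 0) - (if q I ∈ X then 1 else 0)) := by
    intro T p q X
    simp only [Finset.sum_apply, Pi.add_apply, Pi.neg_apply]
    rw [Finset.sum_comm]
    refine Finset.sum_congr rfl fun I _ => ?_
    rw [Finset.sum_add_distrib, Finset.sum_neg_distrib, sum_stdVec, sum_stdVec, sub_eq_add_neg]
  have hS : (∑ I ∈ Finset.univ.filter (fun I : Finset (Fin n) => IsInterval I ∧ 2 ≤ I.card),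
        (convexHull ℝ {x : Fin n → ℝ | ∃ i ∈ I, x = stdVec n i} +
          convexHull ℝ {x : Fin n → ℝ | ∃ i ∈ I, x = - stdVec n i})) =
      convexHull ℝ (∑ I ∈ Finset.univ.filter
        (fun I : Finset (Fin n) => IsInterval I ∧ 2 ≤ I.card),
        ({x : Fin n → ℝ | ∃ i ∈ I, x = stdVec n i} +
          {x : Fin n → ℝ | ∃ i ∈ I, x = - stdVec n i})) := by
    rw [convexHull_sum]
    refine Finset.sum_congr rfl fun I _ => ?_
    rw [convexHull_add]
  rw [hS]
  apply Set.Subset.antisymm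
  · apply convexHull_min
    · intro v hv
      obtain ⟨g, hg, rfl⟩ := (Set.mem_finsetSum _ _ _).1 hv
      have hg' : ∀ I : Finset (Fin n), ∃ p q : Fin n, I ∈ Finset.univ.filter
          (fun I : Finset (Fin n) => IsInterval I ∧ 2 ≤ I.card) →
          p ∈ I ∧ q ∈ I ∧ g I = stdVec n p + -stdVec n q := by
        intro I
        by_cases h : I ∈ Finset.univ.filter
          (fun I : Finset (Fin n) => IsInterval I ∧ 2 ≤ I.card)
        · obtain ⟨_, ⟨p, hp, rfl⟩, _, ⟨q, hq, rfl⟩, h2⟩ := Set.mem_add.1 (hg h)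
          exact ⟨p, q, fun _ => ⟨hp, hq, h2.symm⟩⟩
        · exact ⟨⟨0, hn⟩, ⟨0, hn⟩, fun h' => absurd h' h⟩
      choose p q hpq using hg'
      rw [Finset.sum_congr rfl fun I hI => (hpq I hI).2.2]
      refine ⟨?_, fun X _ _ => ?_⟩
      · rw [hvs]; simp
      · rw [hvs, fWeak_eq]
        refine Finset.sum_le_sum fun I hI => ?_
        obtain ⟨hp, hq, _⟩ := hpq I hI
        by_cases h1 : p I ∈ X
        · by_cases h2 : q I ∈ X
          · simp only [h1, h2, if_true, sub_self]; split_ifs <;> norm_num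
          · have h3 : ¬ I ⊆ X := fun h => h2 (h hq)
            have h4 : ¬ I ⊆ Xᶜ := fun h => by simpa [h1] using h hp
            simp [h1, h2, h3, h4]
        · simp only [h1, if_false]; split_ifs <;> norm_num
    · rintro x ⟨hx0, hx⟩ z ⟨hz0, hz⟩ a b ha hb hab
      have hl : ∀ X : Finset (Fin n), ∑ i ∈ X, (a • x + b • z) i =
          a * ∑ i ∈ X, x i + b * ∑ i ∈ X, z i := by
        intro X
        simp [Finset.sum_add_distrib, Finset.mul_sum]
      refine ⟨by rw [hl, hx0, hz0]; simp, fun X h1 h2 => ?_⟩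
      rw [hl]
      have e1 := mul_le_mul_of_nonneg_left (hx X h1 h2) ha
      have e2 := mul_le_mul_of_nonneg_left (hz X h1 h2) hb
      have e3 : a * (fWeak n X : ℝ) + b * fWeak n X = fWeak n X := by rw [← add_mul, hab, one_mul]
      linarith
  · rintro x ⟨hx0, hx⟩
    by_contra hxS
    have hfin : (∑ I ∈ Finset.univ.filter
        (fun I : Finset (Fin n) => IsInterval I ∧ 2 ≤ I.card),
        ({x : Fin n → ℝ | ∃ i ∈ I, x = stdVec n i} +
          {x : Fin n → ℝ | ∃ i ∈ I, x = - stdVec n i})).Finite := by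
      refine Finset.sum_induction _ Set.Finite (fun _ _ h h' => h.add h') (by simp) ?_
      intro I _
      refine Set.Finite.add ?_ ?_
      · refine (Set.finite_range (fun i => stdVec n i)).subset ?_
        rintro _ ⟨i, _, rfl⟩; exact ⟨i, rfl⟩
      · refine (Set.finite_range (fun i => -stdVec n i)).subset ?_
        rintro _ ⟨i, _, rfl⟩; exact ⟨i, rfl⟩
    obtain ⟨f, u, hf, hu⟩ := geometric_hahn_banach_closed_point (convex_convexHull ℝ _)
      (hfin.isCompact_convexHull ℝ).isClosed hxS
    set c : Fin n → ℝ := fun i => f (stdVec n i) with hc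
    have hfc : ∀ v : Fin n → ℝ, f v = ∑ i, c i * v i := by
      intro v
      have : v = ∑ i, v i • stdVec n i := by
        ext k
        simp [stdVec]
      conv_lhs => rw [this]
      rw [map_sum]
      refine Finset.sum_congr rfl fun i _ => ?_
      rw [map_smul, smul_eq_mul, mul_comm]
    have hex : ∀ I : Finset (Fin n), ∃ p q : Fin n, I.Nonempty →
        p ∈ I ∧ q ∈ I ∧ (∀ i ∈ I, c i ≤ c p) ∧ (∀ i ∈ I, c q ≤ c i) := by
      intro I
      by_cases h : I.Nonempty
      · obtain ⟨p, hp, hp'⟩ := I.exists_max_image c h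
        obtain ⟨q, hq, hq'⟩ := I.exists_min_image c h
        exact ⟨p, q, fun _ => ⟨hp, hq, hp', hq'⟩⟩
      · exact ⟨⟨0, hn⟩, ⟨0, hn⟩, fun h' => absurd h' h⟩
    choose p q hpq using hex
    set v : Fin n → ℝ := ∑ I ∈ Finset.univ.filter
        (fun I : Finset (Fin n) => IsInterval I ∧ 2 ≤ I.card),
        (stdVec n (p I) + -stdVec n (q I)) with hv
    have hvS := hf v (subset_convexHull ℝ _ (by
      rw [Set.mem_finsetSum]
      refine ⟨_, fun {I} hI => ?_, hv.symm⟩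
      obtain ⟨h1, h2, _⟩ := hpq I (Finset.mem_filter.1 hI).2.1.1
      exact Set.add_mem_add ⟨_, h1, rfl⟩ ⟨_, h2, rfl⟩))
    have hv0 : ∑ i, v i = 0 := by rw [hv, hvs]; simp
    have key : 0 ≤ ∑ i, c i * (v i - x i) := by
      refine abel_aux (fun i => v i - x i) ?_ (Finset.univ.image c) c (by simp) ?_
      · rw [Finset.sum_sub_distrib, hv0, hx0, sub_zero]
      · intro t
        set X := Finset.univ.filter (fun i => t ≤ c i) with hX
        rw [Finset.sum_sub_distrib]
        rcases X.eq_empty_or_nonempty with h | h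
        · simp [h]
        by_cases h' : X = Finset.univ
        · rw [h', hv0, hx0, sub_zero]
        have hle := hx X h h'
        have heq : ∑ i ∈ X, v i = fWeak n X := by
          rw [hv, hvs, fWeak_eq]
          refine Finset.sum_congr rfl fun I hI => ?_
          obtain ⟨h1, h2, h3, h4⟩ := hpq I (Finset.mem_filter.1 hI).2.1.1
          have e1 : p I ∈ X ↔ ¬ I ⊆ Xᶜ := by
            constructor
            · intro h5 h6
              simpa [h5] using h6 h1
            · intro h5
              obtain ⟨b, hb, hb'⟩ := Finset.not_subset.1 h5
              have : t ≤ c b := by simpa [hX] using hb'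
              simpa [hX] using this.trans (h3 b hb)
          have e2 : q I ∈ X ↔ I ⊆ X := by
            constructor
            · intro h5 b hb
              have : t ≤ c (q I) := by simpa [hX] using h5
              simpa [hX] using this.trans (h4 b hb)
            · intro h5; exact h5 h2
          have e3 : q I ∈ X → p I ∈ X := by
            intro h5
            exact (e2.1 h5) h1
          simp only [← e1, ← e2]
          by_cases h5 : p I ∈ X <;> by_cases h6 : q I ∈ X
          · simp [h5, h6]
          · simp [h5, h6]
          · exact absurd (e3 h6) h5
          · simp [h5, h6]
        linarith
    rw [hfc] at hu hvS
    simp only [mul_sub, Finset.sum_sub_distrib] at key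
    linarith

end
end

section
/- For all nonempty consecutive intervals I, J of [n], the shard polytope SP(yang(I,J)) of the yang arc equals the translate of conv({0} ∪ {e_j − e_i : i ∈ I, j ∈ J}) by the vector e_{min(I)} − e_{max(J)}. -/
open Classical Pointwise

noncomputable section

/-- An `α`-alternating matching for the arc `α = (a, b, A, B)`: a (possibly
empty) sequence `a ≤ i₁ < j₁ < i₂ < j₂ < ⋯ < i_q < j_q ≤ b` with
`i_p ∈ {a} ∪ A` and `j_p ∈ B ∪ {b}`, recorded as the list of pairs `(i_p, j_p)`. -/
def AltMatching {n : ℕ} (a b : Fin n) (A B : Finset (Fin n))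
    (M : List (Fin n × Fin n)) : Prop :=
  (∀ p ∈ M, p.1 ∈ insert a A ∧ p.2 ∈ insert b B ∧ p.1 < p.2) ∧
    M.Chain' (fun p q => p.2 < q.1)

/-- The shard polytope of the arc `(a, b, A, B)`: the convex hull of the
characteristic vectors `Σ_p (e_{i_p} − e_{j_p})` of all alternating matchings. -/
def SP (n : ℕ) (a b : Fin n) (A B : Finset (Fin n)) : Set (Fin n → ℝ) :=
  convexHull ℝ {x : Fin n → ℝ | ∃ M : List (Fin n × Fin n),
    AltMatching a b A B M ∧ x = (M.map (fun p => stdVec n p.1 - stdVec n p.2)).sum}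

theorem yang_points_eq {n : ℕ} (I J : Finset (Fin n)) (a b : Fin n) (haI : a ∈ I) (hbJ : b ∈ J)
    (ha : ∀ i ∈ I, a ≤ i) (hb : ∀ j ∈ J, j ≤ b) (hIJ : ∀ i ∈ I, ∀ j ∈ J, i < j) :
    {x : Fin n → ℝ | ∃ M : List (Fin n × Fin n),
      AltMatching a b (J.erase b) (I.erase a) M ∧
        x = (M.map (fun p => stdVec n p.1 - stdVec n p.2)).sum} =
    (fun y => y + (stdVec n a - stdVec n b)) ''
      (insert 0 {x : Fin n → ℝ | ∃ i ∈ I, ∃ j ∈ J, x = stdVec n j - stdVec n i}) := by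
  have hab : a < b := hIJ a haI b hbJ
  ext x
  simp only [Set.mem_setOf_eq, Set.mem_image, Set.mem_insert_iff]
  constructor
  · rintro ⟨M, ⟨hM, hch⟩, rfl⟩
    have hpair : ∀ p ∈ M, (p.1 = a ∧ p.2 = b) ∨ (p.1 = a ∧ p.2 ∈ I ∧ p.2 ≠ a) ∨
        (p.1 ∈ J ∧ p.1 ≠ b ∧ p.2 = b) := by
      intro p hp
      obtain ⟨h1, h2, h3⟩ := hM p hp
      simp only [Finset.mem_insert, Finset.mem_erase] at h1 h2
      rcases h1 with h1 | ⟨h1, h1'⟩ <;> rcases h2 with h2 | ⟨h2, h2'⟩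
      · exact Or.inl ⟨h1, h2⟩
      · exact Or.inr (Or.inl ⟨h1, h2', h2⟩)
      · exact Or.inr (Or.inr ⟨h1', h1, h2⟩)
      · exact absurd (hIJ _ h2' _ h1') (not_lt.mpr h3.le)
    have hle : ∀ p ∈ M, p.1 < b := by
      intro p hp
      rcases hpair p hp with h | h | h
      · rw [h.1]; exact hab
      · rw [h.1]; exact hab
      · exact lt_of_le_of_ne (hb _ h.1) h.2.1
    match M, hM, hch, hpair, hle with
    | [], _, _, _, _ =>
      exact ⟨stdVec n b - stdVec n a, Or.inr ⟨a, haI, b, hbJ, rfl⟩, by simp⟩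
    | [p], _, _, hpair, _ =>
      rcases hpair p (by simp) with ⟨h1, h2⟩ | ⟨h1, h2, h3⟩ | ⟨h1, h2, h3⟩
      · exact ⟨0, Or.inl rfl, by simp [h1, h2]⟩
      · exact ⟨stdVec n b - stdVec n p.2, Or.inr ⟨_, h2, b, hbJ, rfl⟩, by simp [h1]⟩
      · exact ⟨stdVec n p.1 - stdVec n a, Or.inr ⟨a, haI, _, h1, rfl⟩, by simp [h3]⟩
    | p :: q :: t, _, hch, hpair, hle =>
      have hch' := List.isChain_cons_cons.mp hch
      have hpq : p.2 < q.1 := hch'.1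
      have hqb := hle q (by simp)
      have hp : p.1 = a ∧ p.2 ∈ I ∧ p.2 ≠ a := by
        rcases hpair p (by simp) with h | h | h
        · exact absurd (h.2 ▸ hpq) (not_lt.mpr hqb.le)
        · exact h
        · exact absurd (h.2.2 ▸ hpq) (not_lt.mpr hqb.le)
      have hqa : q.1 ≠ a := fun h => absurd (h ▸ hpq) (not_lt.mpr (ha _ hp.2.1))
      have hq : q.1 ∈ J ∧ q.1 ≠ b ∧ q.2 = b := by
        rcases hpair q (by simp) with h | h | h
        · exact absurd h.1 hqa
        · exact absurd h.1 hqa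
        · exact h
      match t, hch', hle with
      | [], _, _ =>
        refine ⟨stdVec n q.1 - stdVec n p.2, Or.inr ⟨_, hp.2.1, _, hq.1, rfl⟩, ?_⟩
        simp [hp.1, hq.2.2]
        abel
      | r :: t, hch', hle =>
        have h3 : q.2 < r.1 := (List.isChain_cons_cons.mp hch'.2).1
        have hr := hle r (by simp)
        rw [hq.2.2] at h3
        exact absurd h3 (not_lt.mpr hr.le)
  · rintro ⟨y, rfl | ⟨i, hi, j, hj, rfl⟩, rfl⟩
    · exact ⟨[(a, b)], ⟨by simp [hab], List.isChain_singleton _⟩, by simp⟩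
    · by_cases hia : i = a <;> by_cases hjb : j = b
      · exact ⟨[], ⟨by simp, List.isChain_nil⟩, by simp [hia, hjb]⟩
      · refine ⟨[(j, b)], ⟨?_, List.isChain_singleton _⟩, by simp [hia]⟩
        simp [hj, hjb, lt_of_le_of_ne (hb j hj) hjb]
      · refine ⟨[(a, i)], ⟨?_, List.isChain_singleton _⟩, by simp [hjb]⟩
        simp [hi, hia, lt_of_le_of_ne (ha i hi) (Ne.symm hia)]
      · refine ⟨[(a, i), (j, b)], ⟨?_, ?_⟩, ?_⟩
        · simp [hi, hia, lt_of_le_of_ne (ha i hi) (Ne.symm hia), hj, hjb,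
            lt_of_le_of_ne (hb j hj) hjb]
        · exact List.isChain_cons_cons.mpr ⟨hIJ i hi j hj, List.isChain_singleton _⟩
        · simp
          abel

/-- the shard polytope of the yang arc
`yang(I,J) = (min I, max J, J∖{max J}, I∖{min I})` equals the translate of
`conv({0} ∪ {e_j − e_i : i ∈ I, j ∈ J})` by the vector `e_{min I} − e_{max J}`. -/
theorem yang_shard_polytope (n : ℕ) (I J : Finset (Fin n))
    (hI : IsInterval I) (hJ : IsInterval J)
    (hc : (I.max' hI.1 : ℕ) + 1 = (J.min' hJ.1 : ℕ)) :
    SP n (I.min' hI.1) (J.max' hJ.1) (J.erase (J.max' hJ.1)) (I.erase (I.min' hI.1)) =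
      (fun y => y + (stdVec n (I.min' hI.1) - stdVec n (J.max' hJ.1))) ''
        convexHull ℝ
          (insert 0 {x : Fin n → ℝ | ∃ i ∈ I, ∃ j ∈ J, x = stdVec n j - stdVec n i}) := by
  rw [SP, yang_points_eq I J _ _ (I.min'_mem _) (J.max'_mem _) (fun i hi => I.min'_le i hi)
    (fun j hj => J.le_max' j hj)]
  · have h := AffineMap.image_convexHull (𝕜 := ℝ)
      (AffineMap.id ℝ (Fin n → ℝ) + AffineMap.const ℝ (Fin n → ℝ)
        (stdVec n (I.min' hI.1) - stdVec n (J.max' hJ.1)))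
      (insert 0 {x : Fin n → ℝ | ∃ i ∈ I, ∃ j ∈ J, x = stdVec n j - stdVec n i})
    exact h.symm
  · intro i hi j hj
    have h1 : (i : ℕ) ≤ (I.max' hI.1 : ℕ) := I.le_max' i hi
    have h2 : (J.min' hJ.1 : ℕ) ≤ (j : ℕ) := J.min'_le j hj
    exact Fin.lt_def.mpr (by omega)

end
end
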